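/- arXiv:2003.05180 — 8 statements merged into one kernel-verified Lean document; each statement's English description precedes it below -/
import Mathlib

section
/- For α ∈ [1/2, 1], the jump transformation T̊_α is ergodic with respect to Lebesgue measure: every Borel set A ⊆ [α−1, α) with T̊_α^{−1}(A) = A (up to Lebesgue null sets) satisfies λ(A) = 0 or λ([α−1, α) \ A) = 0. -/
open MeasureTheory Set

noncomputable def g : ℝ := (Real.sqrt 5 - 1) / 2

noncomputable def T (α : ℝ) (x : ℝ) : ℝ :=
  if x = 0 then 0 else 1 / x - ⌊1 / x + 1 - α⌋

noncomputable def digit (α : ℝ) (k : ℕ) (x : ℝ) : ℤ :=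
  if (T α)^[k - 1] x = 0 then 0 else ⌊1 / ((T α)^[k - 1] x) + 1 - α⌋

noncomputable def cylinder (α : ℝ) (n : ℕ) (a : ℕ → ℤ) : Set ℝ :=
  {x | x ∈ Set.Ico (α - 1) α ∧ ∀ k, 1 ≤ k → k ≤ n → digit α k x = a k}

def contQ (a : ℕ → ℤ) : ℕ → ℤ
  | 0 => 1
  | 1 => a 1
  | (n + 2) => a (n + 2) * contQ a (n + 1) + contQ a n

def contP (a : ℕ → ℤ) : ℕ → ℤ
  | 0 => 0
  | 1 => 1
  | (n + 2) => a (n + 2) * contP a (n + 1) + contP a n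

noncomputable def NT (α : ℝ) (p : ℝ × ℝ) : ℝ × ℝ :=
  if p.1 = 0 then (0, 0)
  else (1 / p.1 - ⌊1 / p.1 + 1 - α⌋, 1 / (p.2 + ⌊1 / p.1 + 1 - α⌋))

noncomputable def Omega (α : ℝ) : Set (ℝ × ℝ) :=
  ⋃ n : ℕ, closure ((NT α)^[n] '' (Set.Ico (α - 1) α ×ˢ ({0} : Set ℝ)))

def Sset (x y : ℝ) : Set (ℝ × ℝ) :=
  {(x, y), (-x, -y), (x + 1, y / (1 - y)), (1 - x, -y / (y + 1))}

noncomputable def jumpTime (α : ℝ) (x : ℝ) : ℕ :=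
  sInf {n : ℕ | 1 ≤ n ∧
    (T α)^[n] '' cylinder α n (fun k => digit α k x) = Set.Ico (α - 1) α}

noncomputable def jumpT (α : ℝ) (x : ℝ) : ℝ := (T α)^[jumpTime α x] x

/-- The first digit of the `α`-continued fraction expansion of `x`. -/
noncomputable def leadDigit (α x : ℝ) : ℤ := if x = 0 then 0 else ⌊1 / x + 1 - α⌋

/-- The cylinder of order `n` containing `x`. -/
noncomputable def cylinderOf (α : ℝ) (n : ℕ) (x : ℝ) : Set ℝ :=
  cylinder α n (fun k => digit α k x)

theorem T_eq_sub_leadDigit (α x : ℝ) : T α x = 1 / x - leadDigit α x := by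
  by_cases hx : x = 0 <;> simp [T, leadDigit, hx]

theorem mem_cylinderOf {α : ℝ} {n : ℕ} {x y : ℝ} :
    y ∈ cylinderOf α n x ↔ y ∈ Ico (α - 1) α ∧
      ∀ k < n, leadDigit α ((T α)^[k] y) = leadDigit α ((T α)^[k] x) := by
  refine and_congr_right fun _ => ⟨fun h k hk => h (k + 1) (by omega) (by omega), ?_⟩
  rintro h (_ | k) hk hkn
  · omega
  · exact h k (by omega)

theorem self_mem_cylinderOf {α : ℝ} {x : ℝ} (n : ℕ) (hx : x ∈ Ico (α - 1) α) :
    x ∈ cylinderOf α n x :=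
  mem_cylinderOf.2 ⟨hx, fun _ _ => rfl⟩

theorem cylinderOf_eq {α : ℝ} {n k : ℕ} {x y : ℝ} (hy : y ∈ cylinderOf α n x) (hk : k ≤ n) :
    cylinderOf α k y = cylinderOf α k x := by
  ext z
  simp only [mem_cylinderOf] at hy ⊢
  refine and_congr_right fun _ => forall_congr' fun j => forall_congr' fun hj => ?_
  rw [hy.2 j (by omega)]

theorem mem_cylinderOf_succ {α : ℝ} {n : ℕ} {x y : ℝ} :
    y ∈ cylinderOf α (n + 1) x ↔ y ∈ cylinderOf α n x ∧
      leadDigit α ((T α)^[n] y) = leadDigit α ((T α)^[n] x) := by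
  simp only [mem_cylinderOf, and_assoc]
  refine and_congr_right fun _ => ⟨fun h => ⟨fun k hk => h k (by omega), h n (by omega)⟩, ?_⟩
  rintro ⟨h1, h2⟩ k hk
  rcases Nat.lt_succ_iff_lt_or_eq.1 hk with h | rfl
  exacts [h1 k h, h2]

theorem leadDigit_bounds (α : ℝ) {x : ℝ} (h0 : x ≠ 0) :
    (leadDigit α x : ℝ) ≤ 1 / x + 1 - α ∧ 1 / x - α < leadDigit α x := by
  have h1 := Int.floor_le (1 / x + 1 - α)
  have h2 := Int.lt_floor_add_one (1 / x + 1 - α)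
  simp only [leadDigit, h0, if_false]
  exact ⟨h1, by linarith⟩

theorem one_le_leadDigit {α x : ℝ} (hα : α ∈ Icc (1 / 2 : ℝ) 1) (hx : x ∈ Ico (α - 1) α)
    (h0 : 0 < x) : 1 ≤ leadDigit α x := by
  have h1 : 1 ≤ 1 / x := by
    rw [le_div_iff₀ h0]
    linarith [hx.2, hα.2]
  rw [leadDigit, if_neg h0.ne', Int.le_floor]
  push_cast
  linarith [hα.2]

theorem one_div_le_neg {α x : ℝ} (hx : x ∈ Ico (α - 1) α) (h0 : x < 0) :
    α < 1 ∧ 1 / x ≤ -(1 / (1 - α)) := by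
  have h : α < 1 := by linarith [hx.1]
  refine ⟨h, ?_⟩
  rw [← one_div_neg_eq_neg_one_div]
  exact one_div_le_one_div_of_neg_of_le h0 (by linarith [hx.1])

theorem leadDigit_le_neg_two {α x : ℝ} (hα : α ∈ Icc (1 / 2 : ℝ) 1) (hx : x ∈ Ico (α - 1) α)
    (h0 : x < 0) : leadDigit α x ≤ -2 := by
  obtain ⟨h, h1⟩ := one_div_le_neg hx h0
  have h2 : 2 ≤ 1 / (1 - α) := by
    rw [le_div_iff₀ (by linarith)]
    linarith [hα.1]
  have h3 : leadDigit α x < -1 := by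
    rw [leadDigit, if_neg h0.ne, Int.floor_lt]
    push_cast
    linarith [hα.1]
  omega

theorem leadDigit_cases {α x : ℝ} (hα : α ∈ Icc (1 / 2 : ℝ) 1) (hx : x ∈ Ico (α - 1) α)
    (h0 : x ≠ 0) : 1 ≤ leadDigit α x ∨ leadDigit α x ≤ -2 :=
  h0.lt_or_gt.symm.imp (one_le_leadDigit hα hx) (leadDigit_le_neg_two hα hx)

theorem ne_zero_of_leadDigit_eq {α x y : ℝ} (hα : α ∈ Icc (1 / 2 : ℝ) 1)
    (hx : x ∈ Ico (α - 1) α) (h0 : x ≠ 0) (h : leadDigit α y = leadDigit α x) : y ≠ 0 := by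
  rintro rfl
  have : leadDigit α 0 = 0 := by simp [leadDigit]
  rcases leadDigit_cases hα hx h0 with h1 | h1 <;> omega

theorem T_mem {α x : ℝ} (hα : α ∈ Icc (1 / 2 : ℝ) 1) : T α x ∈ Ico (α - 1) α := by
  by_cases h0 : x = 0
  · simp only [T, h0, if_true]
    exact ⟨by linarith [hα.2], by linarith [hα.1]⟩
  · obtain ⟨h1, h2⟩ := leadDigit_bounds α h0
    rw [T_eq_sub_leadDigit]
    exact ⟨by linarith, by linarith⟩

theorem iterate_T_mem {α x : ℝ} (hα : α ∈ Icc (1 / 2 : ℝ) 1) (hx : x ∈ Ico (α - 1) α) (n : ℕ) :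
    (T α)^[n] x ∈ Ico (α - 1) α := by
  cases n with
  | zero => exact hx
  | succ n =>
    rw [Function.iterate_succ_apply']
    exact T_mem hα

/-- The inverse branch of `T α` with digit `b`. -/
theorem inverse_branch {α z : ℝ} (hα : α ∈ Icc (1 / 2 : ℝ) 1) (hz : z ∈ Ico (α - 1) α)
    {b : ℤ} (hb : 1 ≤ b ∨ b ≤ -2) :
    (b + z : ℝ) ≠ 0 ∧ leadDigit α (1 / (b + z)) = b ∧ T α (1 / (b + z)) = z := by
  have h0 : (b + z : ℝ) ≠ 0 := by
    rcases hb with hb | hb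
    · have : (1 : ℝ) ≤ b := by exact_mod_cast hb
      linarith [hz.1, hα.1]
    · have : (b : ℝ) ≤ -2 := by exact_mod_cast hb
      linarith [hz.2, hα.2]
  have h1 : leadDigit α (1 / (b + z)) = b := by
    rw [leadDigit, if_neg (one_div_ne_zero h0), one_div_one_div, Int.floor_eq_iff]
    exact ⟨by linarith [hz.1], by linarith [hz.2]⟩
  refine ⟨h0, h1, ?_⟩
  rw [T_eq_sub_leadDigit, h1, one_div_one_div]
  ring

theorem one_div_add_le {α z z' : ℝ} (hα : α ∈ Icc (1 / 2 : ℝ) 1) (hz : z ∈ Ico (α - 1) α)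
    (hz' : z' ∈ Ico (α - 1) α) {b : ℤ} (hb : 1 ≤ b ∨ b ≤ -2) (h : z ≤ z') :
    1 / (b + z' : ℝ) ≤ 1 / (b + z) := by
  rcases hb with hb | hb
  · have : (1 : ℝ) ≤ b := by exact_mod_cast hb
    exact one_div_le_one_div_of_le (by linarith [hz.1, hα.1]) (by linarith)
  · have : (b : ℝ) ≤ -2 := by exact_mod_cast hb
    exact one_div_le_one_div_of_neg_of_le (by linarith [hz'.2, hα.2]) (by linarith)

theorem mem_image_cylinderOf_succ {α x : ℝ} (hα : α ∈ Icc (1 / 2 : ℝ) 1)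
    (hx : x ∈ Ico (α - 1) α) {n : ℕ} (h0 : (T α)^[n] x ≠ 0) {z : ℝ} :
    z ∈ (T α)^[n + 1] '' cylinderOf α (n + 1) x ↔ z ∈ Ico (α - 1) α ∧
      1 / (leadDigit α ((T α)^[n] x) + z : ℝ) ∈ (T α)^[n] '' cylinderOf α n x := by
  have hb := leadDigit_cases hα (iterate_T_mem hα hx n) h0
  constructor
  · rintro ⟨y, hy, rfl⟩
    rw [mem_cylinderOf_succ] at hy
    refine ⟨iterate_T_mem hα hy.1.1 _, y, hy.1, ?_⟩
    rw [Function.iterate_succ_apply', T_eq_sub_leadDigit, hy.2]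
    simp
  · rintro ⟨hz, y, hy, hyz⟩
    obtain ⟨h1, h2, h3⟩ := inverse_branch hα hz hb
    refine ⟨y, mem_cylinderOf_succ.2 ⟨hy, by rw [hyz, h2]⟩, ?_⟩
    rw [Function.iterate_succ_apply', hyz, h3]

theorem image_cylinderOf_subset {α x : ℝ} (hα : α ∈ Icc (1 / 2 : ℝ) 1) (n : ℕ) :
    (T α)^[n] '' cylinderOf α n x ⊆ Ico (α - 1) α := by
  rintro _ ⟨y, hy, rfl⟩
  exact iterate_T_mem hα hy.1 n

theorem image_cylinderOf_zero (α x : ℝ) : (T α)^[0] '' cylinderOf α 0 x = Ico (α - 1) α := by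
  ext z
  simp [mem_cylinderOf]

theorem ordConnected_image_cylinderOf {α x : ℝ} (hα : α ∈ Icc (1 / 2 : ℝ) 1)
    (hx : x ∈ Ico (α - 1) α) (h0 : ∀ k, (T α)^[k] x ≠ 0) (n : ℕ) :
    ((T α)^[n] '' cylinderOf α n x).OrdConnected := by
  induction n with
  | zero =>
    rw [image_cylinderOf_zero]
    exact ordConnected_Ico
  | succ n ih =>
    refine ⟨fun u hu v hv z hz => ?_⟩
    have hb := leadDigit_cases hα (iterate_T_mem hα hx n) (h0 n)
    rw [mem_image_cylinderOf_succ hα hx (h0 n)] at hu hv ⊢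
    have hzI : z ∈ Ico (α - 1) α := ordConnected_Ico.out hu.1 hv.1 hz
    exact ⟨hzI, ih.out hv.2 hu.2
      ⟨one_div_add_le hα hzI hv.1 hb hz.2, one_div_add_le hα hu.1 hzI hb hz.1⟩⟩

theorem Ioo_subset_image_cylinderOf {x : ℝ} (hx : x ∈ Ico (1 - 1 : ℝ) 1)
    (h0 : ∀ k, (T 1)^[k] x ≠ 0) (n : ℕ) : Ioo (0 : ℝ) 1 ⊆ (T 1)^[n] '' cylinderOf 1 n x := by
  have hα : (1 : ℝ) ∈ Icc (1 / 2 : ℝ) 1 := by norm_num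
  induction n with
  | zero =>
    rw [image_cylinderOf_zero]
    intro z hz
    exact ⟨by linarith [hz.1], hz.2⟩
  | succ n ih =>
    intro z hz
    rw [mem_image_cylinderOf_succ hα hx (h0 n)]
    refine ⟨⟨by linarith [hz.1], hz.2⟩, ih ?_⟩
    have hI := iterate_T_mem hα hx n
    have hpos : 0 < (T 1)^[n] x := lt_of_le_of_ne (by linarith [hI.1]) (h0 n).symm
    have hb : (1 : ℝ) ≤ leadDigit 1 ((T 1)^[n] x) := by
      exact_mod_cast one_le_leadDigit hα hI hpos
    refine ⟨one_div_pos.2 (by linarith [hz.1]), ?_⟩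
    rw [div_lt_one (by linarith [hz.1])]
    linarith [hz.1]

/-- The points of `[α - 1, α)` whose orbit avoids `0` and that lie in no full cylinder. -/
def noFullCylinder (α : ℝ) : Set ℝ :=
  {x | x ∈ Ico (α - 1) α ∧ (∀ k, (T α)^[k] x ≠ 0) ∧
    ∀ n, (T α)^[n + 1] '' cylinderOf α (n + 1) x ≠ Ico (α - 1) α}

theorem notMem_noFullCylinder {α x : ℝ} (hα : α ∈ Icc (1 / 2 : ℝ) 1) (n : ℕ)
    (h : ∀ z ∈ Ico (α - 1) α,
      1 / (leadDigit α ((T α)^[n] x) + z : ℝ) ∈ (T α)^[n] '' cylinderOf α n x) :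
    x ∉ noFullCylinder α := by
  rintro ⟨hx, h0, hn⟩
  refine hn n (Subset.antisymm (image_cylinderOf_subset hα _) fun z hz => ?_)
  exact (mem_image_cylinderOf_succ hα hx (h0 n)).2 ⟨hz, h z hz⟩

theorem leadDigit_eq_of_between {α u v w : ℝ} (hu : u ≠ 0) (hv : v ≠ 0) (hw : w ≠ 0)
    (huv : u ≤ v) (hvw : v ≤ w) (hs : 0 < u ∨ w < 0) (h : leadDigit α u = leadDigit α w) :
    leadDigit α v = leadDigit α u := by
  have h1 : 1 / v ≤ 1 / u ∧ 1 / w ≤ 1 / v := by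
    rcases hs with hs | hs
    · exact ⟨one_div_le_one_div_of_le hs huv, one_div_le_one_div_of_le (hs.trans_le huv) hvw⟩
    · exact ⟨one_div_le_one_div_of_neg_of_le (hvw.trans_lt hs) huv,
        one_div_le_one_div_of_neg_of_le hs hvw⟩
  simp only [leadDigit, hu, hv, hw, if_false] at h ⊢
  apply le_antisymm
  · exact Int.floor_mono (by linarith [h1.1])
  · rw [h]
    exact Int.floor_mono (by linarith [h1.2])

/-- Between two points of a cylinder image with other digits, a whole rank-one cylinder fits. -/
theorem notMem_noFullCylinder_of_between {α x y₀ y₁ y₂ : ℝ} (hα : α ∈ Icc (1 / 2 : ℝ) 1) {n : ℕ}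
    (h₀ : y₀ ∈ noFullCylinder α ∩ cylinderOf α n x)
    (h₁ : y₁ ∈ noFullCylinder α ∩ cylinderOf α n x)
    (h₂ : y₂ ∈ noFullCylinder α ∩ cylinderOf α n x)
    (h₀₁ : leadDigit α ((T α)^[n] y₀) ≠ leadDigit α ((T α)^[n] y₁))
    (h₂₁ : leadDigit α ((T α)^[n] y₂) ≠ leadDigit α ((T α)^[n] y₁))
    (hlt₀ : (T α)^[n] y₀ < (T α)^[n] y₁) (hlt₂ : (T α)^[n] y₁ < (T α)^[n] y₂) : False := by
  refine notMem_noFullCylinder hα n (fun z hz => ?_) h₁.1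
  have hI := iterate_T_mem hα h₁.1.1 n
  have hne := h₁.1.2.1 n
  have hb := leadDigit_cases hα hI hne
  obtain ⟨hb0, hbd, -⟩ := inverse_branch hα hz hb
  have hord := ordConnected_image_cylinderOf hα h₁.1.1 h₁.1.2.1 n
  have heq := cylinderOf_eq h₁.2 le_rfl
  have m₀ : (T α)^[n] y₀ ∈ (T α)^[n] '' cylinderOf α n y₁ := by
    rw [heq]
    exact mem_image_of_mem _ h₀.2
  have m₂ : (T α)^[n] y₂ ∈ (T α)^[n] '' cylinderOf α n y₁ := by
    rw [heq]
    exact mem_image_of_mem _ h₂.2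
  have e₀ := h₀.1.2.1 n
  have e₂ := h₂.1.2.1 n
  generalize (T α)^[n] y₀ = u₀ at *
  generalize (T α)^[n] y₁ = u₁ at *
  generalize (T α)^[n] y₂ = u₂ at *
  have hv0 := one_div_ne_zero hb0
  have hsign : (0 < u₁ ∧ 0 < 1 / (leadDigit α u₁ + z : ℝ)) ∨
      (u₁ < 0 ∧ 1 / (leadDigit α u₁ + z : ℝ) < 0) := by
    rcases hne.lt_or_gt with h | h
    · right
      have : (leadDigit α u₁ : ℝ) ≤ -2 := by exact_mod_cast leadDigit_le_neg_two hα hI h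
      exact ⟨h, one_div_neg.2 (by linarith [hz.2, hα.2])⟩
    · left
      have : (1 : ℝ) ≤ leadDigit α u₁ := by exact_mod_cast one_le_leadDigit hα hI h
      exact ⟨h, one_div_pos.2 (by linarith [hz.1, hα.1])⟩
  generalize 1 / (leadDigit α u₁ + z : ℝ) = v at *
  refine hord.out m₀ m₂ ⟨?_, ?_⟩ <;> by_contra! hlt
  · refine h₀₁ ((leadDigit_eq_of_between hv0 e₀ hne hlt.le hlt₀.le ?_ hbd).trans hbd)
    exact hsign.imp (·.2) (·.1)
  · refine h₂₁ (leadDigit_eq_of_between hne e₂ hv0 hlt₂.le hlt.le ?_ hbd.symm)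
    exact hsign.imp (·.1) (·.2)

theorem leadDigit_eq_one_of_noFullCylinder {y : ℝ} (hy : y ∈ noFullCylinder 1) (n : ℕ) :
    leadDigit 1 ((T 1)^[n] y) = 1 := by
  have hα : (1 : ℝ) ∈ Icc (1 / 2 : ℝ) 1 := by norm_num
  have hI := iterate_T_mem hα hy.1 n
  have hpos : 0 < (T 1)^[n] y := lt_of_le_of_ne (by linarith [hI.1]) (hy.2.1 n).symm
  have h1 := one_le_leadDigit hα hI hpos
  by_contra hne
  refine notMem_noFullCylinder hα n (fun z hz => ?_) hy
  have h2 : (2 : ℝ) ≤ leadDigit 1 ((T 1)^[n] y) := by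
    exact_mod_cast (show 2 ≤ leadDigit 1 ((T 1)^[n] y) by omega)
  refine Ioo_subset_image_cylinderOf hy.1 hy.2.1 n ⟨one_div_pos.2 (by linarith [hz.1]), ?_⟩
  rw [div_lt_one (by linarith [hz.1])]
  linarith [hz.1]

/-- A bound for the number of children of a cylinder that meet `noFullCylinder α`. -/
noncomputable def branching (α : ℝ) : ℕ := if α = 1 then 1 else 2

theorem exists_cover_step {α : ℝ} (hα : α ∈ Icc (1 / 2 : ℝ) 1) (n : ℕ) (x : ℝ) :
    ∃ F : Finset ℝ, F.card ≤ branching α ∧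
      ∀ y ∈ noFullCylinder α ∩ cylinderOf α n x, ∃ z ∈ F, y ∈ cylinderOf α (n + 1) z := by
  have key : ∀ y ∈ noFullCylinder α ∩ cylinderOf α n x,
      ∀ z ∈ noFullCylinder α ∩ cylinderOf α n x,
      leadDigit α ((T α)^[n] y) = leadDigit α ((T α)^[n] z) → y ∈ cylinderOf α (n + 1) z := by
    intro y hy z hz h
    rw [mem_cylinderOf_succ, cylinderOf_eq hz.2 le_rfl]
    exact ⟨hy.2, h⟩
  rcases (noFullCylinder α ∩ cylinderOf α n x).eq_empty_or_nonempty with he | ⟨y₀, h₀⟩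
  · exact ⟨∅, by simp, by simp [he]⟩
  by_cases h : ∃ y₁ ∈ noFullCylinder α ∩ cylinderOf α n x,
      leadDigit α ((T α)^[n] y₁) ≠ leadDigit α ((T α)^[n] y₀)
  · obtain ⟨y₁, h₁, hne⟩ := h
    have h1 : α ≠ 1 := by
      rintro rfl
      rw [leadDigit_eq_one_of_noFullCylinder h₁.1, leadDigit_eq_one_of_noFullCylinder h₀.1] at hne
      exact hne rfl
    refine ⟨{y₀, y₁}, by simpa [branching, h1] using Finset.card_le_two, fun y hy => ?_⟩
    by_contra! hcon
    have hy0 : leadDigit α ((T α)^[n] y) ≠ leadDigit α ((T α)^[n] y₀) :=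
      fun h => hcon y₀ (by simp) (key y hy y₀ h₀ h)
    have hy1 : leadDigit α ((T α)^[n] y) ≠ leadDigit α ((T α)^[n] y₁) :=
      fun h => hcon y₁ (by simp) (key y hy y₁ h₁ h)
    have ne {p q : ℝ} (h : leadDigit α p ≠ leadDigit α q) : p ≠ q := fun e => h (by rw [e])
    have B {p q r : ℝ} := @notMem_noFullCylinder_of_between α x p q r hα n
    rcases (ne hy0).lt_or_gt with a | a <;> rcases (ne hy1).lt_or_gt with b | b <;>
      rcases (ne hne).lt_or_gt with c | c
    · exact B hy h₁ h₀ hy1 hne.symm b c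
    · exact B hy h₀ h₁ hy0 hne a c
    · exact B h₁ hy h₀ hy1.symm hy0.symm b a
    · linarith
    · linarith
    · exact B h₀ hy h₁ hy0.symm hy1.symm a b
    · exact B h₁ h₀ hy hne hy0 c a
    · exact B h₀ h₁ hy hne.symm hy1 c b
  · push Not at h
    refine ⟨{y₀}, ?_, fun y hy => ⟨y₀, by simp, key y hy y₀ h₀ (h y hy)⟩⟩
    by_cases h1 : α = 1 <;> simp [branching, h1]

theorem exists_cover {α : ℝ} (hα : α ∈ Icc (1 / 2 : ℝ) 1) (n : ℕ) :
    ∃ F : Finset ℝ, F.card ≤ branching α ^ n ∧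
      ∀ y ∈ noFullCylinder α, ∃ z ∈ F, y ∈ cylinderOf α n z := by
  classical
  induction n with
  | zero => exact ⟨{0}, by simp, fun y hy => ⟨0, by simp, mem_cylinderOf.2 ⟨hy.1, by simp⟩⟩⟩
  | succ n ih =>
    obtain ⟨F, hF, hcov⟩ := ih
    choose G hG hGcov using exists_cover_step hα n
    refine ⟨F.biUnion G, ?_, fun y hy => ?_⟩
    · rw [pow_succ]
      exact (Finset.card_biUnion_le_card_mul F G _ fun x _ => hG x).trans
        (Nat.mul_le_mul_right _ hF)
    · obtain ⟨x, hx, hyx⟩ := hcov y hy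
      obtain ⟨z, hz, hyz⟩ := hGcov x y ⟨hy, hyx⟩
      exact ⟨z, Finset.mem_biUnion.2 ⟨x, hx, hz⟩, hyz⟩

/-- The product of the first `n` absolute values along the orbit of `x`. -/
noncomputable def orbitProd (α : ℝ) (n : ℕ) (x : ℝ) : ℝ := ∏ k ∈ Finset.range n, |(T α)^[k] x|

theorem orbitProd_succ (α : ℝ) (n : ℕ) (x : ℝ) :
    orbitProd α (n + 1) x = orbitProd α n x * |(T α)^[n] x| :=
  Finset.prod_range_succ _ _

theorem orbitProd_nonneg (α : ℝ) (n : ℕ) (x : ℝ) : 0 ≤ orbitProd α n x :=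
  Finset.prod_nonneg fun _ _ => abs_nonneg _

theorem orbitProd_pos {α x : ℝ} {n : ℕ} (h0 : ∀ k < n, (T α)^[k] x ≠ 0) : 0 < orbitProd α n x :=
  Finset.prod_pos fun k hk => abs_pos.2 (h0 k (Finset.mem_range.1 hk))

theorem abs_le_of_mem {α x : ℝ} (hα : α ∈ Icc (1 / 2 : ℝ) 1) (hx : x ∈ Ico (α - 1) α) :
    |x| ≤ α :=
  abs_le.2 ⟨by linarith [hx.1, hα.1], hx.2.le⟩

theorem one_div_lt_of_leadDigit_eq_one {α x : ℝ} (h0 : 0 < x)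
    (h : leadDigit α x = 1) : 1 / x < 1 + α := by
  have := (leadDigit_bounds α h0.ne').2
  rw [h] at this
  push_cast at this
  linarith

theorem abs_mul_T_le {α x : ℝ} (hα : α ∈ Icc (1 / 2 : ℝ) 1) (hx : x ∈ Ico (α - 1) α) :
    |x| * |T α x| ≤ α / (1 + α) := by
  have hα0 : 0 < 1 + α := by linarith [hα.1]
  have hT : |T α x| ≤ α := abs_le_of_mem hα (T_mem hα)
  rcases lt_trichotomy x 0 with h0 | rfl | h0
  · have h1 : |x| ≤ 1 - α := by
      rw [abs_of_neg h0]
      linarith [hx.1]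
    calc |x| * |T α x| ≤ (1 - α) * α := by gcongr; linarith [hα.2]
      _ ≤ α / (1 + α) := by
        rw [le_div_iff₀ hα0]
        nlinarith [hα.1, sq_nonneg α, mul_nonneg (by linarith [hα.1] : 0 ≤ α) (sq_nonneg α)]
  · simp only [abs_zero, zero_mul]
    exact div_nonneg (by linarith [hα.1]) hα0.le
  · have h1 := one_le_leadDigit hα hx h0
    rcases h1.eq_or_lt with h | h
    · have h2 := one_div_lt_of_leadDigit_eq_one h0 h.symm
      rw [← abs_mul, T_eq_sub_leadDigit, ← h]
      have e : x * (1 / x - ((1 : ℤ) : ℝ)) = 1 - x := by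
        field_simp
        push_cast
        ring
      rw [e, abs_of_nonneg (by linarith [hx.2, hα.2]), le_div_iff₀ hα0]
      rw [div_lt_iff₀ h0] at h2
      linarith
    · have h2 : (2 : ℝ) ≤ leadDigit α x := by exact_mod_cast h
      have h3 := (leadDigit_bounds α h0.ne').1
      have h4 : |x| ≤ 1 / (1 + α) := by
        rw [abs_of_pos h0, le_one_div h0 hα0]
        linarith
      calc |x| * |T α x| ≤ 1 / (1 + α) * α := by gcongr
        _ = α / (1 + α) := by ring

theorem orbitProd_two_mul_le {α x : ℝ} (hα : α ∈ Icc (1 / 2 : ℝ) 1) (hx : x ∈ Ico (α - 1) α)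
    (m : ℕ) : orbitProd α (2 * m) x ≤ (α / (1 + α)) ^ m := by
  induction m with
  | zero => simp [orbitProd]
  | succ m ih =>
    have h := abs_mul_T_le hα (iterate_T_mem hα hx (2 * m))
    rw [← Function.iterate_succ_apply' (T α)] at h
    rw [show 2 * (m + 1) = 2 * m + 1 + 1 by ring, orbitProd_succ, orbitProd_succ, mul_assoc,
      pow_succ]
    exact mul_le_mul ih h (by positivity) ((orbitProd_nonneg _ _ _).trans ih)

theorem orbitProd_antitone {α x : ℝ} (hα : α ∈ Icc (1 / 2 : ℝ) 1) (hx : x ∈ Ico (α - 1) α) :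
    Antitone fun n => orbitProd α n x := by
  refine antitone_nat_of_succ_le fun n => ?_
  rw [orbitProd_succ]
  exact mul_le_of_le_one_right (orbitProd_nonneg _ _ _)
    ((abs_le_of_mem hα (iterate_T_mem hα hx n)).trans hα.2)

theorem tendsto_orbitProd {α x : ℝ} (hα : α ∈ Icc (1 / 2 : ℝ) 1) (hx : x ∈ Ico (α - 1) α) :
    Filter.Tendsto (fun n => orbitProd α n x) Filter.atTop (nhds 0) := by
  have hα0 : 0 < 1 + α := by linarith [hα.1]
  have h1 : α / (1 + α) < 1 := by
    rw [div_lt_one hα0]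
    linarith
  have h2 : Filter.Tendsto (fun n => (α / (1 + α)) ^ (n / 2)) Filter.atTop (nhds 0) :=
    (tendsto_pow_atTop_nhds_zero_of_lt_one (div_nonneg (by linarith [hα.1]) hα0.le) h1).comp
      (Nat.tendsto_div_const_atTop two_ne_zero)
  refine squeeze_zero (fun n => orbitProd_nonneg _ _ _) (fun n => ?_) h2
  exact (orbitProd_antitone hα hx (Nat.mul_div_le n 2)).trans (orbitProd_two_mul_le hα hx _)

theorem abs_sub_eq_of_mem_cylinderOf {α x u v : ℝ} {n : ℕ}
    (hu0 : ∀ k < n, (T α)^[k] u ≠ 0) (hv0 : ∀ k < n, (T α)^[k] v ≠ 0)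
    (hu : u ∈ cylinderOf α n x) (hv : v ∈ cylinderOf α n x) :
    |u - v| = |(T α)^[n] u - (T α)^[n] v| * (orbitProd α n u * orbitProd α n v) := by
  induction n with
  | zero => simp [orbitProd]
  | succ n ih =>
    rw [mem_cylinderOf_succ] at hu hv
    rw [ih (fun k hk => hu0 k (by omega)) (fun k hk => hv0 k (by omega)) hu.1 hv.1,
      orbitProd_succ, orbitProd_succ, Function.iterate_succ_apply', Function.iterate_succ_apply',
      T_eq_sub_leadDigit, T_eq_sub_leadDigit α ((T α)^[n] v), hu.2, hv.2]
    have hun := hu0 n (by omega)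
    have hvn := hv0 n (by omega)
    generalize (T α)^[n] u = p at *
    generalize (T α)^[n] v = q at *
    have : |p - q| = |1 / p - leadDigit α ((T α)^[n] x) - (1 / q - leadDigit α ((T α)^[n] x))| *
        (|p| * |q|) := by
      rw [← abs_mul, ← abs_mul, abs_sub_comm]
      congr 1
      field_simp
      ring
    rw [this]
    ring

theorem iterate_ne_zero_of_mem_cylinderOf {α x y : ℝ} (hα : α ∈ Icc (1 / 2 : ℝ) 1) {n : ℕ}
    (hx : x ∈ Ico (α - 1) α) (h0 : ∀ k, (T α)^[k] x ≠ 0) (hy : y ∈ cylinderOf α n x)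
    {k : ℕ} (hk : k < n) : (T α)^[k] y ≠ 0 :=
  ne_zero_of_leadDigit_eq hα (iterate_T_mem hα hx k) (h0 k) ((mem_cylinderOf.1 hy).2 k hk)

/-- The admissible ratios `q_{n-1} / q_n` of continuants for orbits that have reached `x`. -/
def AdmissibleRatio (α x t : ℝ) : Prop :=
  (0 ≤ t ∧ t ≤ 1) ∨ (1 ≤ t ∧ t ≤ 2 ∧ 0 < x) ∨
    (-1 ≤ t ∧ t ≤ 0 ∧ α < 1 ∧ (1 / x < 1 + α → 0 < x → -(1 / 2) ≤ t))

theorem AdmissibleRatio.step {α x t : ℝ} (hα : α ∈ Icc (1 / 2 : ℝ) 1) (hx : x ∈ Ico (α - 1) α)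
    (h0 : x ≠ 0) (h : AdmissibleRatio α x t) :
    (leadDigit α x + t : ℝ) ≠ 0 ∧ AdmissibleRatio α (T α x) (1 / (leadDigit α x + t)) := by
  have inv_neg {s : ℝ} (hs : s ≤ -1) : -1 ≤ 1 / s ∧ 1 / s ≤ 0 := by
    constructor
    · rw [le_div_iff_of_neg (by linarith)]
      linarith
    · exact one_div_nonpos.2 (by linarith)
  have inv_pos {s : ℝ} (hs : 1 ≤ s) : 0 ≤ 1 / s ∧ 1 / s ≤ 1 :=
    ⟨by positivity, by rwa [div_le_one (by linarith)]⟩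
  have inv_half {s : ℝ} (hs : s ≤ -2) : -(1 / 2) ≤ 1 / s := by
    rw [le_div_iff_of_neg (by linarith)]
    linarith
  rcases h0.lt_or_gt with hneg | hpos
  · have hb := leadDigit_le_neg_two hα hx hneg
    have hb' : (leadDigit α x : ℝ) ≤ -2 := by exact_mod_cast hb
    obtain ⟨hα1, hdiv⟩ := one_div_le_neg hx hneg
    have hthree : 1 / T α x < 1 + α → 0 < T α x → (leadDigit α x : ℝ) ≤ -3 := by
      intro h1 h2
      rw [one_div_lt h2 (by linarith [hα.1]), T_eq_sub_leadDigit] at h1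
      have h3 : 2 ≤ 1 / (1 - α) + 1 / (1 + α) := by
        rw [div_add_div _ _ (by linarith) (by linarith [hα.1]), le_div_iff₀]
        · nlinarith [sq_nonneg α]
        · exact mul_pos (by linarith) (by linarith [hα.1])
      have h4 : (leadDigit α x : ℝ) < -2 := by linarith
      have h5 : leadDigit α x < -2 := by exact_mod_cast h4
      exact_mod_cast (show leadDigit α x ≤ -3 by omega)
    have ht : t ≤ 1 := by
      rcases h with h | h | h
      · exact h.2
      · linarith [h.2.2]
      · linarith [h.2.1]
    have hs : (leadDigit α x : ℝ) + t ≤ -1 := by linarith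
    refine ⟨by linarith, Or.inr (Or.inr ⟨(inv_neg hs).1, (inv_neg hs).2, hα1, fun h1 h2 => ?_⟩)⟩
    exact inv_half (by linarith [hthree h1 h2])
  · have hb := one_le_leadDigit hα hx hpos
    have hb' : (1 : ℝ) ≤ leadDigit α x := by exact_mod_cast hb
    by_cases ht : 1 ≤ (leadDigit α x : ℝ) + t
    · exact ⟨by linarith, Or.inl (inv_pos ht)⟩
    have hthird : -1 ≤ t ∧ t ≤ 0 ∧ α < 1 ∧ (1 / x < 1 + α → 0 < x → -(1 / 2) ≤ t) := by
      rcases h with h | h | h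
      · exact absurd (by linarith [h.1]) ht
      · exact absurd (by linarith [h.1]) ht
      · exact h
    obtain ⟨h1, h2, h3, h4⟩ := hthird
    have hone : leadDigit α x = 1 := by
      refine le_antisymm ?_ hb
      by_contra! hlt
      have : (2 : ℝ) ≤ leadDigit α x := by exact_mod_cast hlt
      exact ht (by linarith)
    have h5 := h4 (one_div_lt_of_leadDigit_eq_one hpos hone) hpos
    have h6 : 0 < T α x := by
      rw [T_eq_sub_leadDigit, hone]
      have : 1 < 1 / x := by
        rw [lt_div_iff₀ hpos]
        linarith [hx.2]
      push_cast
      linarith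
    refine ⟨by linarith, Or.inr (Or.inl ⟨?_, ?_, h6⟩)⟩
    · rw [le_div_iff₀ (by linarith)]
      linarith
    · rw [div_le_iff₀ (by linarith)]
      linarith

theorem exists_admissibleRatio {α x u v : ℝ} (hα : α ∈ Icc (1 / 2 : ℝ) 1) {n : ℕ}
    (hu0 : ∀ k < n, (T α)^[k] u ≠ 0) (hv0 : ∀ k < n, (T α)^[k] v ≠ 0)
    (hu : u ∈ cylinderOf α n x) (hv : v ∈ cylinderOf α n x) :
    ∃ t, AdmissibleRatio α ((T α)^[n] u) t ∧ AdmissibleRatio α ((T α)^[n] v) t ∧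
      orbitProd α n u * |1 + t * (T α)^[n] u| = orbitProd α n v * |1 + t * (T α)^[n] v| := by
  induction n with
  | zero => exact ⟨0, Or.inl (by norm_num), Or.inl (by norm_num), by simp [orbitProd]⟩
  | succ n ih =>
    rw [mem_cylinderOf_succ] at hu hv
    obtain ⟨t, htu, htv, heq⟩ :=
      ih (fun k hk => hu0 k (by omega)) (fun k hk => hv0 k (by omega)) hu.1 hv.1
    obtain ⟨hne, hsu⟩ := htu.step hα (iterate_T_mem hα hu.1.1 n) (hu0 n (by omega))
    obtain ⟨-, hsv⟩ := htv.step hα (iterate_T_mem hα hv.1.1 n) (hv0 n (by omega))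
    refine ⟨1 / (leadDigit α ((T α)^[n] u) + t), ?_, ?_, ?_⟩
    · rwa [Function.iterate_succ_apply']
    · rwa [Function.iterate_succ_apply', hu.2, ← hv.2]
    · have key {p s : ℝ} (hp : p ≠ 0) {b : ℝ} (hb : b + s ≠ 0) :
          |p| * |1 + 1 / (b + s) * (1 / p - b)| = |1 + s * p| / |b + s| := by
        rw [← abs_mul, ← abs_div]
        congr 1
        field_simp
        ring
      rw [orbitProd_succ, orbitProd_succ, Function.iterate_succ_apply',
        Function.iterate_succ_apply', T_eq_sub_leadDigit, T_eq_sub_leadDigit α ((T α)^[n] v),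
        mul_assoc, mul_assoc, hv.2, ← hu.2, key (hu0 n (by omega)) hne,
        key (hv0 n (by omega)) hne, ← mul_div_assoc, ← mul_div_assoc, heq]

theorem AdmissibleRatio.bounds {α x t : ℝ} (hα : α ∈ Icc (1 / 2 : ℝ) 1) (hx : x ∈ Ico (α - 1) α)
    (h : AdmissibleRatio α x t) :
    (if α = 1 then 1 / 2 else 1 - α) ≤ |1 + t * x| ∧ |1 + t * x| ≤ 3 := by
  have hlow : (if α = 1 then 1 / 2 else 1 - α) ≤ 1 / 2 := by
    split_ifs
    · exact le_rfl
    · linarith [hα.1]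
  obtain ⟨h1, h2⟩ := hx
  obtain ⟨h3, h4⟩ := hα
  have : (if α = 1 then 1 / 2 else 1 - α) ≤ 1 + t * x ∧ 1 + t * x ≤ 3 := by
    rcases h with ⟨a, b⟩ | ⟨a, b, c⟩ | ⟨a, b, c, -⟩
    · exact ⟨hlow.trans (by nlinarith), by nlinarith⟩
    · exact ⟨hlow.trans (by nlinarith), by nlinarith⟩
    · rw [if_neg c.ne]
      exact ⟨by nlinarith, by nlinarith⟩
  exact ⟨this.1.trans (le_abs_self _), abs_le.2 ⟨by
    have : 0 ≤ (if α = 1 then 1 / 2 else 1 - α) := by split_ifs <;> linarith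
    linarith, this.2⟩⟩

/-- Bounded distortion on cylinders. -/
theorem exists_orbitProd_le {α : ℝ} (hα : α ∈ Icc (1 / 2 : ℝ) 1) :
    ∃ C > 0, ∀ (n : ℕ) (x u v : ℝ), x ∈ Ico (α - 1) α → (∀ k, (T α)^[k] x ≠ 0) →
      u ∈ cylinderOf α n x → v ∈ cylinderOf α n x → orbitProd α n u ≤ C * orbitProd α n v := by
  have hc : (0 : ℝ) < if α = 1 then 1 / 2 else 1 - α := by
    split_ifs with h
    · norm_num
    · linarith [lt_of_le_of_ne hα.2 h]
  refine ⟨3 / (if α = 1 then 1 / 2 else 1 - α), by positivity, fun n x u v hx h0 hu hv => ?_⟩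
  obtain ⟨t, htu, htv, heq⟩ := exists_admissibleRatio hα
    (fun k => iterate_ne_zero_of_mem_cylinderOf hα hx h0 hu)
    (fun k => iterate_ne_zero_of_mem_cylinderOf hα hx h0 hv) hu hv
  have h1 := (htu.bounds hα (iterate_T_mem hα hu.1 n)).1
  have h2 := (htv.bounds hα (iterate_T_mem hα hv.1 n)).2
  generalize (if α = 1 then 1 / 2 else 1 - α) = c at *
  rw [div_mul_eq_mul_div, le_div_iff₀ hc]
  calc orbitProd α n u * c ≤ orbitProd α n u * |1 + t * (T α)^[n] u| := by
        gcongr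
        exact orbitProd_nonneg _ _ _
    _ = orbitProd α n v * |1 + t * (T α)^[n] v| := heq
    _ ≤ orbitProd α n v * 3 := by
        gcongr
        exact orbitProd_nonneg _ _ _
    _ = 3 * orbitProd α n v := mul_comm _ _

theorem abs_sub_le_of_mem_cylinderOf {α x u v : ℝ} (hα : α ∈ Icc (1 / 2 : ℝ) 1) {n : ℕ}
    (hu0 : ∀ k < n, (T α)^[k] u ≠ 0) (hv0 : ∀ k < n, (T α)^[k] v ≠ 0)
    (hu : u ∈ cylinderOf α n x) (hv : v ∈ cylinderOf α n x) :
    |u - v| ≤ orbitProd α n u * orbitProd α n v := by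
  rw [abs_sub_eq_of_mem_cylinderOf hu0 hv0 hu hv]
  have h1 := iterate_T_mem hα hu.1 n
  have h2 := iterate_T_mem hα hv.1 n
  refine mul_le_of_le_one_left (mul_nonneg (orbitProd_nonneg _ _ _) (orbitProd_nonneg _ _ _)) ?_
  exact abs_le.2 ⟨by linarith [h1.1, h2.2], by linarith [h1.2, h2.1]⟩

theorem volume_noFullCylinder_inter_cylinderOf_le {α : ℝ} (hα : α ∈ Icc (1 / 2 : ℝ) 1) (m : ℕ)
    (x : ℝ) : volume (noFullCylinder α ∩ cylinderOf α (2 * m) x) ≤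
      ENNReal.ofReal (2 * (α / (1 + α)) ^ (2 * m)) := by
  rcases (noFullCylinder α ∩ cylinderOf α (2 * m) x).eq_empty_or_nonempty with he | ⟨y, hy⟩
  · simp [he]
  · have hsub : noFullCylinder α ∩ cylinderOf α (2 * m) x ⊆
        Metric.closedBall y ((α / (1 + α)) ^ (2 * m)) := by
      intro z hz
      rw [Metric.mem_closedBall, Real.dist_eq]
      have hr : 0 ≤ α / (1 + α) := div_nonneg (by linarith [hα.1]) (by linarith [hα.1])
      refine (abs_sub_le_of_mem_cylinderOf hα (fun k _ => hz.1.2.1 k) (fun k _ => hy.1.2.1 k)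
        hz.2 hy.2).trans ?_
      rw [two_mul m, pow_add, ← two_mul m]
      exact mul_le_mul (orbitProd_two_mul_le hα hz.1.1 m) (orbitProd_two_mul_le hα hy.1.1 m)
        (orbitProd_nonneg _ _ _) (by positivity)
    exact (measure_mono hsub).trans_eq (Real.volume_closedBall _ _)

theorem branching_mul_lt_one {α : ℝ} (hα : α ∈ Icc (1 / 2 : ℝ) 1) :
    branching α * (α / (1 + α)) < 1 := by
  have hα0 : 0 < 1 + α := by linarith [hα.1]
  rw [← mul_div_assoc, div_lt_one hα0]
  unfold branching
  split_ifs with h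
  · push_cast
    linarith
  · push_cast
    linarith [lt_of_le_of_ne hα.2 h]

theorem volume_noFullCylinder {α : ℝ} (hα : α ∈ Icc (1 / 2 : ℝ) 1) :
    volume (noFullCylinder α) = 0 := by
  have hr : 0 ≤ α / (1 + α) := div_nonneg (by linarith [hα.1]) (by linarith [hα.1])
  have hbound (m : ℕ) : volume (noFullCylinder α) ≤
      ENNReal.ofReal (2 * (branching α * (α / (1 + α))) ^ (2 * m)) := by
    obtain ⟨F, hF, hcov⟩ := exists_cover hα (2 * m)
    calc volume (noFullCylinder α)
        ≤ volume (⋃ z ∈ F, noFullCylinder α ∩ cylinderOf α (2 * m) z) := by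
          refine measure_mono fun y hy => ?_
          obtain ⟨z, hz, hyz⟩ := hcov y hy
          exact mem_biUnion hz ⟨hy, hyz⟩
      _ ≤ ∑ z ∈ F, volume (noFullCylinder α ∩ cylinderOf α (2 * m) z) :=
          measure_biUnion_finset_le _ _
      _ ≤ F.card • ENNReal.ofReal (2 * (α / (1 + α)) ^ (2 * m)) :=
          Finset.sum_le_card_nsmul _ _ _ fun z _ =>
            volume_noFullCylinder_inter_cylinderOf_le hα m z
      _ = ENNReal.ofReal (F.card * (2 * (α / (1 + α)) ^ (2 * m))) := by
          rw [nsmul_eq_mul, ENNReal.ofReal_mul (Nat.cast_nonneg F.card), ENNReal.ofReal_natCast]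
      _ ≤ ENNReal.ofReal (2 * (branching α * (α / (1 + α))) ^ (2 * m)) := by
          apply ENNReal.ofReal_le_ofReal
          have : (F.card : ℝ) ≤ (branching α : ℝ) ^ (2 * m) := by exact_mod_cast hF
          calc (F.card : ℝ) * (2 * (α / (1 + α)) ^ (2 * m))
              ≤ (branching α : ℝ) ^ (2 * m) * (2 * (α / (1 + α)) ^ (2 * m)) := by gcongr
            _ = _ := by rw [mul_pow]; ring
  have hlim : Filter.Tendsto
      (fun m : ℕ => ENNReal.ofReal (2 * (branching α * (α / (1 + α))) ^ (2 * m)))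
      Filter.atTop (nhds 0) := by
    have h1 := (tendsto_pow_atTop_nhds_zero_of_lt_one (by positivity)
      (branching_mul_lt_one hα)).comp (Filter.tendsto_id.const_mul_atTop' (two_pos : 0 < 2))
    simpa using ENNReal.tendsto_ofReal (h1.const_mul 2)
  exact le_antisymm (ge_of_tendsto' hlim hbound) zero_le

theorem volume_preimage_T_eq_zero {α : ℝ} {N : Set ℝ} (hN : volume N = 0) :
    volume (T α ⁻¹' N) = 0 := by
  have hsub : T α ⁻¹' N ⊆
      {0} ∪ ⋃ b : ℤ, (fun y : ℝ => 1 / (y + b)) '' (N ∩ {y | y + b ≠ 0}) := by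
    intro x hx
    by_cases h0 : x = 0
    · exact Or.inl h0
    · have h : T α x + leadDigit α x = 1 / x := by
        rw [T_eq_sub_leadDigit]
        ring
      refine Or.inr (mem_iUnion.2 ⟨leadDigit α x, T α x, ⟨hx, ?_⟩, ?_⟩)
      · rw [mem_ofPred_eq, h]
        exact one_div_ne_zero h0
      · simp only [h, one_div_one_div]
  refine measure_mono_null hsub (measure_union_null (measure_singleton _)
    (measure_iUnion_null fun b => ?_))
  refine addHaar_image_eq_zero_of_differentiableOn_of_addHaar_eq_zero volume ?_
    (measure_mono_null inter_subset_left hN)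
  intro y hy
  have hyb : y + (b : ℝ) ≠ 0 := hy.2
  have : DifferentiableAt ℝ (fun y : ℝ => 1 / (y + b)) y := by
    fun_prop (disch := exact hyb)
  exact this.differentiableWithinAt

theorem ae_iterate_T_notMem {α : ℝ} {N : Set ℝ} (hN : volume N = 0) :
    ∀ᵐ x, ∀ n, (T α)^[n] x ∉ N := by
  rw [ae_all_iff]
  intro n
  change volume {x | ¬ (T α)^[n] x ∉ N} = 0
  simp only [not_not]
  induction n with
  | zero => exact hN
  | succ n ih => exact volume_preimage_T_eq_zero ih

theorem exists_jumpT_iterate_eq (α : ℝ) (m : ℕ) (x : ℝ) :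
    ∃ n, (jumpT α)^[m] x = (T α)^[n] x := by
  induction m with
  | zero => exact ⟨0, rfl⟩
  | succ m ih =>
    obtain ⟨n, hn⟩ := ih
    refine ⟨jumpTime α ((T α)^[n] x) + n, ?_⟩
    rw [Function.iterate_succ_apply', hn, Function.iterate_add_apply]
    rfl

theorem jumpTime_spec {α x : ℝ} {N : ℕ}
    (hN : (T α)^[N + 1] '' cylinderOf α (N + 1) x = Ico (α - 1) α) :
    1 ≤ jumpTime α x ∧ (T α)^[jumpTime α x] '' cylinderOf α (jumpTime α x) x = Ico (α - 1) α ∧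
      ∀ y ∈ cylinderOf α (jumpTime α x) x, jumpTime α y = jumpTime α x := by
  have hmem : jumpTime α x ∈ {n : ℕ | 1 ≤ n ∧
      (T α)^[n] '' cylinder α n (fun k => digit α k x) = Ico (α - 1) α} :=
    Nat.sInf_mem ⟨N + 1, by omega, hN⟩
  refine ⟨hmem.1, hmem.2, fun y hy => le_antisymm ?_ ?_⟩
  · refine Nat.sInf_le ⟨hmem.1, ?_⟩
    change (T α)^[_] '' cylinderOf α _ y = _
    rw [cylinderOf_eq hy le_rfl]
    exact hmem.2
  · by_contra! hlt
    have hy' : jumpTime α y ∈ {n : ℕ | 1 ≤ n ∧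
        (T α)^[n] '' cylinder α n (fun k => digit α k y) = Ico (α - 1) α} := by
      refine Nat.sInf_mem ⟨jumpTime α x, hmem.1, ?_⟩
      change (T α)^[_] '' cylinderOf α _ y = _
      rw [cylinderOf_eq hy le_rfl]
      exact hmem.2
    refine Nat.notMem_of_lt_sInf hlt ⟨hy'.1, ?_⟩
    change (T α)^[_] '' cylinderOf α _ x = _
    rw [← cylinderOf_eq hy hlt.le]
    exact hy'.2

theorem mem_cylinderOf_add {α : ℝ} (hα : α ∈ Icc (1 / 2 : ℝ) 1) {m n : ℕ} {x y : ℝ} :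
    y ∈ cylinderOf α (m + n) x ↔
      y ∈ cylinderOf α n x ∧ (T α)^[n] y ∈ cylinderOf α m ((T α)^[n] x) := by
  simp only [mem_cylinderOf, ← Function.iterate_add_apply]
  constructor
  · rintro ⟨hy, h⟩
    exact ⟨⟨hy, fun k hk => h k (by omega)⟩, iterate_T_mem hα hy n, fun k hk => h _ (by omega)⟩
  · rintro ⟨⟨hy, h1⟩, -, h2⟩
    refine ⟨hy, fun k hk => ?_⟩
    rcases lt_or_ge k n with h | h
    · exact h1 k h
    · obtain ⟨j, rfl⟩ := Nat.exists_eq_add_of_le' h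
      exact h2 j (by omega)

/-- Every point outside the exceptional set lies in full cylinders of arbitrarily large order on
which an iterate of the jump transformation is an iterate of `T α`. -/
theorem exists_full_cylinderOf {α x : ℝ} (hα : α ∈ Icc (1 / 2 : ℝ) 1) (hx : x ∈ Ico (α - 1) α)
    (h0 : ∀ k, (T α)^[k] x ≠ 0) (hfull : ∀ k, (T α)^[k] x ∉ noFullCylinder α) (m : ℕ) :
    ∃ n, m ≤ n ∧ (T α)^[n] '' cylinderOf α n x = Ico (α - 1) α ∧
      ∀ y ∈ cylinderOf α n x, (jumpT α)^[m] y = (T α)^[n] y := by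
  induction m with
  | zero => exact ⟨0, le_rfl, image_cylinderOf_zero α x, fun _ _ => rfl⟩
  | succ m ih =>
    obtain ⟨n, hmn, hn, hjump⟩ := ih
    obtain ⟨N, hN⟩ : ∃ N, (T α)^[N + 1] '' cylinderOf α (N + 1) ((T α)^[n] x) =
        Ico (α - 1) α := by
      by_contra! hcon
      refine hfull n ⟨iterate_T_mem hα hx n, fun k => ?_, hcon⟩
      rw [← Function.iterate_add_apply]
      exact h0 _
    obtain ⟨h1, h2, h3⟩ := jumpTime_spec hN
    refine ⟨jumpTime α ((T α)^[n] x) + n, by omega, ?_, fun y hy => ?_⟩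
    · refine Subset.antisymm (image_cylinderOf_subset hα _) fun z hz => ?_
      rw [← h2] at hz
      obtain ⟨u, hu, rfl⟩ := hz
      have hun : u ∈ (T α)^[n] '' cylinderOf α n x := hn ▸ hu.1
      obtain ⟨y, hy, rfl⟩ := hun
      exact ⟨y, (mem_cylinderOf_add hα).2 ⟨hy, hu⟩, Function.iterate_add_apply _ _ _ _⟩
    · obtain ⟨hyn, hyj⟩ := (mem_cylinderOf_add hα).1 hy
      rw [Function.iterate_succ_apply', hjump y hyn, Function.iterate_add_apply, ← h3 _ hyj]
      rfl

theorem volume_image_le_of_dist_le {f : ℝ → ℝ} {s : Set ℝ} {K : ℝ} (hK : 0 ≤ K)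
    (h : ∀ u ∈ s, ∀ v ∈ s, |f u - f v| ≤ K * |u - v|) :
    volume (f '' s) ≤ ENNReal.ofReal K * volume s := by
  have hL : LipschitzOnWith K.toNNReal f s := by
    refine LipschitzOnWith.of_dist_le_mul fun u hu v hv => ?_
    rw [Real.dist_eq, Real.dist_eq, Real.coe_toNNReal K hK]
    exact h u hu v hv
  have := hL.hausdorffMeasure_image_le zero_le_one
  rwa [hausdorffMeasure_real, ENNReal.rpow_one] at this

/-- Any set `B ⊆ [α - 1, α)` occupies a definite proportion of a ball around the base point of a
full cylinder, after pulling back by the branch of that cylinder. -/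
theorem volume_le_mul_of_full {α x C : ℝ} (hα : α ∈ Icc (1 / 2 : ℝ) 1) (hC : 0 < C)
    (hdist : ∀ (n : ℕ) (x u v : ℝ), x ∈ Ico (α - 1) α → (∀ k, (T α)^[k] x ≠ 0) →
      u ∈ cylinderOf α n x → v ∈ cylinderOf α n x → orbitProd α n u ≤ C * orbitProd α n v)
    (hx : x ∈ Ico (α - 1) α) (h0 : ∀ k, (T α)^[k] x ≠ 0) {n : ℕ}
    (hfull : (T α)^[n] '' cylinderOf α n x = Ico (α - 1) α) {B D : Set ℝ}
    (hB : B ⊆ Ico (α - 1) α)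
    (hD : ∀ᵐ y, y ∈ cylinderOf α n x → (T α)^[n] y ∈ B → y ∈ D) :
    volume B ≤ ENNReal.ofReal (2 * C ^ 3) *
      (volume (D ∩ Metric.closedBall x (C * orbitProd α n x ^ 2)) /
        volume (Metric.closedBall x (C * orbitProd α n x ^ 2))) := by
  have hP : 0 < orbitProd α n x := orbitProd_pos fun k _ => h0 k
  set P := orbitProd α n x with hPdef
  have hxx := self_mem_cylinderOf n hx
  have hne {u : ℝ} (hu : u ∈ cylinderOf α n x) : ∀ k < n, (T α)^[k] u ≠ 0 :=
    fun k => iterate_ne_zero_of_mem_cylinderOf hα hx h0 hu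
  set S := cylinderOf α n x ∩ (T α)^[n] ⁻¹' B with hS
  have himage : (T α)^[n] '' S = B := by
    rw [hS, image_inter_preimage, hfull, inter_eq_right.2 hB]
  have hlip : ∀ u ∈ S, ∀ v ∈ S, |(T α)^[n] u - (T α)^[n] v| ≤ C ^ 2 / P ^ 2 * |u - v| := by
    intro u hu v hv
    rw [abs_sub_eq_of_mem_cylinderOf (hne hu.1) (hne hv.1) hu.1 hv.1]
    have h1 := hdist n x x u hx h0 hxx hu.1
    have h2 := hdist n x x v hx h0 hxx hv.1
    have h3 : P * P ≤ C * orbitProd α n u * (C * orbitProd α n v) :=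
      mul_le_mul h1 h2 hP.le (hP.le.trans h1)
    rw [div_mul_eq_mul_div, le_div_iff₀ (by positivity)]
    calc |(T α)^[n] u - (T α)^[n] v| * P ^ 2
        ≤ |(T α)^[n] u - (T α)^[n] v| * (C * orbitProd α n u * (C * orbitProd α n v)) := by
          rw [pow_two]
          gcongr
      _ = _ := by ring
  have hball : cylinderOf α n x ⊆ Metric.closedBall x (C * P ^ 2) := by
    intro y hy
    rw [Metric.mem_closedBall, Real.dist_eq]
    refine (abs_sub_le_of_mem_cylinderOf hα (hne hy) (hne hxx) hy hxx).trans ?_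
    calc orbitProd α n y * orbitProd α n x ≤ C * P * P := by
          gcongr
          exact hdist n x y x hx h0 hy hxx
      _ = C * P ^ 2 := by ring
  have hSD : volume S ≤ volume (D ∩ Metric.closedBall x (C * P ^ 2)) := by
    refine measure_mono_ae ?_
    filter_upwards [hD] with y hy hyS
    exact ⟨hy hyS.1 hyS.2, hball hyS.1⟩
  calc volume B = volume ((T α)^[n] '' S) := by rw [himage]
    _ ≤ ENNReal.ofReal (C ^ 2 / P ^ 2) * volume S := volume_image_le_of_dist_le (by positivity) hlip
    _ ≤ ENNReal.ofReal (C ^ 2 / P ^ 2) * volume (D ∩ Metric.closedBall x (C * P ^ 2)) := by gcongr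
    _ = _ := by
      rw [Real.volume_closedBall, ENNReal.div_eq_inv_mul, ← mul_assoc,
        ← ENNReal.ofReal_inv_of_pos (by positivity), ← ENNReal.ofReal_mul (by positivity)]
      congr 2
      field_simp

/-- The jump transformation T̊_α is ergodic w.r.t. Lebesgue measure: every Borel set
A ⊆ [α−1, α) with T̊_α⁻¹(A) = A up to Lebesgue null sets satisfies λ(A) = 0 or
λ([α−1, α) \ A) = 0. -/
theorem jumpT_ergodic (α : ℝ) (hα : α ∈ Set.Icc (1 / 2 : ℝ) 1)
    (A : Set ℝ) (hA : MeasurableSet A) (hAsub : A ⊆ Set.Ico (α - 1) α)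
    (hinv : volume (symmDiff (jumpT α ⁻¹' A ∩ Set.Ico (α - 1) α) A) = 0) :
    volume A = 0 ∨ volume (Set.Ico (α - 1) α \ A) = 0 := by
  obtain ⟨C, hC, hdist⟩ := exists_orbitProd_le hα
  have hBmeas : MeasurableSet (Ico (α - 1) α \ A) := measurableSet_Ico.diff hA
  by_contra! hcon
  obtain ⟨hA0, hB0⟩ := hcon
  have hsymm := ae_iterate_T_notMem (α := α) hinv
  refine hA0 (measure_eq_zero_iff_ae_notMem.2 ?_)
  filter_upwards [Besicovitch.ae_tendsto_measure_inter_div_of_measurableSet volume hBmeas,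
    ae_iterate_T_notMem (α := α) (volume_noFullCylinder hα),
    ae_iterate_T_notMem (α := α) (measure_singleton (0 : ℝ))] with x hdens hfull h0 hxA
  have hx := hAsub hxA
  have hinvariant : ∀ y ∈ Ico (α - 1) α,
      (∀ n, (T α)^[n] y ∉ symmDiff (jumpT α ⁻¹' A ∩ Ico (α - 1) α) A) →
      ∀ m, ((jumpT α)^[m] y ∈ A ↔ y ∈ A) := by
    intro y hy hyE m
    induction m with
    | zero => rfl
    | succ m ih =>
      obtain ⟨n, hn⟩ := exists_jumpT_iterate_eq α m y
      have hI := iterate_T_mem hα hy n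
      have hE := hyE n
      rw [← hn] at hI hE
      rw [← ih, Function.iterate_succ_apply']
      simp only [mem_symmDiff, mem_inter_iff, mem_preimage] at hE
      tauto
  choose n hmn hn hjump using exists_full_cylinderOf hα hx h0 hfull
  have hbound (m : ℕ) := volume_le_mul_of_full (D := Ico (α - 1) α \ A) hα hC hdist hx h0 (hn m)
    (sdiff_subset (s := Ico (α - 1) α) (t := A)) (by
      filter_upwards [hsymm] with y hyE hy hyB
      refine ⟨hy.1, fun hyA => hyB.2 ?_⟩
      rw [← hjump m y hy]
      exact (hinvariant y hy.1 hyE m).2 hyA)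
  have hradius : Filter.Tendsto (fun m => C * orbitProd α (n m) x ^ 2) Filter.atTop
      (nhdsWithin 0 (Ioi 0)) := by
    refine tendsto_nhdsWithin_iff.2 ⟨?_, .of_forall fun m => ?_⟩
    · have h := ((tendsto_orbitProd hα hx).comp
        (Filter.tendsto_atTop_mono hmn Filter.tendsto_id)).pow 2
      simpa using h.const_mul C
    · have : 0 < orbitProd α (n m) x := orbitProd_pos fun k _ => h0 k
      exact mem_Ioi.2 (by positivity)
  have hlim := ENNReal.Tendsto.const_mul (a := ENNReal.ofReal (2 * C ^ 3)) (hdens.comp hradius)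
    (Or.inr ENNReal.ofReal_ne_top)
  rw [indicator_of_notMem (fun h => h.2 hxA), mul_zero] at hlim
  exact hB0 (le_antisymm (ge_of_tendsto' hlim hbound) zero_le)
end

section
/- For α ∈ [1/2, 1], the map T_α is exact with respect to μ_α: every set A belonging to the tail σ-algebra ⋂_{n≥0} T_α^{−n}(𝔅), where 𝔅 is the Borel σ-algebra of [α−1, α), satisfies μ_α(A) = 0 or μ_α(A) = 1. -/
open MeasureTheory Set

namespace TanakaIto

/-- The points of `(α - 1, α)` whose whole orbit avoids `0` and `α - 1`. -/
def core (α : ℝ) : Set ℝ :=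
  {x | ∀ k : ℕ, (T α)^[k] x ∈ Ioo (α - 1) α ∧ (T α)^[k] x ≠ 0}

/-- The first digit, without a special value at `0`. -/
noncomputable def firstDigit (α x : ℝ) : ℤ := ⌊1 / x + 1 - α⌋

/-- `x` and `y` have the same first `n` digits. -/
def SameDigits (α : ℝ) (n : ℕ) (x y : ℝ) : Prop :=
  ∀ k < n, firstDigit α ((T α)^[k] x) = firstDigit α ((T α)^[k] y)

/-- The points of the core with the same first `n` digits as `x`. -/
def fiber (α : ℝ) (n : ℕ) (x : ℝ) : Set ℝ := {y ∈ core α | SameDigits α n x y}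

/-- The product of the absolute values of the first `n` points of the orbit of `x`; its inverse
square is the absolute derivative of the `n`-th iterate at `x`. -/
noncomputable def orbitProd (α : ℝ) (n : ℕ) (x : ℝ) : ℝ :=
  ∏ k ∈ Finset.range n, |(T α)^[k] x|

variable {α : ℝ}

lemma T_eq {x : ℝ} (hx : x ≠ 0) : T α x = 1 / x - firstDigit α x := by
  simp [T, hx, firstDigit]

lemma mem_Ioo_of_mem_core {x : ℝ} (hx : x ∈ core α) : x ∈ Ioo (α - 1) α := (hx 0).1

lemma ne_zero_of_mem_core {x : ℝ} (hx : x ∈ core α) : x ≠ 0 := (hx 0).2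

lemma T_mem_core {x : ℝ} (hx : x ∈ core α) : T α x ∈ core α := fun k ↦ by
  simpa only [← Function.iterate_succ_apply] using hx (k + 1)

lemma iterate_mem_core {x : ℝ} (hx : x ∈ core α) (n : ℕ) : (T α)^[n] x ∈ core α := fun k ↦ by
  simpa only [← Function.iterate_add_apply] using hx (k + n)

lemma mem_core_of_T_mem {x : ℝ} (hx : x ∈ Ioo (α - 1) α) (h0 : x ≠ 0) (hT : T α x ∈ core α) :
    x ∈ core α := by
  rintro (_ | k)
  · exact ⟨hx, h0⟩
  · simpa only [Function.iterate_succ_apply] using hT k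

lemma sameDigits_succ {n : ℕ} {x y : ℝ} :
    SameDigits α (n + 1) x y ↔
      firstDigit α x = firstDigit α y ∧ SameDigits α n (T α x) (T α y) := by
  constructor
  · intro h
    exact ⟨h 0 n.succ_pos, fun k hk ↦ by simpa using h (k + 1) (by omega)⟩
  · rintro ⟨h0, h⟩ (_ | k) hk
    · exact h0
    · simpa using h k (by omega)

lemma one_div_eq {x : ℝ} (hx : x ≠ 0) : 1 / x = firstDigit α x + T α x := by
  rw [T_eq hx]; ring

lemma eq_one_div {x : ℝ} (hx : x ≠ 0) : x = 1 / (firstDigit α x + T α x) := by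
  rw [← one_div_eq hx, one_div_one_div]

lemma abs_lt_of_mem_core (hα : α ∈ Icc (1 / 2 : ℝ) 1) {x : ℝ} (hx : x ∈ core α) : |x| < α := by
  obtain ⟨h1, h2⟩ := mem_Ioo_of_mem_core hx
  rw [abs_lt]
  constructor <;> linarith [hα.1]

lemma one_le_firstDigit (hα : α ∈ Icc (1 / 2 : ℝ) 1) {x : ℝ} (hx : x ∈ core α) (h : 0 < x) :
    1 ≤ firstDigit α x := by
  have h1 := (abs_lt.1 (abs_lt_of_mem_core hα hx)).2
  have h2 : 1 ≤ 1 / x := by rw [le_div_iff₀ h]; linarith [hα.2]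
  rw [firstDigit, Int.le_floor]
  push_cast
  linarith [hα.2]

lemma firstDigit_le_neg_one (hα : α ∈ Icc (1 / 2 : ℝ) 1) {x : ℝ} (hx : x ∈ core α) (h : x < 0) :
    firstDigit α x ≤ -1 := by
  have h1 := (abs_lt.1 (abs_lt_of_mem_core hα hx)).1
  have h2 : 1 / x ≤ -1 := by rw [div_le_iff_of_neg h]; linarith [hα.2]
  have : firstDigit α x < 0 := by
    rw [firstDigit, Int.floor_lt]
    push_cast
    linarith [hα.1]
  omega

lemma abs_mul_abs_T_le (hα : α ∈ Icc (1 / 2 : ℝ) 1) {x : ℝ} (hx : x ∈ core α) :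
    |x| * |T α x| ≤ α / (1 + α) := by
  obtain ⟨hα1, hα2⟩ := hα
  have hT := abs_lt_of_mem_core ⟨hα1, hα2⟩ (T_mem_core hx)
  have key : |x| ≤ 1 / (1 + α) → |x| * |T α x| ≤ α / (1 + α) := fun h ↦ by
    calc |x| * |T α x| ≤ 1 / (1 + α) * α := by gcongr
      _ = α / (1 + α) := by ring
  obtain ⟨h1, h2⟩ := mem_Ioo_of_mem_core hx
  rcases lt_or_gt_of_ne (ne_zero_of_mem_core hx) with h | h
  · apply key
    rw [abs_of_neg h, le_div_iff₀ (by linarith)]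
    nlinarith
  · have ha := one_le_firstDigit ⟨hα1, hα2⟩ hx h
    have e := one_div_eq (α := α) h.ne'
    have hTI := mem_Ioo_of_mem_core (T_mem_core hx)
    rcases ha.eq_or_lt with ha | ha
    · rw [← ha] at e
      push_cast at e
      have e' : x * T α x = 1 - x := by
        have : T α x = 1 / x - 1 := by linarith
        rw [this]; field_simp
      rw [← abs_mul, e', abs_of_nonneg (by linarith), le_div_iff₀ (by linarith)]
      have : 1 / x < 1 + α := by linarith [hTI.2]
      rw [div_lt_iff₀ h] at this
      nlinarith
    · apply key
      rw [abs_of_pos h, le_div_comm₀ h (by linarith), e]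
      have : (2 : ℝ) ≤ firstDigit α x := by exact_mod_cast ha
      linarith [hTI.1]

/-- `z ↦ 1 / (a + z)` is the inverse branch with digit `a`. -/
lemma firstDigit_inverse_branch {z : ℝ} (hz : z ∈ core α) (a : ℤ) :
    firstDigit α (1 / (a + z)) = a := by
  obtain ⟨h1, h2⟩ := mem_Ioo_of_mem_core hz
  rw [firstDigit, one_div_one_div, Int.floor_eq_iff]
  constructor <;> linarith

lemma inverse_branch_pos (hα : α ∈ Icc (1 / 2 : ℝ) 1) {z : ℝ} (hz : z ∈ core α) {a : ℤ}
    (ha : 0 < a) : 0 < 1 / (a + z) := by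
  obtain ⟨h1, h2⟩ := mem_Ioo_of_mem_core hz
  have : (1 : ℝ) ≤ a := by exact_mod_cast ha
  apply one_div_pos.2
  linarith [hα.1]

lemma inverse_branch_neg (hα : α ∈ Icc (1 / 2 : ℝ) 1) {z : ℝ} (hz : z ∈ core α) {a : ℤ}
    (ha : a < 0) : 1 / (a + z) < 0 := by
  obtain ⟨h1, h2⟩ := mem_Ioo_of_mem_core hz
  have : (a : ℝ) ≤ -1 := by exact_mod_cast Int.le_sub_one_of_lt ha
  apply one_div_neg.2
  linarith [hα.2]

lemma inverse_branch_mul_pos (hα : α ∈ Icc (1 / 2 : ℝ) 1) {x z : ℝ} (hx : x ∈ core α)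
    (hz : z ∈ core α) : 0 < x * (1 / (firstDigit α x + z)) := by
  rcases lt_or_gt_of_ne (ne_zero_of_mem_core hx) with h | h
  · have := firstDigit_le_neg_one hα hx h
    exact mul_pos_of_neg_of_neg h (inverse_branch_neg hα hz (by omega))
  · have := one_le_firstDigit hα hx h
    exact mul_pos h (inverse_branch_pos hα hz (by omega))

lemma T_inverse_branch (hα : α ∈ Icc (1 / 2 : ℝ) 1) {x z : ℝ} (hx : x ∈ core α)
    (hz : z ∈ core α) : T α (1 / (firstDigit α x + z)) = z := by
  have := inverse_branch_mul_pos hα hx hz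
  rw [T_eq (right_ne_zero_of_mul this.ne'), firstDigit_inverse_branch hz, one_div_one_div]
  ring

lemma inverse_branch_mem_core (hα : α ∈ Icc (1 / 2 : ℝ) 1) {x z : ℝ} (hx : x ∈ core α)
    (hz : z ∈ core α) (h : 1 / (firstDigit α x + z) ∈ Ioo (α - 1) α) :
    1 / (firstDigit α x + z) ∈ core α :=
  mem_core_of_T_mem h (right_ne_zero_of_mul (inverse_branch_mul_pos hα hx hz).ne')
    (by rwa [T_inverse_branch hα hx hz])

/-- The level sets of the first digit on either side of `0` are order convex. -/
lemma firstDigit_eq_of_between {x y z : ℝ} (hxz : 0 < x * z) (hxy : x ≤ y) (hyz : y ≤ z)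
    (h : firstDigit α x = firstDigit α z) : firstDigit α y = firstDigit α x := by
  have hinv : 1 / z ≤ 1 / y ∧ 1 / y ≤ 1 / x := by
    rcases pos_and_pos_or_neg_and_neg_of_mul_pos hxz with ⟨hx, -⟩ | ⟨-, hz⟩
    · exact ⟨one_div_le_one_div_of_le (hx.trans_le hxy) hyz, one_div_le_one_div_of_le hx hxy⟩
    · exact ⟨one_div_le_one_div_of_neg_of_le hz hyz,
        one_div_le_one_div_of_neg_of_le (hyz.trans_lt hz) hxy⟩
  apply le_antisymm
  · exact Int.floor_le_floor (by linarith [hinv.2])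
  · rw [h]
    exact Int.floor_le_floor (by linarith [hinv.1])

lemma T_sub_T {x y : ℝ} (hx : x ≠ 0) (hy : y ≠ 0) (h : firstDigit α x = firstDigit α y) :
    x - y = -(T α x - T α y) * x * y := by
  rw [T_eq hx, T_eq hy, h]
  field_simp
  ring

lemma orbitProd_succ (n : ℕ) (x : ℝ) :
    orbitProd α (n + 1) x = |x| * orbitProd α n (T α x) := by
  simp [orbitProd, Finset.prod_range_succ', mul_comm]

lemma orbitProd_pos {x : ℝ} (hx : x ∈ core α) (n : ℕ) : 0 < orbitProd α n x :=
  Finset.prod_pos fun k _ ↦ abs_pos.2 (hx k).2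

lemma orbitProd_sq_le (hα : α ∈ Icc (1 / 2 : ℝ) 1) (n : ℕ) :
    ∀ {x : ℝ}, x ∈ core α → orbitProd α n x ^ 2 ≤ 2 * (α / (1 + α)) ^ n := by
  obtain ⟨hα1, hα2⟩ := hα
  induction n using Nat.twoStepInduction with
  | zero => intro x _; simp [orbitProd]
  | one =>
    intro x hx
    have := abs_lt_of_mem_core ⟨hα1, hα2⟩ hx
    have h2 : |x| ^ 2 ≤ α ^ 2 := by gcongr
    simp only [orbitProd, Finset.prod_range_one, Function.iterate_zero, id_eq, pow_one]
    refine h2.trans ?_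
    rw [← mul_div_assoc, le_div_iff₀ (by linarith)]
    nlinarith
  | more n ih _ =>
    intro x hx
    have h1 := abs_mul_abs_T_le ⟨hα1, hα2⟩ hx
    have h2 := ih (T_mem_core (T_mem_core hx))
    calc orbitProd α (n + 2) x ^ 2
        = (|x| * |T α x|) ^ 2 * orbitProd α n (T α (T α x)) ^ 2 := by
          rw [orbitProd_succ, orbitProd_succ]; ring
      _ ≤ (α / (1 + α)) ^ 2 * (2 * (α / (1 + α)) ^ n) := by gcongr
      _ = _ := by ring

lemma orbitProd_mul_le (hα : α ∈ Icc (1 / 2 : ℝ) 1) (n : ℕ) {x y : ℝ} (hx : x ∈ core α)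
    (hy : y ∈ core α) : orbitProd α n x * orbitProd α n y ≤ 2 * (α / (1 + α)) ^ n := by
  nlinarith [orbitProd_sq_le hα n hx, orbitProd_sq_le hα n hy,
    sq_nonneg (orbitProd α n x - orbitProd α n y)]

lemma abs_sub_eq (n : ℕ) :
    ∀ {x y : ℝ}, x ∈ core α → y ∈ core α → SameDigits α n x y →
      |x - y| = |(T α)^[n] x - (T α)^[n] y| * (orbitProd α n x * orbitProd α n y) := by
  induction n with
  | zero => intro x y _ _ _; simp [orbitProd]
  | succ n ih =>
    intro x y hx hy h
    obtain ⟨h0, h⟩ := sameDigits_succ.1 h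
    rw [T_sub_T (ne_zero_of_mem_core hx) (ne_zero_of_mem_core hy) h0, abs_mul, abs_mul, abs_neg,
      ih (T_mem_core hx) (T_mem_core hy) h, orbitProd_succ, orbitProd_succ]
    simp only [Function.iterate_succ_apply]
    ring

lemma abs_sub_lt_one {x y : ℝ} (hx : x ∈ core α) (hy : y ∈ core α) : |x - y| < 1 := by
  obtain ⟨h1, h2⟩ := mem_Ioo_of_mem_core hx
  obtain ⟨h3, h4⟩ := mem_Ioo_of_mem_core hy
  rw [abs_lt]
  constructor <;> linarith

lemma abs_sub_le (hα : α ∈ Icc (1 / 2 : ℝ) 1) (n : ℕ) {x y : ℝ} (hx : x ∈ core α)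
    (hy : y ∈ core α) (h : SameDigits α n x y) : |x - y| ≤ 2 * (α / (1 + α)) ^ n := by
  have h1 := abs_sub_lt_one (iterate_mem_core hx n) (iterate_mem_core hy n)
  have h2 := (mul_pos (orbitProd_pos hx n) (orbitProd_pos hy n)).le
  rw [abs_sub_eq n hx hy h]
  exact (mul_le_of_le_one_left h2 h1.le).trans (orbitProd_mul_le hα n hx hy)

lemma ratio_le_half (hα : α ∈ Icc (1 / 2 : ℝ) 1) : α / (1 + α) ≤ 1 / 2 := by
  rw [div_le_div_iff₀ (by linarith [hα.1]) two_pos]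
  linarith [hα.2]

lemma abs_le_abs_mul_exp (hα : α ∈ Icc (1 / 2 : ℝ) 1) {x y : ℝ} (hx : x ∈ core α)
    (hy : y ∈ core α) (h : firstDigit α x = firstDigit α y) :
    |x| ≤ |y| * Real.exp |T α x - T α y| := by
  have h1 := T_sub_T (ne_zero_of_mem_core hx) (ne_zero_of_mem_core hy) h
  have h2 : |x - y| = |T α x - T α y| * |x| * |y| := by
    rw [h1, abs_mul, abs_mul, abs_neg]
  have h3 : |x| ≤ 1 := (abs_lt_of_mem_core hα hx).le.trans hα.2
  have h4 : |x| ≤ |y| + |x - y| := by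
    have := abs_sub_abs_le_abs_sub x y
    linarith
  have h5 := Real.add_one_le_exp |T α x - T α y|
  calc |x| ≤ |y| + |T α x - T α y| * |x| * |y| := h2 ▸ h4
    _ ≤ |y| + |T α x - T α y| * 1 * |y| := by gcongr
    _ = |y| * (|T α x - T α y| + 1) := by ring
    _ ≤ _ := by gcongr

/-- Bounded distortion with a sum over the orbit in the exponent. -/
lemma orbitProd_le_mul_exp_sum (hα : α ∈ Icc (1 / 2 : ℝ) 1) (n : ℕ) :
    ∀ {x y : ℝ}, x ∈ core α → y ∈ core α → SameDigits α n x y →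
      orbitProd α n x ≤ orbitProd α n y *
        Real.exp (2 * ∑ k ∈ Finset.range n, (1 / 2 : ℝ) ^ k) := by
  induction n with
  | zero => intro x y _ _ _; simp [orbitProd]
  | succ n ih =>
    intro x y hx hy h
    obtain ⟨h0, h⟩ := sameDigits_succ.1 h
    have hT : |T α x - T α y| ≤ 2 * (1 / 2 : ℝ) ^ n :=
      (abs_sub_le hα n (T_mem_core hx) (T_mem_core hy) h).trans <| by
        have := ratio_le_half hα
        have : 0 ≤ α / (1 + α) := div_nonneg (by linarith [hα.1]) (by linarith [hα.1])
        gcongr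
    have h1 := abs_le_abs_mul_exp hα hx hy h0
    have h2 := ih (T_mem_core hx) (T_mem_core hy) h
    have h3 := (orbitProd_pos (T_mem_core hx) n).le
    rw [orbitProd_succ, orbitProd_succ, Finset.sum_range_succ, mul_add, Real.exp_add]
    calc |x| * orbitProd α n (T α x)
        ≤ (|y| * Real.exp (2 * (1 / 2 : ℝ) ^ n)) * (orbitProd α n (T α y) *
          Real.exp (2 * ∑ k ∈ Finset.range n, (1 / 2 : ℝ) ^ k)) := by
          refine mul_le_mul (h1.trans ?_) h2 h3 (by positivity)
          gcongr
      _ = _ := by ring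

/-- Bounded distortion. -/
lemma orbitProd_le_mul (hα : α ∈ Icc (1 / 2 : ℝ) 1) (n : ℕ) {x y : ℝ} (hx : x ∈ core α)
    (hy : y ∈ core α) (h : SameDigits α n x y) :
    orbitProd α n x ≤ orbitProd α n y * Real.exp 4 := by
  refine (orbitProd_le_mul_exp_sum hα n hx hy h).trans ?_
  have := (orbitProd_pos hy n).le
  have h2 : ∑ k ∈ Finset.range n, (1 / 2 : ℝ) ^ k ≤ 2 := sum_geometric_two_le n
  gcongr
  linarith

/-- The points of `J` whose cylinder, restricted to `J`, is not mapped onto the core by any of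
the first `n` iterates. -/
def slowSet (α : ℝ) (n : ℕ) (J : Set ℝ) : Set ℝ :=
  {x ∈ J | ∀ k, 1 ≤ k → k ≤ n → ¬ core α ⊆ (T α)^[k] '' (J ∩ fiber α k x)}

/-- `J` is order convex relative to the core. -/
def CoreConvex (α : ℝ) (J : Set ℝ) : Prop :=
  ∀ ⦃x⦄, x ∈ J → ∀ ⦃y⦄, y ∈ J → ∀ ⦃z⦄, z ∈ core α → x ≤ z → z ≤ y → z ∈ J

lemma slowSet_subset (n : ℕ) (J : Set ℝ) : slowSet α n J ⊆ J := fun _ h ↦ h.1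

/-- An inverse branch reverses the order. -/
lemma inverse_branch_le (hα : α ∈ Icc (1 / 2 : ℝ) 1) {p z : ℝ} (hp : p ∈ core α)
    (hz : z ∈ core α) :
    (T α p ≤ z → 1 / (firstDigit α p + z) ≤ p) ∧ (z ≤ T α p → p ≤ 1 / (firstDigit α p + z)) := by
  have hpos := inverse_branch_mul_pos hα hp hz
  have h := T_sub_T (α := α) (ne_zero_of_mem_core hp) (right_ne_zero_of_mul hpos.ne')
    (firstDigit_inverse_branch hz _).symm
  rw [T_inverse_branch hα hp hz, mul_assoc] at h
  constructor <;> intro h' <;> nlinarith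

lemma CoreConvex.image (hα : α ∈ Icc (1 / 2 : ℝ) 1) {J : Set ℝ} (hJ : J ⊆ core α)
    (hc : CoreConvex α J) (a : ℤ) : CoreConvex α (T α '' {x ∈ J | firstDigit α x = a}) := by
  rintro _ ⟨p, ⟨hpJ, rfl⟩, rfl⟩ _ ⟨q, ⟨hqJ, hq⟩, rfl⟩ z hz hpz hzq
  have h1 := (inverse_branch_le hα (hJ hpJ) hz).1 hpz
  have h2 := (inverse_branch_le hα (hJ hqJ) hz).2 hzq
  rw [hq] at h2
  have hmem := inverse_branch_mem_core hα (hJ hpJ) hz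
    ⟨(mem_Ioo_of_mem_core (hJ hqJ)).1.trans_le h2, h1.trans_lt (mem_Ioo_of_mem_core (hJ hpJ)).2⟩
  exact ⟨_, ⟨hc hqJ hpJ hmem h2 h1, firstDigit_inverse_branch hz _⟩,
    T_inverse_branch hα (hJ hpJ) hz⟩

/-- If `J` meets digits other than that of `x` on both sides of `x`, then the first cylinder
at `x` is contained in `J` and is mapped onto the core. -/
lemma core_subset_image_of_between (hα : α ∈ Icc (1 / 2 : ℝ) 1) {J : Set ℝ} (hJ : J ⊆ core α)
    (hc : CoreConvex α J) {x y₁ y₂ : ℝ} (hx : x ∈ J) (h₁ : y₁ ∈ J) (h₂ : y₂ ∈ J)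
    (hlt₁ : y₁ < x) (hlt₂ : x < y₂) (hd₁ : firstDigit α y₁ ≠ firstDigit α x)
    (hd₂ : firstDigit α y₂ ≠ firstDigit α x) :
    core α ⊆ T α '' {y ∈ J | firstDigit α y = firstDigit α x} := by
  intro z hz
  have hpos := inverse_branch_mul_pos hα (hJ hx) hz
  have hdig := firstDigit_inverse_branch hz (firstDigit α x)
  have hT := T_inverse_branch hα (hJ hx) hz
  have hmem := inverse_branch_mem_core hα (hJ hx) hz
  set w := 1 / (firstDigit α x + z)
  have hw₁ : y₁ < w := by
    by_contra! h
    exact hd₁ ((firstDigit_eq_of_between (by rwa [mul_comm]) h hlt₁.le hdig).trans hdig)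
  have hw₂ : w < y₂ := by
    by_contra! h
    exact hd₂ (firstDigit_eq_of_between hpos hlt₂.le h hdig.symm)
  have hw := hmem ⟨(mem_Ioo_of_mem_core (hJ h₁)).1.trans hw₁,
    hw₂.trans (mem_Ioo_of_mem_core (hJ h₂)).2⟩
  exact ⟨w, ⟨hc h₁ h₂ hw hw₁.le hw₂.le, hdig⟩, hT⟩

lemma T_mem_slowSet {n : ℕ} {J : Set ℝ} (hJ : J ⊆ core α) {x : ℝ}
    (hx : x ∈ slowSet α (n + 1) J) :
    T α x ∈ slowSet α n (T α '' {y ∈ J | firstDigit α y = firstDigit α x}) := by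
  refine ⟨⟨x, ⟨hx.1, rfl⟩, rfl⟩, fun k h1 hk hsub ↦ hx.2 (k + 1) (by omega) (by omega) ?_⟩
  intro z hz
  obtain ⟨_, ⟨⟨v, ⟨hvJ, hv⟩, rfl⟩, -, hs⟩, rfl⟩ := hsub hz
  exact ⟨v, ⟨hvJ, hJ hvJ, sameDigits_succ.2 ⟨hv.symm, hs⟩⟩, rfl⟩

/-- The slow points of `J` split into those in the leftmost and those in the rightmost first
cylinder of `J`. -/
lemma exists_slowSet_succ_subset (hα : α ∈ Icc (1 / 2 : ℝ) 1) {J : Set ℝ} (hJ : J ⊆ core α)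
    (hc : CoreConvex α J) (n : ℕ) :
    ∃ a b : ℤ, ∀ x ∈ slowSet α (n + 1) J, firstDigit α x = a ∨ firstDigit α x = b := by
  have key : ∀ x ∈ slowSet α (n + 1) J,
      (∀ y ∈ J, y < x → firstDigit α y = firstDigit α x) ∨
        (∀ y ∈ J, x < y → firstDigit α y = firstDigit α x) := by
    intro x hx
    by_contra! h
    obtain ⟨⟨y₁, h₁, hlt₁, hd₁⟩, y₂, h₂, hlt₂, hd₂⟩ := h
    refine hx.2 1 le_rfl (by omega) fun z hz ↦ ?_
    obtain ⟨y, ⟨hy, hyd⟩, rfl⟩ :=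
      core_subset_image_of_between hα hJ hc hx.1 h₁ h₂ hlt₁ hlt₂ hd₁ hd₂ hz
    refine ⟨y, ⟨hy, hJ hy, ?_⟩, rfl⟩
    exact sameDigits_succ.2 ⟨hyd.symm, fun k hk ↦ absurd hk k.not_lt_zero⟩
  have hl : ∃ a : ℤ, ∀ x ∈ J, (∀ y ∈ J, y < x → firstDigit α y = firstDigit α x) →
      firstDigit α x = a := by
    by_cases h : ∃ p ∈ J, ∀ y ∈ J, y < p → firstDigit α y = firstDigit α p
    · obtain ⟨p, hp, hp'⟩ := h
      refine ⟨firstDigit α p, fun x hx hx' ↦ ?_⟩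
      rcases lt_trichotomy x p with h | rfl | h
      · exact hp' x hx h
      · rfl
      · exact (hx' p hp h).symm
    · push Not at h
      exact ⟨0, fun x hx hx' ↦ by
        obtain ⟨y, hy, hlt, hne⟩ := h x hx
        exact absurd (hx' y hy hlt) hne⟩
  have hr : ∃ b : ℤ, ∀ x ∈ J, (∀ y ∈ J, x < y → firstDigit α y = firstDigit α x) →
      firstDigit α x = b := by
    by_cases h : ∃ p ∈ J, ∀ y ∈ J, p < y → firstDigit α y = firstDigit α p
    · obtain ⟨p, hp, hp'⟩ := h
      refine ⟨firstDigit α p, fun x hx hx' ↦ ?_⟩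
      rcases lt_trichotomy x p with h | rfl | h
      · exact (hx' p hp h).symm
      · rfl
      · exact hp' x hx h
    · push Not at h
      exact ⟨0, fun x hx hx' ↦ by
        obtain ⟨y, hy, hlt, hne⟩ := h x hx
        exact absurd (hx' y hy hlt) hne⟩
  obtain ⟨a, ha⟩ := hl
  obtain ⟨b, hb⟩ := hr
  exact ⟨a, b, fun x hx ↦ (key x hx).imp (ha x hx.1) (hb x hx.1)⟩

/-- A monotone subadditive set function that is at most `c` on sets with constant first `n`
digits is at most `2 ^ n * c` on slow sets. -/
lemma slowSet_le (hα : α ∈ Icc (1 / 2 : ℝ) 1) (c : ENNReal) (n : ℕ) :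
    ∀ (θ : Set ℝ → ENNReal), Monotone θ → (∀ A B, θ (A ∪ B) ≤ θ A + θ B) →
      (∀ S ⊆ core α, (∀ x ∈ S, ∀ y ∈ S, SameDigits α n x y) → θ S ≤ c) →
      ∀ J ⊆ core α, CoreConvex α J → θ (slowSet α n J) ≤ 2 ^ n * c := by
  induction n with
  | zero =>
    intro θ hmono _ hθ J hJ _
    rw [pow_zero, one_mul]
    exact hθ _ ((slowSet_subset 0 J).trans hJ) fun x _ y _ k hk ↦ absurd hk k.not_lt_zero
  | succ n ih =>
    intro θ hmono hsub hθ J hJ hc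
    have hdigit : ∀ a : ℤ, θ {x ∈ slowSet α (n + 1) J | firstDigit α x = a} ≤ 2 ^ n * c := by
      intro a
      have := ih (fun E ↦ θ {x ∈ core α | firstDigit α x = a ∧ T α x ∈ E})
        (fun E F hEF ↦ hmono fun x hx ↦ ⟨hx.1, hx.2.1, hEF hx.2.2⟩)
        (fun E F ↦ (hmono fun x hx ↦ by
          rcases hx with ⟨h1, h2, h3 | h3⟩
          · exact Or.inl ⟨h1, h2, h3⟩
          · exact Or.inr ⟨h1, h2, h3⟩).trans (hsub _ _))
        (fun S hS hdig ↦ hθ _ (fun x hx ↦ hx.1) fun x hx y hy ↦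
          sameDigits_succ.2 ⟨hx.2.1.trans hy.2.1.symm, hdig _ hx.2.2 _ hy.2.2⟩)
        (T α '' {y ∈ J | firstDigit α y = a})
        (by rintro _ ⟨y, hy, rfl⟩; exact T_mem_core (hJ hy.1))
        (hc.image hα hJ a)
      refine (hmono ?_).trans this
      rintro x ⟨hx, rfl⟩
      exact ⟨hJ hx.1, rfl, T_mem_slowSet hJ hx⟩
    obtain ⟨a, b, hab⟩ := exists_slowSet_succ_subset hα hJ hc n
    calc θ (slowSet α (n + 1) J)
        ≤ θ ({x ∈ slowSet α (n + 1) J | firstDigit α x = a} ∪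
            {x ∈ slowSet α (n + 1) J | firstDigit α x = b}) :=
          hmono fun x hx ↦ (hab x hx).imp (⟨hx, ·⟩) (⟨hx, ·⟩)
      _ ≤ 2 ^ n * c + 2 ^ n * c := (hsub _ _).trans (add_le_add (hdigit a) (hdigit b))
      _ = 2 ^ (n + 1) * c := by ring

/-- The points of the core whose cylinder is mapped onto the core by some iterate. -/
def fullSet (α : ℝ) : Set ℝ :=
  {x ∈ core α | ∃ k, 1 ≤ k ∧ core α ⊆ (T α)^[k] '' fiber α k x}

lemma volume_le_of_sameDigits (hα : α ∈ Icc (1 / 2 : ℝ) 1) {n : ℕ} {S : Set ℝ}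
    (hS : S ⊆ core α) (h : ∀ x ∈ S, ∀ y ∈ S, SameDigits α n x y) :
    volume S ≤ ENNReal.ofReal (2 * (α / (1 + α)) ^ n) := by
  refine (Real.volume_le_diam S).trans (Metric.ediam_le fun x hx y hy ↦ ?_)
  rw [edist_dist, Real.dist_eq]
  exact ENNReal.ofReal_le_ofReal (abs_sub_le hα n (hS hx) (hS hy) (h x hx y hy))

lemma core_subset_fullSet_of_eq_one : core 1 ⊆ fullSet 1 := by
  intro x hx
  refine ⟨hx, 1, le_rfl, fun z hz ↦ ?_⟩
  have hα : (1 : ℝ) ∈ Icc (1 / 2 : ℝ) 1 := by norm_num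
  have hx0 := mem_Ioo_of_mem_core hx
  have hz0 := mem_Ioo_of_mem_core hz
  rw [sub_self] at hx0 hz0
  have hd : (1 : ℝ) ≤ firstDigit 1 x := by exact_mod_cast one_le_firstDigit hα hx hx0.1
  have hmem := inverse_branch_mem_core hα hx hz ⟨by
    rw [sub_self]; apply one_div_pos.2; linarith [hz0.1], by
    rw [div_lt_one] <;> linarith [hz0.1]⟩
  refine ⟨_, ⟨hmem, sameDigits_succ.2 ⟨(firstDigit_inverse_branch hz _).symm,
    fun k hk ↦ absurd hk k.not_lt_zero⟩⟩, T_inverse_branch hα hx hz⟩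

lemma volume_core_diff_fullSet (hα : α ∈ Icc (1 / 2 : ℝ) 1) :
    volume (core α \ fullSet α) = 0 := by
  rcases hα.2.eq_or_lt with rfl | hlt
  · rw [sdiff_eq_empty.2 core_subset_fullSet_of_eq_one, measure_empty]
  have hκ0 : 0 ≤ α / (1 + α) := div_nonneg (by linarith [hα.1]) (by linarith [hα.1])
  have hκ : 2 * (α / (1 + α)) < 1 := by
    rw [← mul_div_assoc, div_lt_one] <;> linarith [hα.1]
  have hle : ∀ n, volume (core α \ fullSet α) ≤ ENNReal.ofReal (2 * (2 * (α / (1 + α))) ^ n) := by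
    intro n
    calc volume (core α \ fullSet α) ≤ volume (slowSet α n (core α)) :=
          measure_mono fun x hx ↦ ⟨hx.1, fun k h1 _ hk ↦ hx.2 ⟨hx.1, k, h1,
            hk.trans (image_mono inter_subset_right)⟩⟩
      _ ≤ 2 ^ n * ENNReal.ofReal (2 * (α / (1 + α)) ^ n) :=
          slowSet_le hα _ n (fun S ↦ volume S) (fun _ _ h ↦ measure_mono h)
            (fun A B ↦ measure_union_le A B)
            (fun S hS h ↦ volume_le_of_sameDigits hα hS h) _ subset_rfl
            (fun _ _ _ _ _ hz _ _ ↦ hz)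
      _ = _ := by
          rw [← ENNReal.ofReal_ofNat 2, ← ENNReal.ofReal_pow zero_le_two,
            ← ENNReal.ofReal_mul (by positivity), mul_pow]
          ring_nf
  have hlim : Filter.Tendsto (fun n : ℕ ↦ ENNReal.ofReal (2 * (2 * (α / (1 + α))) ^ n))
      Filter.atTop (nhds 0) := by
    have := (tendsto_pow_atTop_nhds_zero_of_lt_one (mul_nonneg zero_le_two hκ0) hκ).const_mul 2
    simpa using ENNReal.tendsto_ofReal this
  exact le_antisymm (ge_of_tendsto' hlim hle) zero_le

lemma core_subset_image_fiber_add {n k : ℕ} {x : ℝ}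
    (hn : core α ⊆ (T α)^[n] '' fiber α n x)
    (hk : core α ⊆ (T α)^[k] '' fiber α k ((T α)^[n] x)) :
    core α ⊆ (T α)^[k + n] '' fiber α (k + n) x := by
  intro z hz
  obtain ⟨u, ⟨hu, hdu⟩, rfl⟩ := hk hz
  obtain ⟨v, ⟨hv, hdv⟩, rfl⟩ := hn hu
  refine ⟨v, ⟨hv, fun j hj ↦ ?_⟩, Function.iterate_add_apply ..⟩
  rcases lt_or_ge j n with h | h
  · exact hdv j h
  · obtain ⟨i, rfl⟩ := Nat.exists_eq_add_of_le' h
    simpa only [Function.iterate_add_apply] using hdu i (by omega)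

/-- If the orbit stays in the full set, then infinitely many cylinders at `x` are full. -/
lemma exists_full_fiber {x : ℝ} (hx : ∀ j, (T α)^[j] x ∈ fullSet α) (N : ℕ) :
    ∃ n ≥ N, core α ⊆ (T α)^[n] '' fiber α n x := by
  induction N with
  | zero => exact ⟨0, le_rfl, fun z hz ↦ ⟨z, ⟨hz, fun k hk ↦ absurd hk k.not_lt_zero⟩, rfl⟩⟩
  | succ N ih =>
    obtain ⟨n, hn, hfull⟩ := ih
    obtain ⟨-, k, hk, hfull'⟩ := hx n
    exact ⟨k + n, by omega, core_subset_image_fiber_add hfull hfull'⟩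

/-- Images under a full branch: the volume of the complement of `B` in the core is controlled by
the density at `x` of the complement of the `n`-th preimage of `B`. -/
lemma volume_core_diff_le (hα : α ∈ Icc (1 / 2 : ℝ) 1) {n : ℕ} {x : ℝ} (hx : x ∈ core α)
    (hfull : core α ⊆ (T α)^[n] '' fiber α n x) (A B : Set ℝ)
    (hAB : ∀ y ∈ core α, y ∈ A → (T α)^[n] y ∈ B) :
    volume (core α \ B) ≤ ENNReal.ofReal (2 * Real.exp 4 ^ 3) *
      (volume (Aᶜ ∩ Metric.closedBall x (Real.exp 4 * orbitProd α n x ^ 2)) /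
        volume (Metric.closedBall x (Real.exp 4 * orbitProd α n x ^ 2))) := by
  set p := orbitProd α n x with hp
  have hp0 : 0 < p := orbitProd_pos hx n
  have hD : 0 < Real.exp 4 := Real.exp_pos 4
  set K : NNReal := ⟨(Real.exp 4) ^ 2 / p ^ 2, by positivity⟩ with hK
  have hlip : LipschitzOnWith K (T α)^[n] (fiber α n x \ A) := by
    refine LipschitzOnWith.of_dist_le_mul ?_
    rintro y ⟨⟨hy, hxy⟩, -⟩ z ⟨⟨hz, hxz⟩, -⟩
    have hyz : SameDigits α n y z := fun k hk ↦ (hxy k hk).symm.trans (hxz k hk)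
    have h1 := orbitProd_le_mul hα n hx hy hxy
    have h2 := orbitProd_le_mul hα n hx hz hxz
    have h3 : p * p ≤ (orbitProd α n y * Real.exp 4) * (orbitProd α n z * Real.exp 4) :=
      mul_le_mul h1 h2 hp0.le (hp0.le.trans h1)
    rw [Real.dist_eq, Real.dist_eq, abs_sub_eq n hy hz hyz]
    change _ ≤ (Real.exp 4) ^ 2 / p ^ 2 * _
    rw [div_mul_eq_mul_div, le_div_iff₀ (by positivity)]
    calc |(T α)^[n] y - (T α)^[n] z| * p ^ 2 = |(T α)^[n] y - (T α)^[n] z| * (p * p) := by ring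
      _ ≤ |(T α)^[n] y - (T α)^[n] z| *
          ((orbitProd α n y * Real.exp 4) * (orbitProd α n z * Real.exp 4)) := by gcongr
      _ = _ := by ring
  have himage : volume ((T α)^[n] '' (fiber α n x \ A)) ≤ K * volume (fiber α n x \ A) := by
    have := hlip.hausdorffMeasure_image_le zero_le_one
    rwa [hausdorffMeasure_real, ENNReal.rpow_one] at this
  have hball : fiber α n x \ A ⊆ Aᶜ ∩ Metric.closedBall x (Real.exp 4 * p ^ 2) := by
    rintro y ⟨⟨hy, hxy⟩, hyA⟩
    refine ⟨hyA, ?_⟩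
    have h1 := orbitProd_le_mul hα n hy hx fun k hk ↦ (hxy k hk).symm
    have h2 := abs_sub_lt_one (iterate_mem_core hx n) (iterate_mem_core hy n)
    have h3 := orbitProd_pos hy n
    rw [Metric.mem_closedBall, dist_comm, Real.dist_eq, abs_sub_eq n hx hy hxy]
    calc _ ≤ 1 * (p * (p * Real.exp 4)) := by gcongr
      _ = _ := by ring
  have hsub : core α \ B ⊆ (T α)^[n] '' (fiber α n x \ A) := by
    rintro z ⟨hz, hzB⟩
    obtain ⟨v, hv, rfl⟩ := hfull hz
    exact ⟨v, ⟨hv, fun hvA ↦ hzB (hAB v hv.1 hvA)⟩, rfl⟩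
  have hr : 0 < Real.exp 4 * p ^ 2 := by positivity
  have hvol : (K : ENNReal) = ENNReal.ofReal (2 * Real.exp 4 ^ 3) /
      volume (Metric.closedBall x (Real.exp 4 * p ^ 2)) := by
    rw [Real.volume_closedBall, ← ENNReal.ofReal_div_of_pos (by positivity),
      ← ENNReal.ofReal_coe_nnreal]
    congr 1
    change (Real.exp 4) ^ 2 / p ^ 2 = _
    field_simp
  calc volume (core α \ B) ≤ K * volume (fiber α n x \ A) := (measure_mono hsub).trans himage
    _ ≤ K * volume (Aᶜ ∩ Metric.closedBall x (Real.exp 4 * p ^ 2)) := by gcongr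
    _ = _ := by rw [hvol, div_eq_mul_inv, div_eq_mul_inv]; ring

/-- Along its full cylinders, the images of a set around a density point exhaust the core. -/
lemma exists_tendsto_volume_core_diff (hα : α ∈ Icc (1 / 2 : ℝ) 1) {A : Set ℝ} {B : ℕ → Set ℝ}
    (hAB : ∀ n, ∀ y ∈ core α, y ∈ A → (T α)^[n] y ∈ B n) {x : ℝ} (hx : x ∈ core α)
    (hfull : ∀ N, ∃ n ≥ N, core α ⊆ (T α)^[n] '' fiber α n x)
    (hdens : Filter.Tendsto (fun r ↦ volume (Aᶜ ∩ Metric.closedBall x r) /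
      volume (Metric.closedBall x r)) (nhdsWithin 0 (Ioi 0)) (nhds 0)) :
    ∃ φ : ℕ → ℕ, Filter.Tendsto (fun j ↦ volume (core α \ B (φ j))) Filter.atTop (nhds 0) := by
  choose φ hφ hφfull using hfull
  refine ⟨φ, ?_⟩
  have hsq : Filter.Tendsto (fun n ↦ Real.exp 4 * orbitProd α n x ^ 2) Filter.atTop
      (nhdsWithin 0 (Ioi 0)) := by
    refine tendsto_nhdsWithin_iff.2 ⟨?_, .of_forall fun n ↦ ?_⟩
    · have hκ0 : 0 ≤ α / (1 + α) := div_nonneg (by linarith [hα.1]) (by linarith [hα.1])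
      have h := (tendsto_pow_atTop_nhds_zero_of_lt_one hκ0
        ((ratio_le_half hα).trans_lt one_half_lt_one)).const_mul 2
      rw [mul_zero] at h
      have := (squeeze_zero (fun n ↦ sq_nonneg (orbitProd α n x))
        (fun n ↦ orbitProd_sq_le hα n hx) h).const_mul (Real.exp 4)
      rwa [mul_zero] at this
    · have := orbitProd_pos hx n
      exact mem_Ioi.2 (by positivity)
  have h := ENNReal.Tendsto.const_mul (a := ENNReal.ofReal (2 * Real.exp 4 ^ 3))
    (hdens.comp (hsq.comp (Filter.tendsto_atTop_mono hφ Filter.tendsto_id)))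
    (Or.inr ENNReal.ofReal_ne_top)
  rw [mul_zero] at h
  exact tendsto_of_tendsto_of_tendsto_of_le_of_le tendsto_const_nhds h (fun _ ↦ zero_le)
    fun j ↦ volume_core_diff_le hα hx (hφfull j) A _ (hAB _)

lemma ae_mem_core {μ : Measure ℝ} (hT : MeasurePreserving (T α) μ μ)
    (hac : μ ≪ volume.restrict (Ico (α - 1) α)) : ∀ᵐ x ∂μ, x ∈ core α := by
  have h : ∀ᵐ x ∂μ, x ∈ Ioo (α - 1) α ∧ x ≠ 0 := by
    apply hac.ae_le
    filter_upwards [ae_restrict_mem measurableSet_Ico,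
      ae_restrict_of_ae (Measure.ae_ne volume (α - 1)),
      ae_restrict_of_ae (Measure.ae_ne volume 0)] with x hx h1 h0
    exact ⟨⟨lt_of_le_of_ne hx.1 h1.symm, hx.2⟩, h0⟩
  exact ae_all_iff.2 fun k ↦ (hT.iterate k).quasiMeasurePreserving.ae h

lemma ae_iterate_mem_fullSet (hα : α ∈ Icc (1 / 2 : ℝ) 1) {μ : Measure ℝ}
    (hT : MeasurePreserving (T α) μ μ) (hac : μ ≪ volume.restrict (Ico (α - 1) α)) :
    ∀ᵐ x ∂μ, ∀ j, (T α)^[j] x ∈ fullSet α := by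
  have h : ∀ᵐ x ∂μ, x ∈ fullSet α := by
    have h1 : ∀ᵐ x ∂μ, x ∉ core α \ fullSet α :=
      (hac.trans Measure.absolutelyContinuous_restrict).ae_le <|
        measure_eq_zero_iff_ae_notMem.1 (volume_core_diff_fullSet hα)
    filter_upwards [ae_mem_core hT hac, h1] with x hx hx'
    by_contra hxF
    exact hx' ⟨hx, hxF⟩
  exact ae_all_iff.2 fun j ↦ (hT.iterate j).quasiMeasurePreserving.ae h

lemma tendsto_measure_zero_of_absolutelyContinuous {Ω : Type*} [MeasurableSpace Ω]
    {μ ν : Measure Ω} [IsFiniteMeasure μ] [SigmaFinite ν] (h : μ ≪ ν) {s : ℕ → Set Ω}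
    (hs : Filter.Tendsto (fun j ↦ ν (s j)) Filter.atTop (nhds 0)) :
    Filter.Tendsto (fun j ↦ μ (s j)) Filter.atTop (nhds 0) := by
  have := tendsto_setLIntegral_zero (μ := ν) (Measure.lintegral_rnDeriv_lt_top μ ν).ne hs
  simpa only [Measure.setLIntegral_rnDeriv h] using this

end TanakaIto

open TanakaIto

/-- T_α is exact w.r.t. μ_α: every set in the tail σ-algebra ⋂_{n≥0} T_α^{−n}(𝔅),
where 𝔅 is the Borel σ-algebra of [α−1, α), has μ_α-measure 0 or 1. -/
theorem T_exact (α : ℝ) (hα : α ∈ Set.Icc (1 / 2 : ℝ) 1)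
    (μ : Measure ℝ) (hprob : IsProbabilityMeasure μ) (herg : Ergodic (T α) μ)
    (hac : μ ≪ volume.restrict (Set.Ico (α - 1) α))
    (hca : volume.restrict (Set.Ico (α - 1) α) ≪ μ)
    (A : Set ℝ)
    (hA : ∀ n : ℕ, ∃ B : Set ℝ, MeasurableSet B ∧ B ⊆ Set.Ico (α - 1) α ∧
      A = {x ∈ Set.Ico (α - 1) α | (T α)^[n] x ∈ B}) :
    μ A = 0 ∨ μ A = 1 := by
  have hT := herg.toMeasurePreserving
  choose B hBm hBI hB using hA
  have hAm : MeasurableSet A := by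
    rw [hB 0]
    exact measurableSet_Ico.inter (hBm 0)
  have hμI : ∀ᵐ x ∂μ, x ∈ Ico (α - 1) α := hac.ae_le (ae_restrict_mem measurableSet_Ico)
  have hcompl : ∀ n, μ Aᶜ = μ (core α \ B n) := by
    intro n
    calc μ Aᶜ = μ ((T α)^[n] ⁻¹' (B n)ᶜ) := by
          apply measure_congr
          filter_upwards [hμI] with x hx
          refine propext (not_congr ?_)
          rw [hB n]
          exact and_iff_right hx
      _ = μ (B n)ᶜ := (hT.iterate n).measure_preimage (hBm n).compl.nullMeasurableSet
      _ = μ (core α \ B n) := by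
          apply measure_congr
          filter_upwards [ae_mem_core hT hac] with x hx
          exact propext (and_iff_right hx).symm
  by_cases hA0 : μ A = 0
  · exact Or.inl hA0
  right
  have hdens := (hac.trans Measure.absolutelyContinuous_restrict).ae_le
    (Besicovitch.ae_tendsto_measure_inter_div_of_measurableSet volume hAm.compl)
  obtain ⟨x, hxA, hx, hxF, hxd⟩ := ((frequently_ae_mem_iff.2 hA0).and_eventually
    ((ae_mem_core hT hac).and ((ae_iterate_mem_fullSet hα hT hac).and hdens))).exists
  rw [indicator_of_notMem (notMem_compl_iff.2 hxA)] at hxd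
  obtain ⟨φ, hφ⟩ := exists_tendsto_volume_core_diff hα (A := A) (B := B)
    (fun n y _ hy ↦ by rw [hB n] at hy; exact hy.2) hx (exists_full_fiber hxF) hxd
  have hlim := tendsto_measure_zero_of_absolutelyContinuous
    (hac.trans Measure.absolutelyContinuous_restrict) hφ
  simp only [← hcompl] at hlim
  exact (prob_compl_eq_zero_iff hAm).1 (tendsto_nhds_unique tendsto_const_nhds hlim)
end

section
/- Let α ∈ (g, 1) and d = −⌊1/(α−1) + 1 − α⌋. Then Ω_α ⊆ X_α, where X_α = [α−1, T_α(α−1)] × [1/(2−√2−d), 1/(1−√2−d)] ∪ [α−1, α] × [1/(1−√2−d), 2−√2] ∪ [1/α − 1, α] × [2−√2, √2]. -/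
open MeasureTheory Set

/-- The points of the polygon `X_α` that lie over the interval `[α - 1, α)`, with `s = √2`. -/
def polygonOverInterval (α s : ℝ) (d : ℤ) : Set (ℝ × ℝ) :=
  {p | p.1 ∈ Set.Ico (α - 1) α ∧
    p ∈ Set.Icc (α - 1) (T α (α - 1)) ×ˢ
          Set.Icc (1 / (2 - s - (d : ℝ))) (1 / (1 - s - (d : ℝ))) ∪
        Set.Icc (α - 1) α ×ˢ Set.Icc (1 / (1 - s - (d : ℝ))) (2 - s) ∪
        Set.Icc (1 / α - 1) α ×ˢ Set.Icc (2 - s) s}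

lemma sub_digit_mem_Ico (α x : ℝ) :
    1 / x - ⌊1 / x + 1 - α⌋ ∈ Set.Ico (α - 1) α := by
  have h1 := Int.floor_le (1 / x + 1 - α)
  have h2 := Int.lt_floor_add_one (1 / x + 1 - α)
  constructor <;> linarith

lemma sq_add_gt_one_of_g_lt {α : ℝ} (h : g < α) : 1 < α ^ 2 + α ∧ 1 / 2 < α := by
  have h5 : Real.sqrt 5 ^ 2 = 5 := Real.sq_sqrt (by norm_num)
  have h5' : 2 < Real.sqrt 5 := by
    rw [Real.lt_sqrt] <;> norm_num
  unfold g at h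
  constructor <;> nlinarith

lemma three_le_of_digit {α : ℝ} (hg : g < α) (h1 : α < 1) {d : ℤ}
    (hd : d = -⌊1 / (α - 1) + 1 - α⌋) : 3 ≤ d := by
  obtain ⟨hq, hα⟩ := sq_add_gt_one_of_g_lt hg
  have h : ⌊1 / (α - 1) + 1 - α⌋ < -2 := by
    rw [Int.floor_lt]
    have : 1 / (α - 1) < α - 3 := by
      rw [div_lt_iff_of_neg (by linarith)]
      nlinarith
    push_cast
    linarith
  omega

/-- In the extremal case `d = 3`, points left of `T α (α - 1)` have digit at least `3`. -/
lemma three_le_digit_of_le {α x : ℝ} (hg : g < α) (h1 : α < 1) (hx : 0 < x)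
    (hxT : x ≤ 1 / (α - 1) + 3) : 3 ≤ ⌊1 / x + 1 - α⌋ := by
  obtain ⟨hq, hα⟩ := sq_add_gt_one_of_g_lt hg
  have h : 1 / (α - 1) + 3 ≤ 1 / (2 + α) := by
    have hne : α - 1 ≠ 0 := by linarith
    have e : 1 / (2 + α) - (1 / (α - 1) + 3)
        = 3 * (α ^ 2 + α - 1) / ((2 + α) * (1 - α)) := by
      have : (2 + α) ≠ 0 := by linarith
      have : 1 - α ≠ 0 := by linarith
      have e2 : 1 / (α - 1) = - (1 / (1 - α)) := by
        rw [← neg_sub, one_div, one_div, inv_neg]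
      rw [e2]
      field_simp
      ring
    have : 0 ≤ 3 * (α ^ 2 + α - 1) / ((2 + α) * (1 - α)) := by
      apply div_nonneg
      · linarith
      · apply mul_nonneg <;> linarith
    linarith
  have h2 : 2 + α ≤ 1 / x := by
    rw [le_div_iff₀ hx]
    have := (le_div_iff₀ (by linarith : 0 < 2 + α)).1 (hxT.trans h)
    linarith
  rw [Int.le_floor]
  push_cast
  linarith

lemma NT_mem_polygonOverInterval {α s : ℝ} (hg : g < α) (h1 : α < 1) (hs : s ^ 2 = 2)
    (hs1 : 1.414 < s) (hs2 : s < 1.415) {d : ℤ} (hd : d = -⌊1 / (α - 1) + 1 - α⌋)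
    {p : ℝ × ℝ} (hp : p ∈ polygonOverInterval α s d) :
    NT α p ∈ polygonOverInterval α s d := by
  have hd3 := three_le_of_digit hg h1 hd
  have hd3' : (3 : ℝ) ≤ d := by exact_mod_cast hd3
  obtain ⟨hq, hα⟩ := sq_add_gt_one_of_g_lt hg
  have hT : T α (α - 1) = 1 / (α - 1) + d := by
    unfold T
    rw [if_neg (by linarith), hd]
    push_cast
    ring
  have hlo2 : 1 / (1 - s - (d : ℝ)) < 0 := div_neg_of_pos_of_neg one_pos (by linarith)
  have hlo2' : s / 2 - 1 ≤ 1 / (1 - s - (d : ℝ)) := by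
    rw [le_div_iff_of_neg (by linarith)]
    nlinarith
  have hlo1' : 1 - s ≤ 1 / (2 - s - (d : ℝ)) := by
    rw [le_div_iff_of_neg (by linarith)]
    nlinarith
  obtain ⟨x, y⟩ := p
  unfold polygonOverInterval at hp ⊢
  rw [hT] at hp ⊢
  simp only [mem_ofPred_eq, mem_union, mem_prod, mem_Icc, mem_Ico] at hp
  obtain ⟨⟨hx1, hx2⟩, hy⟩ := hp
  unfold NT
  by_cases hx0 : x = 0
  · simp only [hx0, if_true, mem_ofPred_eq, mem_union, mem_prod, mem_Icc, mem_Ico]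
    exact ⟨⟨by linarith, by linarith⟩, Or.inl (Or.inr ⟨⟨by linarith, by linarith⟩,
      by linarith, by linarith⟩)⟩
  simp only [hx0, if_false, mem_ofPred_eq, mem_union, mem_prod, mem_Icc]
  have hI := sub_digit_mem_Ico α x
  refine ⟨hI, ?_⟩
  set a : ℤ := ⌊1 / x + 1 - α⌋ with ha
  obtain ⟨hI1, hI2⟩ := hI
  rcases lt_or_gt_of_ne hx0 with hneg | hpos
  · have hinv : 1 / x ≤ 1 / (α - 1) := one_div_le_one_div_of_neg_of_le hneg hx1
    have had : a ≤ -d := by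
      rw [hd, neg_neg]
      exact Int.floor_le_floor (by linarith)
    have hys : y ≤ 2 - s := by
      rcases hy with (h | h) | h
      · linarith
      · linarith
      · have : 1 < 1 / α := by rw [lt_div_iff₀ (by linarith)]; linarith
        linarith
    have hA : (a : ℝ) ≤ -d := by exact_mod_cast had
    have hy0 : 1 / (y + a) < 0 := div_neg_of_pos_of_neg one_pos (by linarith)
    left
    by_cases hc : 1 / (1 - s - (d : ℝ)) ≤ 1 / (y + a)
    · right
      exact ⟨⟨hI1, hI2.le⟩, hc, by linarith⟩
    · left
      have hda : a = -d := by
        by_contra hne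
        have h' : a ≤ -d - 1 := by omega
        have hA' : (a : ℝ) ≤ -d - 1 := by exact_mod_cast h'
        exact hc (one_div_le_one_div_of_neg_of_le (by linarith) (by linarith))
      refine ⟨⟨hI1, ?_⟩, ?_, (not_le.1 hc).le⟩
      · rw [hda]
        push_cast
        linarith
      · exact one_div_le_one_div_of_neg_of_le (by linarith) (by linarith)
  · have hinv : 1 / α < 1 / x := one_div_lt_one_div_of_lt hpos hx2
    have hαinv : α < 1 / α ∧ 1 / α < 1 + α := by
      constructor
      · rw [lt_div_iff₀ (by linarith)]; nlinarith
      · rw [div_lt_iff₀ (by linarith)]; nlinarith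
    have ha1 : 1 ≤ a := by
      rw [ha, Int.le_floor]
      push_cast
      linarith
    have hA1 : (1 : ℝ) ≤ a := by exact_mod_cast ha1
    have hys : y ≤ s := by
      rcases hy with (h | h) | h <;> linarith
    have hyl : 1 - s ≤ y := by
      rcases hy with (h | h) | h <;> linarith
    have hy0 : 0 < 1 / (y + a) := one_div_pos.2 (by linarith)
    have key : s / 2 - 1 ≤ y ∨ 3 ≤ a := by
      rcases hy with (h | h) | h
      · rcases hd3.eq_or_lt with hd' | hd'
        · right
          apply three_le_digit_of_le hg h1 hpos
          have := h.1.2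
          rw [← hd'] at this
          exact_mod_cast this
        · left
          have hd4 : (4 : ℝ) ≤ d := by exact_mod_cast hd'
          refine le_trans ?_ h.2.1
          rw [le_div_iff_of_neg (by linarith)]
          nlinarith
      · left; linarith
      · left; linarith
    by_cases hc : 1 / (y + a) ≤ 2 - s
    · left; right
      exact ⟨⟨hI1, hI2.le⟩, by linarith, hc⟩
    · right
      have hlt : a < 2 := by
        by_contra hge
        apply hc
        rw [div_le_iff₀ (by linarith)]
        have hA2 : (2 : ℝ) ≤ a := by exact_mod_cast not_lt.1 hge
        rcases key with h | h
        · nlinarith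
        · have hA3 : (3 : ℝ) ≤ a := by exact_mod_cast h
          nlinarith
      have hae : a = 1 := by omega
      rw [hae] at hc hI2 ⊢
      push_cast at hc hI2 ⊢
      refine ⟨⟨by linarith, hI2.le⟩, (not_le.1 hc).le, ?_⟩
      have hyk : s / 2 - 1 ≤ y := by
        rcases key with h | h
        · exact h
        · omega
      rw [div_le_iff₀ (by linarith)]
      nlinarith

/-- For α ∈ (g, 1) and d = −⌊1/(α−1) + 1 − α⌋, the natural extension domain is
contained in the polygon X_α. -/
theorem Omega_subset_X (α : ℝ) (hα : α ∈ Set.Ioo g 1)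
    (d : ℤ) (hd : d = -⌊1 / (α - 1) + 1 - α⌋) :
    Omega α ⊆
      Set.Icc (α - 1) (T α (α - 1)) ×ˢ
          Set.Icc (1 / (2 - Real.sqrt 2 - (d : ℝ))) (1 / (1 - Real.sqrt 2 - (d : ℝ))) ∪
        Set.Icc (α - 1) α ×ˢ
          Set.Icc (1 / (1 - Real.sqrt 2 - (d : ℝ))) (2 - Real.sqrt 2) ∪
        Set.Icc (1 / α - 1) α ×ˢ
          Set.Icc (2 - Real.sqrt 2) (Real.sqrt 2) := by
  have hs : Real.sqrt 2 ^ 2 = 2 := Real.sq_sqrt (by norm_num)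
  have hs1 : 1.414 < Real.sqrt 2 := by rw [Real.lt_sqrt] <;> norm_num
  have hs2 : Real.sqrt 2 < 1.415 := by rw [Real.sqrt_lt'] <;> norm_num
  have hd3 : (3 : ℝ) ≤ d := by exact_mod_cast three_le_of_digit hα.1 hα.2 hd
  refine iUnion_subset fun n => closure_minimal ?_
    (((isClosed_Icc.prod isClosed_Icc).union (isClosed_Icc.prod isClosed_Icc)).union
      (isClosed_Icc.prod isClosed_Icc))
  rintro _ ⟨p, ⟨hp1, hp2⟩, rfl⟩
  have hp0 : p ∈ polygonOverInterval α (Real.sqrt 2) d := by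
    refine ⟨hp1, Or.inl (Or.inr ⟨⟨hp1.1, hp1.2.le⟩, ?_⟩)⟩
    rw [mem_singleton_iff.1 hp2]
    exact ⟨(div_neg_of_pos_of_neg one_pos (by linarith)).le, by linarith⟩
  have hmaps : MapsTo (NT α) (polygonOverInterval α (Real.sqrt 2) d)
      (polygonOverInterval α (Real.sqrt 2) d) :=
    fun _ hq => NT_mem_polygonOverInterval hα.1 hα.2 hs hs1 hs2 hd hq
  exact (hmaps.iterate n hp0).2
end

section
/- Let g ≤ α ≤ β ≤ 1, x ∈ [α−1, α), z ∈ [β−1, β). If x = z, or (x+1)(1−z) = 1, or (1−x)(z+1) = 1, then T_β(z) − T_α(x) ∈ {0, 1}. -/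
open MeasureTheory Set

/-- `T α x` lies in `[α - 1, α)` and differs from `1 / x` by an integer. -/
theorem exists_int_T_eq {α x : ℝ} (hx : x ≠ 0) :
    ∃ m : ℤ, T α x = 1 / x - m ∧ α - 1 ≤ T α x ∧ T α x < α := by
  refine ⟨⌊1 / x + 1 - α⌋, by simp [T, hx], ?_, ?_⟩ <;> simp only [T, hx, if_false]
  · linarith [Int.floor_le (1 / x + 1 - α)]
  · linarith [Int.lt_floor_add_one (1 / x + 1 - α)]

theorem T_sub_T_mem_of_one_div_sub_eq_int {α β x z : ℝ} (hαβ : α ≤ β) (hβα : β < α + 1)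
    (hx : x ≠ 0) (hz : z ≠ 0) {k : ℤ} (hk : 1 / z - 1 / x = k) :
    T β z - T α x ∈ ({0, 1} : Set ℝ) := by
  obtain ⟨m, hm, hm₁, hm₂⟩ := exists_int_T_eq (α := α) hx
  obtain ⟨n, hn, hn₁, hn₂⟩ := exists_int_T_eq (α := β) hz
  have hd : T β z - T α x = ((k - n + m : ℤ) : ℝ) := by
    push_cast
    linarith
  have hlow : -1 < k - n + m := by
    exact_mod_cast (by linarith : (-1 : ℝ) < ((k - n + m : ℤ) : ℝ))
  have hupp : k - n + m < 2 := by
    exact_mod_cast (by linarith : ((k - n + m : ℤ) : ℝ) < 2)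
  rw [hd]
  obtain h | h : k - n + m = 0 ∨ k - n + m = 1 := by omega
  all_goals simp [h]

/-- If x = z, or (x+1)(1−z) = 1, or (1−x)(z+1) = 1, then T_β(z) − T_α(x) ∈ {0, 1}. -/
theorem synchronization_diff (α β x z : ℝ)
    (hαβ : g ≤ α) (hαβ' : α ≤ β) (hβ : β ≤ 1)
    (hx : x ∈ Set.Ico (α - 1) α) (hz : z ∈ Set.Ico (β - 1) β)
    (h : x = z ∨ (x + 1) * (1 - z) = 1 ∨ (1 - x) * (z + 1) = 1) :
    T β z - T α x ∈ ({0, 1} : Set ℝ) := by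
  have hg : 0 < g := by
    have : (1 : ℝ) < Real.sqrt 5 := Real.lt_sqrt_of_sq_lt (by norm_num)
    unfold g
    linarith
  have hxz : x = 0 ↔ z = 0 := by
    rcases h with rfl | h | h
    · rfl
    all_goals constructor <;> rintro rfl <;> linarith
  by_cases hx0 : x = 0
  · simp [T, hx0, hxz.1 hx0]
  have hz0 : z ≠ 0 := fun hz0 => hx0 (hxz.2 hz0)
  obtain ⟨k, hk⟩ : ∃ k : ℤ, 1 / z - 1 / x = k := by
    rcases h with rfl | h | h
    · exact ⟨0, by simp⟩
    · refine ⟨1, ?_⟩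
      push_cast
      field_simp
      linarith
    · refine ⟨-1, ?_⟩
      push_cast
      field_simp
      linarith
  exact T_sub_T_mem_of_one_div_sub_eq_int hαβ' (by linarith) hx0 hz0 hk
end

section
/- Let g ≤ α ≤ β ≤ 1, x ∈ [α−1, α), z ∈ [β−1, β), and suppose x + z = 1. If x > 1/(α+1), then (T_α(x)+1)(1−z) = 1; if z > 1/(β+1), then (1−x)(T_β(z)+1) = 1; and if x ≤ 1/(α+1) and z ≤ 1/(β+1), then (T_α(x)+1)(T_β(z)+1) = 1. -/
open MeasureTheory Set

lemma g_pos : 0 < g := by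
  have : Real.sqrt 1 < Real.sqrt 5 := Real.sqrt_lt_sqrt (by norm_num) (by norm_num)
  rw [Real.sqrt_one] at this
  unfold g
  linarith

lemma g_sq_add_g : g ^ 2 + g = 1 := by
  have : Real.sqrt 5 ^ 2 = 5 := Real.sq_sqrt (by norm_num)
  unfold g
  linarith

lemma T_eq_one_div_sub {α x : ℝ} (n : ℤ) (hx : 0 < x) (hl : (n + α - 1) * x ≤ 1)
    (hu : 1 < (n + α) * x) : T α x = 1 / x - n := by
  have hl' : n + α - 1 ≤ 1 / x := (le_div_iff₀ hx).2 hl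
  have hu' : 1 / x < n + α := (div_lt_iff₀ hx).2 hu
  have hf : ⌊1 / x + 1 - α⌋ = n := Int.floor_eq_iff.2 ⟨by linarith, by linarith⟩
  rw [T, if_neg hx.ne', hf]

lemma T_add_one_of_gt {α x : ℝ} (hα : 0 < α) (hα' : α ≤ 1) (hx : 1 / (α + 1) < x)
    (hxα : x < α) : T α x + 1 = 1 / x := by
  have hx0 : 0 < x := lt_trans (by positivity) hx
  rw [div_lt_iff₀ (by linarith)] at hx
  rw [T_eq_one_div_sub 1 hx0 (by push_cast; nlinarith) (by push_cast; linarith)]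
  push_cast
  ring

/-- If `x ≤ 1 / (α + 1)` and `1 - x ≤ 1 / (β + 1)`, the first digit of `x` is `2`. -/
lemma T_eq_one_div_sub_two {α β x : ℝ} (hα : g ≤ α) (hβ : g ≤ β)
    (hx : x ≤ 1 / (α + 1)) (hx' : 1 - x ≤ 1 / (β + 1)) (hxβ : 1 - β < x) (hβ' : β ≤ 1) :
    T α x = 1 / x - 2 := by
  have hg := g_pos
  have hg2 := g_sq_add_g
  have hx0 : 0 < x := by linarith
  rw [le_div_iff₀ (by linarith)] at hx hx'
  have hu : 1 < (2 + α) * x := by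
    rcases hβ.eq_or_lt with rfl | hlt
    · nlinarith
    · have h1 : 1 < β * (α + 1) := by nlinarith
      nlinarith
  simpa using T_eq_one_div_sub 2 hx0 (by push_cast; linarith) (by push_cast; exact hu)

/-- Suppose x + z = 1. If x > 1/(α+1), then (T_α(x)+1)(1−z) = 1; if z > 1/(β+1),
then (1−x)(T_β(z)+1) = 1; if x ≤ 1/(α+1) and z ≤ 1/(β+1), then
(T_α(x)+1)(T_β(z)+1) = 1. -/
theorem synchronization_reflect (α β x z : ℝ)
    (hαβ : g ≤ α) (hαβ' : α ≤ β) (hβ : β ≤ 1)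
    (hx : x ∈ Set.Ico (α - 1) α) (hz : z ∈ Set.Ico (β - 1) β)
    (h : x + z = 1) :
    (x > 1 / (α + 1) → (T α x + 1) * (1 - z) = 1) ∧
    (z > 1 / (β + 1) → (1 - x) * (T β z + 1) = 1) ∧
    (x ≤ 1 / (α + 1) → z ≤ 1 / (β + 1) → (T α x + 1) * (T β z + 1) = 1) := by
  obtain ⟨-, hxα⟩ := hx
  obtain ⟨-, hzβ⟩ := hz
  have hg := g_pos
  have hx0 : 0 < x := by linarith
  have hz0 : 0 < z := by linarith
  have hxz : 1 - x = z := by linarith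
  have hzx : 1 - z = x := by linarith
  refine ⟨fun h1 => ?_, fun h2 => ?_, fun h1 h2 => ?_⟩
  · rw [T_add_one_of_gt (by linarith) (by linarith) h1 hxα, hzx, one_div_mul_cancel hx0.ne']
  · rw [T_add_one_of_gt (by linarith) hβ h2 hzβ, hxz, mul_one_div_cancel hz0.ne']
  · rw [T_eq_one_div_sub_two hαβ (hαβ.trans hαβ') h1 (hxz ▸ h2) (by linarith) hβ,
      T_eq_one_div_sub_two (hαβ.trans hαβ') hαβ h2 (hzx ▸ h1) (by linarith) (by linarith)]
    obtain rfl : z = 1 - x := hxz.symm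
    field_simp
    ring
end

section
/- Let g ≤ α < β ≤ 1, x ∈ [α−1, α), z ∈ [β−1, β), with z − x ∈ {0, 1} or x + z ∈ {0, 1}. Let n ≥ 1 be such that T_α^{n−1}(x) < β/(β+1). Then there exists k ≥ 1 such that T_β^k(z) − T_α^n(x) ∈ {0, 1} or T_α^n(x) + T_β^k(z) ∈ {0, 1}. -/
open MeasureTheory Set

/-- The two points differ by `0` or `1`, or add up to `0` or `1`. -/
def Synced (x z : ℝ) : Prop :=
  z - x ∈ ({0, 1} : Set ℝ) ∨ x + z ∈ ({0, 1} : Set ℝ)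

theorem T_mem_Ico {α : ℝ} (h0 : 0 < α) (h1 : α ≤ 1) (x : ℝ) : T α x ∈ Ico (α - 1) α := by
  unfold T
  split_ifs with hx
  · constructor <;> linarith
  · have h2 := Int.floor_le (1 / x + 1 - α)
    have h3 := Int.lt_floor_add_one (1 / x + 1 - α)
    constructor <;> linarith

theorem T_zero (α : ℝ) : T α 0 = 0 := if_pos rfl

theorem exists_T_eq (α : ℝ) {x : ℝ} (hx : x ≠ 0) : ∃ m : ℤ, T α x = 1 / x - m :=
  ⟨_, if_neg hx⟩

theorem T_eq_sub {α x : ℝ} (hx : x ≠ 0) (m : ℤ) (h1 : α - 1 ≤ 1 / x - m)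
    (h2 : 1 / x - m < α) : T α x = 1 / x - m := by
  have hm : ⌊1 / x + 1 - α⌋ = m := Int.floor_eq_iff.2 ⟨by linarith, by linarith⟩
  rw [T, if_neg hx, hm]

theorem int_cast_mem_pair {m : ℤ} (h1 : (-1 : ℝ) < m) (h2 : (m : ℝ) < 2) :
    (m : ℝ) ∈ ({0, 1} : Set ℝ) := by
  have h1' : -1 < m := by exact_mod_cast h1
  have h2' : m < 2 := by exact_mod_cast h2
  obtain rfl | rfl : m = 0 ∨ m = 1 := by lia
  · simp
  · simp

theorem synced_T_of_inv {α β x z : ℝ} (h0 : 1 / 2 < α) (hαβ : α < β) (hβ : β ≤ 1)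
    (hx : x ≠ 0) (hz : z ≠ 0) (m : ℤ) (h : 1 / z - 1 / x = m ∨ 1 / x + 1 / z = m) :
    Synced (T α x) (T β z) := by
  obtain ⟨hx1, hx2⟩ := T_mem_Ico (by linarith) (by linarith : α ≤ 1) x
  obtain ⟨hz1, hz2⟩ := T_mem_Ico (by linarith) hβ z
  obtain ⟨a, ha⟩ := exists_T_eq α hx
  obtain ⟨b, hb⟩ := exists_T_eq β hz
  rcases h with h | h
  · left
    have e : T β z - T α x = ((m - b + a : ℤ) : ℝ) := by push_cast; linarith
    rw [e]
    exact int_cast_mem_pair (by rw [← e]; linarith) (by rw [← e]; linarith)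
  · right
    have e : T α x + T β z = ((m - b - a : ℤ) : ℝ) := by push_cast; linarith
    rw [e]
    exact int_cast_mem_pair (by rw [← e]; linarith) (by rw [← e]; linarith)

theorem half_lt_g : 1 / 2 < g := by
  have : (2 : ℝ) < Real.sqrt 5 := Real.lt_sqrt_of_sq_lt (by norm_num)
  unfold g
  linarith

theorem one_div_le_one_add {α : ℝ} (h : g ≤ α) : 1 / α ≤ 1 + α := by
  have hg := half_lt_g
  have e : g * (1 + g) = 1 := by
    have := Real.sq_sqrt (show (0 : ℝ) ≤ 5 by norm_num)
    unfold g
    nlinarith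
  rw [div_le_iff₀ (by linarith)]
  nlinarith

theorem Synced.T_self {α β x : ℝ} (h0 : 1 / 2 < α) (hαβ : α < β) (hβ : β ≤ 1) :
    Synced (T α x) (T β x) := by
  by_cases hx : x = 0
  · subst hx
    simp [Synced, T_zero]
  · exact synced_T_of_inv h0 hαβ hβ hx hx 0 (by simp)

theorem Synced.T_neg {α β x : ℝ} (h0 : 1 / 2 < α) (hαβ : α < β) (hβ : β ≤ 1) :
    Synced (T α x) (T β (-x)) := by
  by_cases hx : x = 0
  · subst hx
    simp [Synced, T_zero]
  · refine synced_T_of_inv h0 hαβ hβ hx (neg_ne_zero.2 hx) 0 (Or.inr ?_)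
    field_simp
    simp

theorem Synced.T_T_add_one {α β x : ℝ} (hgα : g ≤ α) (hαβ : α < β) (hβ : β ≤ 1)
    (hx : α - 1 ≤ x) (hz : x + 1 < β) : Synced (T α x) (T β (T β (x + 1))) := by
  have h0 := half_lt_g
  have hx0 : x < 0 := by linarith
  have hz0 : 0 < x + 1 := by linarith
  have e : T β (x + 1) = 1 / (x + 1) - (1 : ℤ) := by
    refine T_eq_sub hz0.ne' 1 ?_ ?_
    · have : 1 ≤ 1 / (x + 1) := by rw [le_div_iff₀ hz0]; linarith
      push_cast; linarith
    · have h1 : 1 / (x + 1) ≤ 1 / α := one_div_le_one_div_of_le (by linarith) (by linarith)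
      have h2 := one_div_le_one_add hgα
      push_cast; linarith
  have e2 : T β (x + 1) = -x / (x + 1) := by
    rw [e]; field_simp; push_cast; ring
  have hx0' := hx0.ne
  rw [e2]
  refine synced_T_of_inv (by linarith) hαβ hβ hx0'
    (div_ne_zero (neg_ne_zero.2 hx0') hz0.ne') (-1) (Or.inr ?_)
  field_simp
  push_cast
  ring

theorem Synced.T_T_one_sub {α β x : ℝ} (hgα : g ≤ α) (hαβ : α < β) (hβ : β ≤ 1)
    (hz : 1 - x < β) (hx : x < β / (β + 1)) : Synced (T α x) (T β (T β (1 - x))) := by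
  have h0 := half_lt_g
  have hx0 : 0 < x := by linarith
  rw [lt_div_iff₀ (by linarith)] at hx
  have hz0 : 0 < 1 - x := by nlinarith
  have e : T β (1 - x) = 1 / (1 - x) - (1 : ℤ) := by
    refine T_eq_sub hz0.ne' 1 ?_ ?_
    · have : 1 ≤ 1 / (1 - x) := by rw [le_div_iff₀ hz0]; linarith
      push_cast; linarith
    · have : 1 / (1 - x) < 1 + β := by rw [div_lt_iff₀ hz0]; nlinarith
      push_cast; linarith
  have e2 : T β (1 - x) = x / (1 - x) := by
    rw [e]; field_simp; push_cast; ring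
  rw [e2]
  refine synced_T_of_inv (by linarith) hαβ hβ hx0.ne'
    (div_ne_zero hx0.ne' hz0.ne') (-1) (Or.inl ?_)
  field_simp
  push_cast
  ring

theorem T_T_synced_T_one_sub {α β x : ℝ} (hgα : g ≤ α) (hαβ : α < β) (hβ : β ≤ 1)
    (hx : x < α) (hxl : 1 / (1 + α) < x) : Synced (T α (T α x)) (T β (1 - x)) := by
  have h0 := half_lt_g
  have hx0 : 0 < x := lt_trans (one_div_pos.2 (by linarith)) hxl
  have hz0 : 0 < 1 - x := by linarith
  rw [div_lt_iff₀ (by linarith)] at hxl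
  have e : T α x = 1 / x - (1 : ℤ) := by
    refine T_eq_sub hx0.ne' 1 ?_ ?_
    · have : 1 ≤ 1 / x := by rw [le_div_iff₀ hx0]; linarith
      push_cast; linarith
    · have : 1 / x < 1 + α := by rw [div_lt_iff₀ hx0]; linarith
      push_cast; linarith
  have e2 : T α x = (1 - x) / x := by
    rw [e]; field_simp; push_cast; ring
  rw [e2]
  refine synced_T_of_inv (by linarith) hαβ hβ (div_ne_zero hz0.ne' hx0.ne') hz0.ne' 1 (Or.inl ?_)
  field_simp
  push_cast
  ring

theorem T_T_synced_T_T_one_sub {α β x : ℝ} (hgα : g ≤ α) (hαβ : α < β) (hβ : β ≤ 1)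
    (hx2 : x ≠ 1 / 2) (hxu : x ≤ 1 / (1 + α)) (hxl : β / (β + 1) ≤ x) :
    Synced (T α (T α x)) (T β (T β (1 - x))) := by
  have h0 := half_lt_g
  have hα := one_div_le_one_add hgα
  rw [div_le_iff₀ (by linarith)] at hα
  rw [le_div_iff₀ (by linarith)] at hxu
  rw [div_le_iff₀ (by linarith)] at hxl
  have hx0 : 0 < x := by nlinarith
  have hz0 : 0 < 1 - x := by nlinarith
  have ex : T α x = 1 / x - (2 : ℤ) := by
    refine T_eq_sub hx0.ne' 2 ?_ ?_
    · have : 1 + α ≤ 1 / x := by rw [le_div_iff₀ hx0]; linarith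
      push_cast; linarith
    · have : 1 / x < 2 + α := by rw [div_lt_iff₀ hx0]; nlinarith
      push_cast; linarith
  have ez : T β (1 - x) = 1 / (1 - x) - (2 : ℤ) := by
    refine T_eq_sub hz0.ne' 2 ?_ ?_
    · have : 1 + β ≤ 1 / (1 - x) := by rw [le_div_iff₀ hz0]; nlinarith
      push_cast; linarith
    · have : 1 / (1 - x) < 2 + β := by rw [div_lt_iff₀ hz0]; nlinarith
      push_cast; linarith
  have ex2 : T α x = (1 - 2 * x) / x := by
    rw [ex]; field_simp; push_cast; ring
  have ez2 : T β (1 - x) = -(1 - 2 * x) / (1 - x) := by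
    rw [ez]; field_simp; push_cast; ring
  have hne : 1 - 2 * x ≠ 0 := fun h => hx2 (by linarith)
  rw [ex2, ez2]
  refine synced_T_of_inv (by linarith) hαβ hβ (div_ne_zero hne hx0.ne')
    (div_ne_zero (neg_ne_zero.2 hne) hz0.ne') (-1) (Or.inr ?_)
  field_simp
  push_cast
  ring

theorem Synced.exists_iterate {α β x z : ℝ} (hgα : g ≤ α) (hαβ : α < β) (hβ : β ≤ 1)
    (hx : x ∈ Ico (α - 1) α) (hz : z ∈ Ico (β - 1) β) (h : Synced x z) :
    ∃ k, 1 ≤ k ∧ (Synced (T α x) ((T β)^[k] z) ∨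
      (β / (β + 1) ≤ x ∧ Synced (T α (T α x)) ((T β)^[k] z))) := by
  have h0 : 1 / 2 < α := half_lt_g.trans_le hgα
  obtain ⟨hx1, hx2⟩ := hx
  obtain ⟨hz1, hz2⟩ := hz
  obtain rfl | rfl | rfl | rfl : z = x ∨ z = x + 1 ∨ z = -x ∨ z = 1 - x := by
    simp only [Synced, mem_insert_iff, mem_singleton_iff] at h
    rcases h with (h | h) | (h | h)
    · exact Or.inl (by linarith)
    · exact Or.inr (Or.inl (by linarith))
    · exact Or.inr (Or.inr (Or.inl (by linarith)))
    · exact Or.inr (Or.inr (Or.inr (by linarith)))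
  · exact ⟨1, le_rfl, Or.inl (Synced.T_self h0 hαβ hβ)⟩
  · exact ⟨2, one_le_two, Or.inl (Synced.T_T_add_one hgα hαβ hβ hx1 hz2)⟩
  · exact ⟨1, le_rfl, Or.inl (Synced.T_neg h0 hαβ hβ)⟩
  · rcases lt_or_ge x (β / (β + 1)) with hxc | hxc
    · exact ⟨2, one_le_two, Or.inl (Synced.T_T_one_sub hgα hαβ hβ hz2 hxc)⟩
    rcases lt_or_ge (1 / (1 + α)) x with hxl | hxl
    · exact ⟨1, le_rfl, Or.inr ⟨hxc, T_T_synced_T_one_sub hgα hαβ hβ hx2 hxl⟩⟩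
    by_cases hxh : x = 1 / 2
    · refine ⟨1, le_rfl, Or.inl ?_⟩
      have e : 1 - x = x := by linarith
      rw [e]
      exact Synced.T_self h0 hαβ hβ
    · exact ⟨2, one_le_two, Or.inr ⟨hxc, T_T_synced_T_T_one_sub hgα hαβ hβ hxh hxl hxc⟩⟩

theorem Synced.exists_iterate_succ {α β : ℝ} (hgα : g ≤ α) (hαβ : α < β) (hβ : β ≤ 1) (n : ℕ) :
    ∀ x ∈ Ico (α - 1) α, ∀ z ∈ Ico (β - 1) β, Synced x z → (T α)^[n] x < β / (β + 1) →
      ∃ k, 1 ≤ k ∧ Synced ((T α)^[n + 1] x) ((T β)^[k] z) := by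
  have h0 := half_lt_g
  have hT : ∀ x, T α x ∈ Ico (α - 1) α := T_mem_Ico (by linarith) (by linarith)
  have hTβ : ∀ k, 1 ≤ k → ∀ z, (T β)^[k] z ∈ Ico (β - 1) β := by
    intro k hk z
    obtain ⟨j, rfl⟩ := Nat.exists_eq_add_of_le' hk
    rw [Function.iterate_succ_apply']
    exact T_mem_Ico (by linarith) hβ _
  induction n using Nat.strong_induction_on with
  | _ n ih =>
    intro x hx z hz h hn
    obtain ⟨k, hk, h1 | ⟨hxc, h2⟩⟩ := h.exists_iterate hgα hαβ hβ hx hz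
    · rcases n with _ | n
      · exact ⟨k, hk, h1⟩
      · obtain ⟨j, hj, h3⟩ := ih n (by lia) _ (hT x) _ (hTβ k hk z) h1 hn
        exact ⟨j + k, by lia, by rwa [Function.iterate_add_apply (T β) j k]⟩
    · rcases n with _ | _ | n
      · exact absurd hn hxc.not_gt
      · exact ⟨k, hk, h2⟩
      · obtain ⟨j, hj, h3⟩ := ih n (by lia) _ (hT _) _ (hTβ k hk z) h2 hn
        exact ⟨j + k, by lia, by rwa [Function.iterate_add_apply (T β) j k]⟩

/-- Let g ≤ α < β ≤ 1, x ∈ [α−1, α), z ∈ [β−1, β), with z − x ∈ {0, 1} or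
x + z ∈ {0, 1}. If n ≥ 1 and T_α^{n−1}(x) < β/(β+1), then there is k ≥ 1 with
T_β^k(z) − T_α^n(x) ∈ {0, 1} or T_α^n(x) + T_β^k(z) ∈ {0, 1}. -/
theorem synchronization_iterate (α β x z : ℝ)
    (hgα : g ≤ α) (hαβ : α < β) (hβ : β ≤ 1)
    (hx : x ∈ Set.Ico (α - 1) α) (hz : z ∈ Set.Ico (β - 1) β)
    (h : z - x ∈ ({0, 1} : Set ℝ) ∨ x + z ∈ ({0, 1} : Set ℝ))
    (n : ℕ) (hn : 1 ≤ n) (hxn : (T α)^[n - 1] x < β / (β + 1)) :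
    ∃ k : ℕ, 1 ≤ k ∧
      ((T β)^[k] z - (T α)^[n] x ∈ ({0, 1} : Set ℝ) ∨
        (T α)^[n] x + (T β)^[k] z ∈ ({0, 1} : Set ℝ)) := by
  obtain ⟨m, rfl⟩ := Nat.exists_eq_add_of_le' hn
  exact Synced.exists_iterate_succ hgα hαβ hβ m x hx z hz h hxn
end

section
/- Let g ≤ α < β ≤ 1, let (x, y) ∈ Ω_α, let (x̃, ỹ) ∈ S(x, y), and let (x_n, y_n) = 𝒯_α^n(x, y) for some n ≥ 1. If x̃ ∈ [β−1, β) and y_n < 1 − 1/√2, then there exists k ≥ 1 such that 𝒯_β^k(x̃, ỹ) ∈ S(x_n, y_n). -/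
open MeasureTheory Set

lemma one_le_self_add_sq {α : ℝ} (h : g ≤ α) : 1 ≤ α + α ^ 2 := by
  have h5 : Real.sqrt 5 ^ 2 = 5 := Real.sq_sqrt (by norm_num)
  have h1 : 1 ≤ Real.sqrt 5 := Real.one_le_sqrt.mpr (by norm_num)
  have hg : g + g ^ 2 = 1 := by unfold g; nlinarith
  have hg0 : 0 ≤ g := by unfold g; linarith
  nlinarith

lemma pos_of_g_le {α : ℝ} (h : g ≤ α) : 0 < α := by
  have h1 : 2 < Real.sqrt 5 := Real.lt_sqrt_of_sq_lt (by norm_num)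
  have : (0 : ℝ) < g := by unfold g; linarith
  linarith

lemma NT_of_fst_eq_zero (α : ℝ) {p : ℝ × ℝ} (hp : p.1 = 0) : NT α p = (0, 0) := by
  simp [NT, hp]

lemma exists_digit (α : ℝ) {p : ℝ × ℝ} (hp : p.1 ≠ 0) :
    ∃ a : ℤ, NT α p = (1 / p.1 - a, 1 / (p.2 + a)) ∧ 1 / p.1 - a ∈ Ico (α - 1) α := by
  refine ⟨⌊1 / p.1 + 1 - α⌋, by simp [NT, hp], ?_, ?_⟩
  · linarith [Int.floor_le (1 / p.1 + 1 - α)]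
  · linarith [Int.lt_floor_add_one (1 / p.1 + 1 - α)]

lemma NT_fst_mem {β : ℝ} (h0 : 0 < β) (h1 : β ≤ 1) (p : ℝ × ℝ) :
    (NT β p).1 ∈ Ico (β - 1) β := by
  by_cases hp : p.1 = 0
  · rw [NT_of_fst_eq_zero β hp]
    exact ⟨by simpa using h1, h0⟩
  · obtain ⟨a, ha, hmem⟩ := exists_digit β hp
    rwa [ha]

lemma digit_unique {c z : ℝ} {a b : ℤ} (ha : z - a ∈ Ico (c - 1) c)
    (hb : z - b ∈ Ico (c - 1) c) : a = b := by
  have h1 : (a : ℝ) < b + 1 := by linarith [ha.1, hb.2]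
  have h2 : (b : ℝ) < a + 1 := by linarith [ha.2, hb.1]
  norm_cast at h1 h2
  lia

/-- A closed `NT α`-invariant region containing `Omega α`. -/
def boundingRegion (α : ℝ) : Set (ℝ × ℝ) :=
  {p | (α - 1 ≤ p.1 ∧ p.1 ≤ α) ∧ (1 - Real.sqrt 2 ≤ p.2 ∧ p.2 ≤ Real.sqrt 2) ∧
    (0 ≤ p.1 ∨ p.2 ≤ 2 - Real.sqrt 2) ∧ (p.1 ≤ 1 / (2 + α) ∨ Real.sqrt 2 / 2 - 1 ≤ p.2)}

lemma isClosed_boundingRegion (α : ℝ) : IsClosed (boundingRegion α) := by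
  have hx : Continuous (fun p : ℝ × ℝ => p.1) := continuous_fst
  have hy : Continuous (fun p : ℝ × ℝ => p.2) := continuous_snd
  have l {f : ℝ × ℝ → ℝ} (hf : Continuous f) (c : ℝ) : IsClosed {p | f p ≤ c} :=
    isClosed_le hf continuous_const
  have u {f : ℝ × ℝ → ℝ} (hf : Continuous f) (c : ℝ) : IsClosed {p | c ≤ f p} :=
    isClosed_le continuous_const hf
  exact ((u hx _).inter (l hx _)).inter (((u hy _).inter (l hy _)).inter
    (((u hx _).union (l hy _)).inter ((l hx _).union (u hy _))))

lemma one_le_digit_of_pos {α x : ℝ} (h1 : α ≤ 1) (hx0 : 0 < x) (hxα : x ≤ α)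
    {a : ℤ} (ha : 1 / x - a ∈ Ico (α - 1) α) : 1 ≤ a := by
  have : 1 ≤ 1 / x := by rw [le_div_iff₀ hx0]; linarith
  have h : (0 : ℝ) < a := by linarith [ha.2]
  exact_mod_cast h

lemma digit_le_neg_three_of_neg {α x : ℝ} (hα : 0 < α) (hg : 1 ≤ α + α ^ 2)
    (hx0 : x < 0) (hxα : α - 1 ≤ x) {a : ℤ} (ha : 1 / x - a ∈ Ico (α - 1) α) : a ≤ -3 := by
  have h6 : 3 / 5 ≤ α := by nlinarith
  have h : 1 / x < α - 3 := by
    rw [div_lt_iff_of_neg hx0]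
    nlinarith
  have h' : (a : ℝ) < -2 := by linarith [ha.1]
  have : a < -2 := by exact_mod_cast h'
  lia

lemma snd_add_digit_ne_zero {α : ℝ} (hα : 0 < α) (h1 : α ≤ 1) (hg : 1 ≤ α + α ^ 2)
    {p : ℝ × ℝ} (hp : p ∈ boundingRegion α) (hx : p.1 ≠ 0) {a : ℤ}
    (ha : 1 / p.1 - a ∈ Ico (α - 1) α) : p.2 + a ≠ 0 := by
  obtain ⟨⟨hx1, hx2⟩, ⟨hy1, hy2⟩, -⟩ := hp
  have hs : Real.sqrt 2 < 3 / 2 := (Real.sqrt_lt' (by norm_num)).mpr (by norm_num)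
  rcases hx.lt_or_gt with h | h
  · have : (a : ℝ) ≤ -3 := by exact_mod_cast digit_le_neg_three_of_neg hα hg h hx1 ha
    linarith
  · have : (1 : ℝ) ≤ a := by exact_mod_cast one_le_digit_of_pos h1 h hx2 ha
    linarith

lemma NT_mem_boundingRegion {α : ℝ} (hα : 0 < α) (h1 : α ≤ 1) (hg : 1 ≤ α + α ^ 2)
    {p : ℝ × ℝ} (hp : p ∈ boundingRegion α) : NT α p ∈ boundingRegion α := by
  have hs2 : Real.sqrt 2 * Real.sqrt 2 = 2 := Real.mul_self_sqrt (by norm_num)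
  have hs : Real.sqrt 2 < 3 / 2 := (Real.sqrt_lt' (by norm_num)).mpr (by norm_num)
  have hs' : 7 / 5 < Real.sqrt 2 := Real.lt_sqrt_of_sq_lt (by norm_num)
  by_cases hx : p.1 = 0
  · rw [NT_of_fst_eq_zero α hx]
    exact ⟨⟨by simpa using h1, hα.le⟩, ⟨by simp only; linarith, by simp only; linarith⟩,
      Or.inl le_rfl, Or.inr (by simp only; linarith)⟩
  obtain ⟨a, hNT, ha⟩ := exists_digit α hx
  obtain ⟨x, y⟩ := p
  obtain ⟨⟨hx1, hx2⟩, ⟨hy1, hy2⟩, hu, hl⟩ := hp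
  simp only at hx hNT ha hx1 hx2 hy1 hy2 hu hl
  rw [hNT]
  simp only [boundingRegion, mem_ofPred_eq]
  generalize Real.sqrt 2 = s at *
  refine ⟨⟨ha.1, ha.2.le⟩, ?_⟩
  rcases lt_or_gt_of_ne hx with h | h
  · have ha3 := digit_le_neg_three_of_neg hα hg h hx1 ha
    have hyU : y ≤ 2 - s := hu.resolve_left (not_le.mpr h)
    have ha3' : (a : ℝ) ≤ -3 := by exact_mod_cast ha3
    have hneg : y + a < 0 := by linarith
    have hy0 : 1 / (y + a) < 0 := one_div_neg.mpr hneg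
    refine ⟨⟨?_, by linarith⟩, Or.inr (by linarith), ?_⟩
    · rw [le_div_iff_of_neg hneg]
      nlinarith
    · rcases eq_or_lt_of_le ha3 with rfl | h4
      · left
        have hα1 : α < 1 := by linarith
        have hx3 : 1 / x ≤ 1 / (α - 1) := one_div_le_one_div_of_neg_of_le (by linarith) hx1
        have : 1 / (α - 1) + 3 ≤ 1 / (2 + α) := by
          rw [← sub_nonneg]
          have : 1 / (2 + α) - (1 / (α - 1) + 3) =
              3 * (α + α ^ 2 - 1) / ((2 + α) * (1 - α)) := by
            have : α - 1 ≠ 0 := by linarith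
            have : 1 - α ≠ 0 := by linarith
            field_simp
            ring
          rw [this]
          have : 0 < 1 - α := by linarith
          have : 0 ≤ α + α ^ 2 - 1 := by linarith
          positivity
        push_cast
        linarith
      · right
        have : (a : ℝ) ≤ -4 := by exact_mod_cast Int.le_sub_one_of_lt h4
        rw [le_div_iff_of_neg hneg]
        nlinarith
  · have ha1 := one_le_digit_of_pos h1 h hx2 ha
    have ha1' : (1 : ℝ) ≤ a := by exact_mod_cast ha1
    have hpos : 0 < y + a := by linarith
    have hy0 : 0 < 1 / (y + a) := one_div_pos.mpr hpos
    have hs_half : s / 2 ≤ y + a := by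
      by_contra! hlt
      have h2 : x ≤ 1 / (2 + α) := hl.resolve_right (by linarith)
      rw [le_div_iff₀ (by linarith)] at h2
      have : 2 + α ≤ 1 / x := by rw [le_div_iff₀ h]; linarith
      have : (2 : ℝ) < a := by linarith [ha.2]
      linarith
    refine ⟨⟨by linarith, ?_⟩, ?_, Or.inr (by linarith)⟩
    · rw [div_le_iff₀ hpos]
      nlinarith
    · rcases eq_or_lt_of_le ha1 with rfl | h2
      · left
        have : 1 ≤ 1 / x := by rw [le_div_iff₀ h]; linarith
        push_cast
        linarith
      · right
        rw [div_le_iff₀ hpos]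
        have h3 : (2 : ℝ) ≤ a := by exact_mod_cast h2
        have : s / 2 + 1 ≤ y + a := by
          by_cases hy : s / 2 - 1 ≤ y
          · linarith
          have h2 : x ≤ 1 / (2 + α) := hl.resolve_right hy
          rw [le_div_iff₀ (by linarith)] at h2
          have : 2 + α ≤ 1 / x := by rw [le_div_iff₀ h]; linarith
          have h4 : (2 : ℝ) < a := by linarith [ha.2]
          have h5 : (3 : ℝ) ≤ a := by
            have : 2 < a := by exact_mod_cast h4
            exact_mod_cast this
          linarith
        nlinarith

lemma Omega_subset_boundingRegion {α : ℝ} (hα : 0 < α) (h1 : α ≤ 1) (hg : 1 ≤ α + α ^ 2) :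
    Omega α ⊆ boundingRegion α := by
  have hs : Real.sqrt 2 < 3 / 2 := (Real.sqrt_lt' (by norm_num)).mpr (by norm_num)
  have hs' : 7 / 5 < Real.sqrt 2 := Real.lt_sqrt_of_sq_lt (by norm_num)
  have hmaps : MapsTo (NT α) (boundingRegion α) (boundingRegion α) :=
    fun _ hp => NT_mem_boundingRegion hα h1 hg hp
  refine iUnion_subset fun n => closure_minimal ?_ (isClosed_boundingRegion α)
  rintro _ ⟨⟨x, y⟩, ⟨hx, rfl⟩, rfl⟩
  exact hmaps.iterate n ⟨⟨hx.1, hx.2.le⟩, ⟨by simp only; linarith, by simp only; linarith⟩,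
    Or.inr (by simp only; linarith), Or.inr (by simp only; linarith)⟩

/-- Points with equal first coordinates, up to integers, and matching second coordinates. -/
lemma mem_Sset_of_same {α β : ℝ} (hα : 0 < α) (hαβ : α < β) (hβ : β ≤ 1) {z v : ℝ} {a b : ℤ}
    (ha : z - a ∈ Ico (α - 1) α) (hb : z - b ∈ Ico (β - 1) β) (hv : v + a ≠ 0) :
    (z - b, 1 / (v + b)) ∈ Sset (z - a) (1 / (v + a)) := by
  have h1 : (b : ℝ) < a + 1 := by linarith [ha.2, hb.1]
  have h2 : (a : ℝ) < b + 2 := by linarith [ha.1, hb.2]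
  norm_cast at h1 h2
  obtain rfl | rfl : b = a ∨ a = b + 1 := by lia
  · exact Or.inl rfl
  · refine Or.inr (Or.inr (Or.inl ?_))
    push_cast at hv ⊢
    refine Prod.ext (by simp only; ring) ?_
    simp only
    rw [one_sub_div hv, div_div_div_cancel_right₀ hv]
    ring_nf

/-- Points with opposite first coordinates, up to integers, and matching second coordinates. -/
lemma mem_Sset_of_neg {α β : ℝ} (hg : 1 ≤ α + α ^ 2) (hα : 0 < α) (hαβ : α < β) (hβ : β ≤ 1)
    {z v : ℝ} {a b : ℤ}
    (ha : z - a ∈ Ico (α - 1) α) (hb : -z - b ∈ Ico (β - 1) β) (hv : v + a ≠ 0) :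
    (-z - b, 1 / (-v + b)) ∈ Sset (z - a) (1 / (v + a)) := by
  have hα2 : 1 / 2 < α := by nlinarith
  have h1 : (-a - b : ℝ) < 2 := by linarith [ha.2, hb.2]
  have h2 : (-1 : ℝ) < -a - b := by linarith [ha.1, hb.1]
  norm_cast at h1 h2
  obtain rfl | rfl : b = -a ∨ b = -a - 1 := by lia
  · refine Or.inr (Or.inl ?_)
    push_cast
    refine Prod.ext (by simp only; ring) ?_
    simp only
    rw [← neg_add, one_div_neg_eq_neg_one_div]
  · refine Or.inr (Or.inr (Or.inr ?_))
    push_cast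
    refine Prod.ext (by simp only; ring) ?_
    simp only
    rw [div_add_one hv, ← neg_div, div_div_div_cancel_right₀ hv,
      show -v + (-(a : ℝ) - 1) = -(1 + (v + a)) by ring, one_div_neg_eq_neg_one_div, neg_div]

/-- One `NT α`-step from a point of the bounding region is followed by `NT β`, except that a point
with large second coordinate may be skipped. -/
lemma synchronization_step {α β : ℝ} (hα : 0 < α) (hg : 1 ≤ α + α ^ 2) (hαβ : α < β)
    (hβ : β ≤ 1) {p q : ℝ × ℝ} (hp : p ∈ boundingRegion α) (hS : q ∈ Sset p.1 p.2)
    (hq : q.1 ∈ Ico (β - 1) β) :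
    (∃ k : ℕ, 1 ≤ k ∧ (NT β)^[k] q ∈ Sset (NT α p).1 (NT α p).2) ∨
    (1 - Real.sqrt 2 / 2 ≤ (NT α p).2 ∧
      ∃ k : ℕ, 1 ≤ k ∧ (NT β)^[k] q ∈ Sset (NT α (NT α p)).1 (NT α (NT α p)).2) := by
  have hα1 : α < 1 := by linarith
  have hs2 : Real.sqrt 2 * Real.sqrt 2 = 2 := Real.mul_self_sqrt (by norm_num)
  have hs : Real.sqrt 2 < 3 / 2 := (Real.sqrt_lt' (by norm_num)).mpr (by norm_num)
  have hs' : 7 / 5 < Real.sqrt 2 := Real.lt_sqrt_of_sq_lt (by norm_num)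
  have hp' := NT_mem_boundingRegion hα hα1.le hg hp
  by_cases hx : p.1 = 0
  · left
    refine ⟨1, le_rfl, ?_⟩
    have hq0 : q.1 = 0 := by
      have := hq.2
      rcases hS with rfl | rfl | rfl | rfl
      · exact hx
      · simp [hx]
      · simp only [hx] at this
        linarith
      · simp only [hx] at this
        linarith
    rw [Function.iterate_one, NT_of_fst_eq_zero α hx, NT_of_fst_eq_zero β hq0]
    exact Or.inl rfl
  obtain ⟨a, hNT, ha⟩ := exists_digit α hx
  have hv := snd_add_digit_ne_zero hα hα1.le hg hp hx ha
  obtain ⟨x, y⟩ := p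
  simp only at hx hNT ha hv hS
  have hr := hp
  obtain ⟨⟨hx1, hx2⟩, ⟨hy1, hy2⟩, hu, -⟩ := hr
  simp only at hx1 hx2 hy1 hy2 hu
  rcases hS with rfl | rfl | rfl | rfl
  · left
    refine ⟨1, le_rfl, ?_⟩
    obtain ⟨b, hb, hbm⟩ := exists_digit β (p := (x, y)) hx
    rw [Function.iterate_one, hNT, hb]
    exact mem_Sset_of_same hα hαβ hβ ha hbm hv
  · left
    refine ⟨1, le_rfl, ?_⟩
    obtain ⟨b, hb, hbm⟩ := exists_digit β (p := (-x, -y)) (neg_ne_zero.mpr hx)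
    rw [Function.iterate_one, hNT, hb]
    simp only [one_div_neg_eq_neg_one_div] at hbm ⊢
    exact mem_Sset_of_neg hg hα hαβ hβ ha hbm hv
  · left
    refine ⟨2, by norm_num, ?_⟩
    have hxβ : x + 1 < β := hq.2
    have hx0 : x < 0 := by linarith
    have hy : y < 1 := by linarith [hu.resolve_left (not_le.mpr hx0)]
    have hX : x + 1 ≠ 0 := by linarith
    have hY : 1 - y ≠ 0 := by linarith
    obtain ⟨b, hb, hbm⟩ := exists_digit β (p := (x + 1, y / (1 - y))) hX
    have hb1 : b = 1 := by
      refine digit_unique hbm ⟨?_, ?_⟩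
      · have : 1 < 1 / (x + 1) := by rw [lt_div_iff₀ (by linarith)]; linarith
        push_cast
        linarith
      · have : 1 / (x + 1) < 1 + β := by rw [div_lt_iff₀ (by linarith)]; nlinarith
        push_cast
        linarith
    subst hb1
    have hb' : NT β (x + 1, y / (1 - y)) = (-x / (x + 1), 1 - y) := by
      rw [hb]
      refine Prod.ext ?_ ?_
      · simp only; push_cast; field_simp; ring
      · simp only; push_cast; rw [div_add_one hY]; simp
    obtain ⟨c, hc, hcm⟩ := exists_digit β (p := (-x / (x + 1), 1 - y))
      (div_ne_zero (neg_ne_zero.mpr hx) hX)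
    have hz : 1 / (-x / (x + 1)) - c = -(1 / x) - (c + 1 : ℤ) := by
      push_cast; field_simp; ring
    have hw : 1 - y + c = -y + (c + 1 : ℤ) := by push_cast; ring
    rw [Function.iterate_succ_apply, Function.iterate_one, hb', hc, hNT]
    simp only [hz, hw] at hcm ⊢
    exact mem_Sset_of_neg hg hα hαβ hβ ha hcm hv
  · have hxβ : 1 - x < β := hq.2
    have hx0 : 0 < x := by linarith
    have hX : 1 - x ≠ 0 := by linarith
    have hX0 : 0 < 1 - x := by linarith
    have hY : y + 1 ≠ 0 := by linarith
    have hY' : -y / (y + 1) + 1 = 1 / (y + 1) := by rw [div_add_one hY]; ring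
    obtain ⟨b, hb, hbm⟩ := exists_digit β (p := (1 - x, -y / (y + 1))) hX
    simp only at hb hbm
    have hb1 : 1 ≤ b := one_le_digit_of_pos hβ hX0 hxβ.le hbm
    have ha1 : 1 ≤ a := one_le_digit_of_pos hα1.le hx0 hx2 ha
    rcases eq_or_lt_of_le hb1 with rfl | hb2
    · left
      refine ⟨2, by norm_num, ?_⟩
      have hb' : NT β (1 - x, -y / (y + 1)) = (x / (1 - x), y + 1) := by
        rw [hb]
        refine Prod.ext ?_ ?_
        · simp only; push_cast; field_simp; ring
        · simp only; push_cast; rw [hY', one_div_one_div]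
      obtain ⟨c, hc, hcm⟩ := exists_digit β (p := (x / (1 - x), y + 1)) (div_ne_zero hx hX)
      have hz : 1 / (x / (1 - x)) - c = 1 / x - (c + 1 : ℤ) := by
        push_cast; field_simp; ring
      have hw : y + 1 + c = y + (c + 1 : ℤ) := by push_cast; ring
      rw [Function.iterate_succ_apply, Function.iterate_one, hb', hc, hNT]
      simp only [hz, hw] at hcm ⊢
      exact mem_Sset_of_same hα hαβ hβ ha hcm hv
    right
    have hb2' : (2 : ℝ) ≤ b := by exact_mod_cast hb2
    have hxlow : β ≤ x * (1 + β) := by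
      have : 1 + β ≤ 1 / (1 - x) := by linarith [hbm.1]
      rw [le_div_iff₀ hX0] at this
      linarith
    have ha2 : a ≤ 2 := by
      by_contra! h
      have h' : (3 : ℝ) ≤ a := by exact_mod_cast h
      have : 2 + α ≤ 1 / x := by linarith [ha.1]
      rw [le_div_iff₀ hx0] at this
      nlinarith
    obtain rfl | rfl : a = 1 ∨ a = 2 := by lia
    · have hNT' : NT α (x, y) = ((1 - x) / x, 1 / (y + 1)) := by
        rw [hNT]
        refine Prod.ext ?_ ?_
        · simp only; push_cast; field_simp
        · simp only; push_cast; rfl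
      rw [hNT'] at hp' ⊢
      have hne : (1 - x) / x ≠ 0 := div_ne_zero hX hx
      refine ⟨?_, 1, le_rfl, ?_⟩
      · simp only
        rw [le_div_iff₀ (by linarith)]
        nlinarith
      obtain ⟨c, hc, hcm⟩ := exists_digit α (p := ((1 - x) / x, 1 / (y + 1))) hne
      have hv' := snd_add_digit_ne_zero hα hα1.le hg hp' hne hcm
      have hz : 1 / (1 - x) - b = 1 / ((1 - x) / x) - (b - 1 : ℤ) := by
        push_cast; field_simp; ring
      have hw : -y / (y + 1) + b = 1 / (y + 1) + (b - 1 : ℤ) := by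
        rw [← hY']; push_cast; ring
      rw [Function.iterate_one, hb, hc]
      simp only [hz, hw] at hbm ⊢
      exact mem_Sset_of_same hα hαβ hβ hcm hbm hv'
    · have hxup : x * (1 + α) ≤ 1 := by
        have := ha.1
        push_cast at this
        have : 1 + α ≤ 1 / x := by linarith
        rw [le_div_iff₀ hx0] at this
        linarith
      obtain rfl : b = 2 := by
        by_contra h
        have h3 : 3 ≤ b := by lia
        have h' : (3 : ℝ) ≤ b := by exact_mod_cast h3
        have : 2 + β ≤ 1 / (1 - x) := by linarith [hbm.1]
        rw [le_div_iff₀ hX0] at this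
        nlinarith
      have hY2 : y + 2 ≠ 0 := by linarith
      have hNT' : NT α (x, y) = ((1 - 2 * x) / x, 1 / (y + 2)) := by
        rw [hNT]
        refine Prod.ext ?_ ?_
        · simp only; push_cast; field_simp
        · simp only; push_cast; rfl
      have hb' : NT β (1 - x, -y / (y + 1)) = ((2 * x - 1) / (1 - x), 1 - 1 / (y + 2)) := by
        rw [hb]
        refine Prod.ext ?_ ?_
        · simp only; push_cast; field_simp; ring
        · simp only
          push_cast
          rw [show -y / (y + 1) + 2 = (y + 2) / (y + 1) by field_simp; ring]
          field_simp
          ring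
      rw [hNT'] at hp' ⊢
      refine ⟨?_, 2, by norm_num, ?_⟩
      · simp only
        rw [le_div_iff₀ (by linarith)]
        nlinarith
      rw [Function.iterate_succ_apply, Function.iterate_one, hb']
      by_cases h0 : 2 * x - 1 = 0
      · rw [NT_of_fst_eq_zero α (by simp only; rw [show 1 - 2 * x = 0 by linarith, zero_div]),
          NT_of_fst_eq_zero β (by simp only; rw [h0, zero_div])]
        exact Or.inl rfl
      have h0' : 1 - 2 * x ≠ 0 := fun h => h0 (by linarith)
      obtain ⟨c, hc, hcm⟩ := exists_digit α (p := ((1 - 2 * x) / x, 1 / (y + 2)))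
        (div_ne_zero h0' hx)
      have hv' := snd_add_digit_ne_zero hα hα1.le hg hp' (div_ne_zero h0' hx) hcm
      obtain ⟨d, hd, hdm⟩ := exists_digit β
        (p := ((2 * x - 1) / (1 - x), 1 - 1 / (y + 2))) (div_ne_zero h0 hX)
      have hz : 1 / ((2 * x - 1) / (1 - x)) - d = -(1 / ((1 - 2 * x) / x)) - (d + 1 : ℤ) := by
        push_cast
        rw [one_div_div, one_div_div, show 1 - 2 * x = -(2 * x - 1) by ring, div_neg, neg_neg]
        have : (1 - x) / (2 * x - 1) = x / (2 * x - 1) - 1 := by rw [div_sub_one h0]; ring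
        linarith
      have hw : 1 - 1 / (y + 2) + d = -(1 / (y + 2)) + (d + 1 : ℤ) := by push_cast; ring
      rw [hc, hd]
      simp only [hz, hw] at hdm ⊢
      exact mem_Sset_of_neg hg hα hαβ hβ hcm hdm hv'

lemma synchronization_of_mem_boundingRegion {α β : ℝ} (hα : 0 < α) (hg : 1 ≤ α + α ^ 2)
    (hαβ : α < β) (hβ : β ≤ 1) (n : ℕ) (hn : 1 ≤ n) {p q : ℝ × ℝ} (hp : p ∈ boundingRegion α)
    (hS : q ∈ Sset p.1 p.2) (hq : q.1 ∈ Ico (β - 1) β)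
    (hyn : ((NT α)^[n] p).2 < 1 - Real.sqrt 2 / 2) :
    ∃ k : ℕ, 1 ≤ k ∧ (NT β)^[k] q ∈ Sset ((NT α)^[n] p).1 ((NT α)^[n] p).2 := by
  have hmem (k : ℕ) (hk : 1 ≤ k) (r : ℝ × ℝ) : ((NT β)^[k] r).1 ∈ Ico (β - 1) β := by
    obtain ⟨k, rfl⟩ := Nat.exists_eq_add_of_le' hk
    rw [Function.iterate_succ_apply']
    exact NT_fst_mem (by linarith) hβ _
  have hp₁ := NT_mem_boundingRegion hα (by linarith) hg hp
  have hp₂ := NT_mem_boundingRegion hα (by linarith) hg hp₁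
  induction n using Nat.strong_induction_on generalizing p q with
  | _ n ih =>
  obtain ⟨m, rfl⟩ := Nat.exists_eq_add_of_le' hn
  rcases synchronization_step hα hg hαβ hβ hp hS hq with ⟨k, hk, h⟩ | ⟨hlarge, k, hk, h⟩
  · rcases Nat.eq_zero_or_pos m with rfl | hm
    · exact ⟨k, hk, h⟩
    obtain ⟨l, hl, h'⟩ := ih m (by lia) hm hp₁ h (hmem k hk q) hyn hp₂
      (NT_mem_boundingRegion hα (by linarith) hg hp₂)
    exact ⟨l + k, by lia, by rwa [Function.iterate_add_apply (NT β)]⟩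
  · rcases m with _ | _ | m
    · exact absurd hyn (not_lt.mpr hlarge)
    · exact ⟨k, hk, h⟩
    have hp₃ := NT_mem_boundingRegion hα (by linarith) hg hp₂
    obtain ⟨l, hl, h'⟩ := ih (m + 1) (by lia) (by lia) hp₂ h (hmem k hk q) hyn hp₃
      (NT_mem_boundingRegion hα (by linarith) hg hp₃)
    exact ⟨l + k, by lia, by rwa [Function.iterate_add_apply (NT β)]⟩

/-- Let g ≤ α < β ≤ 1, (x, y) ∈ Ω_α, (x̃, ỹ) ∈ S(x, y), and
(x_n, y_n) = 𝒯_α^n(x, y) for some n ≥ 1. If x̃ ∈ [β−1, β) and y_n < 1 − 1/√2,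
then there is k ≥ 1 with 𝒯_β^k(x̃, ỹ) ∈ S(x_n, y_n). -/
theorem natext_synchronization (α β : ℝ) (hgα : g ≤ α) (hαβ : α < β) (hβ : β ≤ 1)
    (x y x' y' : ℝ) (hxy : (x, y) ∈ Omega α) (hS : (x', y') ∈ Sset x y)
    (n : ℕ) (hn : 1 ≤ n)
    (hx' : x' ∈ Set.Ico (β - 1) β)
    (hyn : ((NT α)^[n] (x, y)).2 < 1 - 1 / Real.sqrt 2) :
    ∃ k : ℕ, 1 ≤ k ∧
      (NT β)^[k] (x', y') ∈ Sset ((NT α)^[n] (x, y)).1 ((NT α)^[n] (x, y)).2 := by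
  have hα := pos_of_g_le hgα
  have hg := one_le_self_add_sq hgα
  have hmem := Omega_subset_boundingRegion hα (by linarith) hg hxy
  refine synchronization_of_mem_boundingRegion hα hg hαβ hβ n hn hmem hS hx' ?_
  rwa [one_div, ← Real.sqrt_div_self] at hyn
end

section
/- Let g ≤ α < β ≤ 1 and let (x, y) ∈ Ω_α with y < 1 − 1/√2. Then S(x, y) ∩ Ω_β ≠ ∅. -/
open MeasureTheory Set

theorem NT_eq {γ x : ℝ} (hx : x ≠ 0) (y : ℝ) (n : ℤ) (h : 1 / x - n ∈ Ico (γ - 1) γ) :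
    NT γ (x, y) = (1 / x - n, 1 / (y + n)) := by
  have hn : ⌊1 / x + 1 - γ⌋ = n := by
    rw [Int.floor_eq_iff]
    constructor <;> linarith [h.1, h.2]
  simp only [NT, if_neg hx, hn]

theorem exists_digit_s16 (γ x : ℝ) : ∃ n : ℤ, 1 / x - n ∈ Ico (γ - 1) γ := by
  refine ⟨⌊1 / x + 1 - γ⌋, ?_, ?_⟩
  · linarith [Int.floor_le (1 / x + 1 - γ)]
  · linarith [Int.lt_floor_add_one (1 / x + 1 - γ)]

theorem g_sq : g * g = 1 - g := by
  have := Real.mul_self_sqrt (show (0 : ℝ) ≤ 5 by norm_num)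
  unfold g
  linarith

theorem g_bounds : 0.618 < g ∧ g < 0.619 := by
  have h := g_sq
  have h0 : 0 < g := by
    have : 1 < Real.sqrt 5 := by
      rw [Real.lt_sqrt] <;> norm_num
    unfold g
    linarith
  constructor <;> nlinarith

theorem sqrt_two_bounds : Real.sqrt 2 * Real.sqrt 2 = 2 ∧ 1.414 < Real.sqrt 2 ∧
    Real.sqrt 2 < 1.415 := by
  refine ⟨Real.mul_self_sqrt (by norm_num), ?_, ?_⟩
  · rw [Real.lt_sqrt] <;> norm_num
  · rw [Real.sqrt_lt'] <;> norm_num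

/-- A region containing the image of `[α - 1, α) × {0}` under every iterate of `NT α`,
see `exists_shadow_iterate`. -/
structure InStrip (α x y : ℝ) : Prop where
  mem : x ∈ Ico (α - 1) α
  lower : -(1 / 2) ≤ y
  lower_of_lt : 1 - g < x → Real.sqrt 2 / 2 - 1 ≤ y
  upper : y ≤ Real.sqrt 2
  upper_of_nonpos : x ≤ 0 → y ≤ 2 - Real.sqrt 2

theorem digit_cases {α x : ℝ} (hgα : g ≤ α) (hα : α ≤ 1) (hx : x ≠ 0) (hxα : x ∈ Ico (α - 1) α)
    {n : ℤ} (hn : 1 / x - n ∈ Ico (α - 1) α) :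
    (0 < x ∧ 1 ≤ n) ∨ (x < 0 ∧ n ≤ -3 ∧ 1 / x ≤ -(2 + g)) := by
  obtain ⟨hx1, hx2⟩ := hxα
  obtain ⟨hn1, hn2⟩ := hn
  have hg := g_bounds
  have hgg := g_sq
  rcases lt_or_gt_of_ne hx with h | h
  · right
    have h1 : 1 / x ≤ -(2 + g) := by
      rw [div_le_iff_of_neg h]
      nlinarith
    refine ⟨h, ?_, h1⟩
    have : (n : ℝ) < (-2 : ℤ) := by push_cast; linarith
    have := Int.cast_lt.1 this
    omega
  · left
    have h1 : 1 < 1 / x := by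
      rw [lt_div_iff₀ h]
      linarith
    refine ⟨h, ?_⟩
    have : ((0 : ℤ) : ℝ) < n := by push_cast; linarith
    have := Int.cast_lt.1 this
    omega

theorem InStrip.add_digit_ne_zero {α x y : ℝ} (h : InStrip α x y) (hgα : g ≤ α) (hα : α ≤ 1)
    (hx : x ≠ 0) {n : ℤ} (hn : 1 / x - n ∈ Ico (α - 1) α) : y + n ≠ 0 := by
  have hs := sqrt_two_bounds
  rcases digit_cases hgα hα hx h.mem hn with ⟨-, h1⟩ | ⟨-, h1, -⟩
  · have : (1 : ℝ) ≤ n := by exact_mod_cast h1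
    linarith [h.lower]
  · have : (n : ℝ) ≤ -3 := by exact_mod_cast h1
    linarith [h.upper]

theorem inStrip_zero {α x : ℝ} (hx : x ∈ Ico (α - 1) α) :
    InStrip α x 0 := by
  have hs := sqrt_two_bounds
  refine ⟨hx, ?_, fun _ => ?_, ?_, fun _ => ?_⟩ <;> linarith

theorem InStrip.next {α x y : ℝ} (h : InStrip α x y) (hgα : g ≤ α) (hα : α ≤ 1) (hx : x ≠ 0)
    {n : ℤ} (hn : 1 / x - n ∈ Ico (α - 1) α) : InStrip α (1 / x - n) (1 / (y + n)) := by
  have hg := g_bounds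
  obtain ⟨hss, hs1, hs2⟩ := sqrt_two_bounds
  obtain ⟨hn1, hn2⟩ := id hn
  obtain ⟨hx1, hx2⟩ := h.mem
  have hlow := h.lower
  rcases digit_cases hgα hα hx h.mem hn with ⟨hpos, h1⟩ | ⟨hneg, h3, hinv⟩
  · have hxx : x * (1 / x) = 1 := by field_simp
    have h1' : (1 : ℝ) ≤ n := by exact_mod_cast h1
    have hp : 0 < y + n := by linarith
    have hp' : 0 < 1 / (y + n) := by positivity
    refine ⟨hn, by linarith, fun _ => by linarith, ?_, fun hle => ?_⟩
    · rw [div_le_iff₀ hp]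
      rcases h1.eq_or_lt with rfl | h2
      · have hx3 : 1 / 2 < x := by
          push_cast at hn2
          by_contra! hc
          nlinarith
        have := h.lower_of_lt (by linarith)
        push_cast
        nlinarith
      · have h2' : (2 : ℝ) ≤ n := by exact_mod_cast h2
        nlinarith
    · rw [div_le_iff₀ hp]
      rcases h1.eq_or_lt with rfl | h2
      · push_cast at hle
        nlinarith
      · rcases (show 2 ≤ n from h2).eq_or_lt with rfl | h4
        · push_cast at hle ⊢
          have hx3 : 1 / 2 ≤ x := by
            by_contra! hc
            nlinarith
          have := h.lower_of_lt (by linarith)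
          nlinarith
        · have h4' : (3 : ℝ) ≤ n := by exact_mod_cast h4
          nlinarith
  · have h3' : (n : ℝ) ≤ -3 := by exact_mod_cast h3
    have hy := h.upper_of_nonpos hneg.le
    have hp : y + n < 0 := by linarith
    have hp' : 1 / (y + n) < 0 := one_div_neg.2 hp
    refine ⟨hn, ?_, fun hlt => ?_, by linarith, fun _ => by linarith⟩
    · rw [le_div_iff_of_neg hp]
      linarith
    · rw [le_div_iff_of_neg hp]
      rcases h3.eq_or_lt with rfl | h4
      · push_cast at hlt
        linarith
      · have h4' : (n : ℝ) ≤ -4 := by exact_mod_cast (show n ≤ -4 by omega)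
        nlinarith

/-- `Reach β N p` says that `p` has first coordinate in `[β - 1, β)` and is reached from
`[β - 1, β) × {0}` in at most `N` steps of `NT β`. -/
def Reach (β : ℝ) (N : ℕ) (p : ℝ × ℝ) : Prop :=
  p.1 ∈ Ico (β - 1) β ∧ ∃ m ≤ N, p ∈ (NT β)^[m] '' (Ico (β - 1) β ×ˢ {0})

theorem reach_zero {β z : ℝ} (hz : z ∈ Ico (β - 1) β) (N : ℕ) : Reach β N (z, 0) :=
  ⟨hz, 0, N.zero_le, (z, 0), ⟨hz, rfl⟩, rfl⟩

theorem Reach.mono {β : ℝ} {N M : ℕ} {p : ℝ × ℝ} (h : Reach β N p) (hNM : N ≤ M) :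
    Reach β M p := by
  obtain ⟨hp, m, hm, hmem⟩ := h
  exact ⟨hp, m, hm.trans hNM, hmem⟩

theorem Reach.next {β z w : ℝ} {N : ℕ} (h : Reach β N (z, w)) (hz : z ≠ 0) {m : ℤ}
    (hm : 1 / z - m ∈ Ico (β - 1) β) : Reach β (N + 1) (1 / z - m, 1 / (w + m)) := by
  obtain ⟨-, k, hk, q, hq, hqk⟩ := h
  refine ⟨hm, k + 1, by omega, q, hq, ?_⟩
  rw [Function.iterate_succ_apply', hqk, NT_eq hz w m hm]

/-- `p` shadows `q` when it lies in `Sset`, or when it lags behind by one digit; the latter only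
happens for large second coordinate of `q`. -/
def Shadow (x y : ℝ) (p : ℝ × ℝ) : Prop :=
  p ∈ Sset x y ∨ 1 - 1 / Real.sqrt 2 ≤ y ∧ (p = (x / (1 + x), y - 1) ∨ p = (-x / (1 + x), 1 - y))

section Coupling

variable {α β x y z w : ℝ} {N : ℕ} {n : ℤ}

theorem exists_shadow_of_inv_eq_add (hgα : g ≤ α) (hαβ : α < β) (hβ : β ≤ 1)
    (hx : 1 / x - n ∈ Ico (α - 1) α) (hyn : y + n ≠ 0) (h : Reach β N (z, w)) (hz : z ≠ 0)
    {j : ℤ} (hzx : 1 / z = 1 / x + j) (hw : w = y - j) :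
    ∃ p, Reach β (N + 1) p ∧ p ∈ Sset (1 / x - n) (1 / (y + n)) := by
  obtain ⟨m, hm⟩ := exists_digit_s16 β z
  refine ⟨_, h.next hz hm, ?_⟩
  obtain ⟨hx1, hx2⟩ := hx
  obtain ⟨hm1, hm2⟩ := hm
  have hg := g_bounds
  rw [hzx] at hm1 hm2 ⊢
  have h0 : (-1 : ℝ) < ((n + j - m : ℤ) : ℝ) := by push_cast; linarith
  have h1 : ((n + j - m : ℤ) : ℝ) < 2 := by push_cast; linarith
  have h0' : -1 < n + j - m := by exact_mod_cast h0
  have h1' : n + j - m < 2 := by exact_mod_cast h1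
  have hcase : m = n + j ∨ m = n + j - 1 := by omega
  rcases hcase with rfl | rfl
  · left
    subst hw
    push_cast
    congr 1 <;> ring
  · right; right; left
    subst hw
    push_cast
    have : 1 / (y + n) / (1 - 1 / (y + n)) = 1 / (y + n - 1) := by
      rw [one_sub_div hyn, div_div_div_cancel_right₀ hyn]
    rw [this]
    congr 1
    · ring
    · congr 1
      ring

theorem exists_shadow_of_inv_eq_neg_sub (hgα : g ≤ α) (hαβ : α < β) (hβ : β ≤ 1)
    (hx : 1 / x - n ∈ Ico (α - 1) α) (hyn : y + n ≠ 0) (h : Reach β N (z, w)) (hz : z ≠ 0)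
    {j : ℤ} (hzx : 1 / z = -(1 / x) - j) (hw : w = j - y) :
    ∃ p, Reach β (N + 1) p ∧ p ∈ Sset (1 / x - n) (1 / (y + n)) := by
  obtain ⟨m, hm⟩ := exists_digit_s16 β z
  refine ⟨_, h.next hz hm, ?_⟩
  obtain ⟨hx1, hx2⟩ := hx
  obtain ⟨hm1, hm2⟩ := hm
  have hg := g_bounds
  rw [hzx] at hm1 hm2 ⊢
  have h0 : (-1 : ℝ) < ((-n - j - m : ℤ) : ℝ) := by push_cast; linarith
  have h1 : ((-n - j - m : ℤ) : ℝ) < 2 := by push_cast; linarith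
  have h0' : -1 < -n - j - m := by exact_mod_cast h0
  have h1' : -n - j - m < 2 := by exact_mod_cast h1
  have hcase : m = -n - j ∨ m = -n - j - 1 := by omega
  rcases hcase with rfl | rfl
  · right; left
    subst hw
    push_cast
    rw [← one_div_neg_eq_neg_one_div (y + (n : ℝ))]
    congr 1
    · ring
    · congr 1
      ring
  · right; right; right
    subst hw
    push_cast
    have : -(1 / (y + n)) / (1 / (y + n) + 1) = 1 / (-(y + n) - 1) := by
      rw [div_add_one hyn, ← neg_div, div_div_div_cancel_right₀ hyn, ← neg_div_neg_eq]
      congr 1 <;> ring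
    rw [this]
    congr 1
    · ring
    · congr 1
      ring

theorem exists_shadow_of_add_one (hgα : g ≤ α) (hαβ : α < β) (hβ : β ≤ 1) (hb : InStrip α x y)
    (hx : 1 / x - n ∈ Ico (α - 1) α) (hyn : y + n ≠ 0) (h : Reach β N (x + 1, y / (1 - y))) :
    ∃ p, Reach β (N + 2) p ∧ p ∈ Sset (1 / x - n) (1 / (y + n)) := by
  have hg := g_bounds
  have hgg := g_sq
  have hs := sqrt_two_bounds
  have hneg : x < 0 := by linarith [h.1.2]
  have hx1 : 0 < x + 1 := by linarith [hb.mem.1]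
  have hy1 : 1 - y ≠ 0 := by linarith [hb.upper_of_nonpos hneg.le]
  have hm : 1 / (x + 1) - (1 : ℤ) ∈ Ico (β - 1) β := by
    push_cast
    have h1 : 1 ≤ 1 / (x + 1) := by
      rw [le_div_iff₀ hx1]
      linarith
    have h2 : 1 / (x + 1) < 1 + β := by
      rw [div_lt_iff₀ hx1]
      nlinarith [hb.mem.1]
    constructor <;> linarith
  have h' := h.next hx1.ne' hm
  refine exists_shadow_of_inv_eq_neg_sub (j := 1) hgα hαβ hβ hx hyn h' ?_ ?_ ?_
  · push_cast
    have : 1 / (x + 1) - 1 = -x / (x + 1) := by field_simp; ring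
    rw [this]
    exact div_ne_zero (neg_ne_zero.2 hneg.ne) hx1.ne'
  · push_cast
    have : 1 / (x + 1) - 1 = -x / (x + 1) := by field_simp; ring
    rw [this]
    field_simp [hneg.ne]
    ring
  · push_cast
    have : y / (1 - y) + 1 = 1 / (1 - y) := by field_simp; ring
    rw [this, one_div_one_div]

theorem exists_shadow_of_one_sub (hgα : g ≤ α) (hαβ : α < β) (hβ : β ≤ 1) (hb : InStrip α x y)
    (hx : 1 / x - n ∈ Ico (α - 1) α) (hyn : y + n ≠ 0) (h : Reach β N (1 - x, -y / (y + 1))) :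
    ∃ p, Reach β (N + 2) p ∧ Shadow (1 / x - n) (1 / (y + n)) p := by
  have hg := g_bounds
  have hgg := g_sq
  obtain ⟨hss, hs1, hs2⟩ := sqrt_two_bounds
  have hpos : 0 < x := by linarith [h.1.2]
  have hlt : x < 1 := by linarith [hb.mem.2]
  have hx1 : 0 < 1 - x := by linarith
  have hy1 : 0 < y + 1 := by linarith [hb.lower]
  have hxx : x * (1 / x) = 1 := by field_simp
  have hyM := hb.upper
  have hinv : 1 / Real.sqrt 2 = Real.sqrt 2 / 2 := by
    rw [div_eq_div_iff] <;> linarith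
  rcases lt_or_ge (1 / x) (1 + α) with hc | hc
  · have hn : n = 1 := by
      have h1 : (1 : ℝ) < 1 / x := by
        rw [lt_div_iff₀ hpos]
        linarith
      have h2 : (n : ℝ) < 2 := by linarith [hx.1]
      have h3 : (0 : ℝ) < n := by linarith [hx.2]
      have h2' : n < 2 := by exact_mod_cast h2
      have h3' : 0 < n := by exact_mod_cast h3
      omega
    subst hn
    refine ⟨_, h.mono (by omega), Or.inr ⟨?_, Or.inl ?_⟩⟩
    · push_cast
      rw [hinv, le_div_iff₀ hy1]
      nlinarith
    · push_cast
      congr 1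
      · field_simp
        ring
      · field_simp
        ring
  · rcases lt_or_ge x (β * (1 - x)) with hd | hd
    · have hm : 1 / (1 - x) - (1 : ℤ) ∈ Ico (β - 1) β := by
        push_cast
        have : 1 / (1 - x) - 1 = x / (1 - x) := by field_simp; ring
        rw [this]
        refine ⟨?_, (div_lt_iff₀ hx1).2 hd⟩
        have : 0 < x / (1 - x) := by positivity
        linarith
      have h' := h.next hx1.ne' hm
      have heq : 1 / (1 - x) - ((1 : ℤ) : ℝ) = x / (1 - x) := by push_cast; field_simp; ring
      obtain ⟨p, hp, hp'⟩ :=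
        exists_shadow_of_inv_eq_add (j := -1) hgα hαβ hβ hx hyn h'
          (by rw [heq]; positivity) (by rw [heq]; push_cast; field_simp; ring)
          (by
            have : -y / (y + 1) + ((1 : ℤ) : ℝ) = 1 / (y + 1) := by push_cast; field_simp; ring
            rw [this, one_div_one_div]
            push_cast
            ring)
      exact ⟨p, hp, Or.inl hp'⟩
    · have hxα : x * (1 + α) ≤ 1 := by
        rwa [le_div_iff₀ hpos, mul_comm] at hc
      have hxlow : 1 < x * (2 + α) := by nlinarith
      have hn : n = 2 := by
        have h1 : 1 / x < 2 + α := by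
          rw [div_lt_iff₀ hpos]
          linarith
        have h2 : (n : ℝ) < 3 := by linarith [hx.1]
        have h3 : (1 : ℝ) < n := by linarith [hx.2]
        have h2' : n < 3 := by exact_mod_cast h2
        have h3' : 1 < n := by exact_mod_cast h3
        omega
      subst hn
      have hm : 1 / (1 - x) - (2 : ℤ) ∈ Ico (β - 1) β := by
        push_cast
        have h1 : 1 + β ≤ 1 / (1 - x) := by
          rw [le_div_iff₀ hx1]
          linarith
        have h2 : 1 / (1 - x) < 2 + β := by
          rw [div_lt_iff₀ hx1]
          nlinarith
        constructor <;> linarith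
      refine ⟨_, (h.next hx1.ne' hm).mono (by omega), Or.inr ⟨?_, Or.inr ?_⟩⟩
      · push_cast
        rw [hinv, le_div_iff₀ (by linarith)]
        nlinarith
      · have hy2 : y + 2 ≠ 0 := by linarith
        have hden : 1 + (1 / x - 2) = (1 - x) / x := by field_simp; ring
        have hw : -y / (y + 1) + 2 = (y + 2) / (y + 1) := by field_simp; ring
        push_cast
        rw [hden, hw]
        congr 1
        · field_simp
          ring
        · field_simp
          ring

theorem Shadow.next (hgα : g ≤ α) (hαβ : α < β) (hβ : β ≤ 1) (hb : InStrip α x y)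
    (hx0 : x ≠ 0) (hx : 1 / x - n ∈ Ico (α - 1) α) {p : ℝ × ℝ} (h : Reach β N p)
    (hp : Shadow x y p) : ∃ q, Reach β (N + 2) q ∧ Shadow (1 / x - n) (1 / (y + n)) q := by
  have hyn := hb.add_digit_ne_zero hgα (hαβ.le.trans hβ) hx0 hx
  have of_one_step (hq : ∃ q, Reach β (N + 1) q ∧ q ∈ Sset (1 / x - n) (1 / (y + n))) :
      ∃ q, Reach β (N + 2) q ∧ Shadow (1 / x - n) (1 / (y + n)) q := by
    obtain ⟨q, hq, hq'⟩ := hq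
    exact ⟨q, hq.mono (by omega), Or.inl hq'⟩
  have hx1 : 0 < 1 + x := by linarith [hb.mem.1, g_bounds.1]
  rcases hp with (rfl | rfl | rfl | rfl) | ⟨-, rfl | rfl⟩
  · exact of_one_step
      (exists_shadow_of_inv_eq_add (j := 0) hgα hαβ hβ hx hyn h hx0 (by simp) (by simp))
  · exact of_one_step
      (exists_shadow_of_inv_eq_neg_sub (j := 0) hgα hαβ hβ hx hyn h (neg_ne_zero.2 hx0)
        (by rw [one_div_neg_eq_neg_one_div]; simp) (by simp))
  · obtain ⟨q, hq, hq'⟩ := exists_shadow_of_add_one hgα hαβ hβ hb hx hyn h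
    exact ⟨q, hq, Or.inl hq'⟩
  · exact exists_shadow_of_one_sub hgα hαβ hβ hb hx hyn h
  · exact of_one_step
      (exists_shadow_of_inv_eq_add (j := 1) hgα hαβ hβ hx hyn h (div_ne_zero hx0 hx1.ne')
        (by push_cast; field_simp) (by simp))
  · exact of_one_step
      (exists_shadow_of_inv_eq_neg_sub (j := 1) hgα hαβ hβ hx hyn h
        (div_ne_zero (neg_ne_zero.2 hx0) hx1.ne')
        (by push_cast; field_simp; ring) (by simp))

end Coupling

theorem exists_shadow_iterate {α β : ℝ} (hgα : g ≤ α) (hαβ : α < β) (hβ : β ≤ 1) {t : ℝ}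
    (ht : t ∈ Ico (α - 1) α) (n : ℕ) :
    ∃ x y, (NT α)^[n] (t, 0) = (x, y) ∧ InStrip α x y ∧
      ∃ p, Reach β (2 * n) p ∧ Shadow x y p := by
  have hg := g_bounds
  have hα : α ≤ 1 := hαβ.le.trans hβ
  induction n with
  | zero =>
    refine ⟨t, 0, rfl, inStrip_zero ht, ?_⟩
    rcases le_or_gt (β - 1) t with h | h
    · exact ⟨(t, 0), reach_zero ⟨h, ht.2.trans hαβ⟩ _, Or.inl (Or.inl rfl)⟩
    · exact ⟨(t + 1, 0), reach_zero ⟨by linarith [ht.1], by linarith⟩ _,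
        Or.inl (Or.inr (Or.inr (Or.inl (by simp))))⟩
  | succ n ih =>
    obtain ⟨x, y, hxy, hb, p, hp, hs⟩ := ih
    rw [Function.iterate_succ_apply', hxy]
    by_cases hx : x = 0
    · refine ⟨0, 0, by simp [NT, hx], inStrip_zero ⟨by linarith, by linarith⟩,
        (0, 0), reach_zero ⟨by linarith, by linarith⟩ _, Or.inl (Or.inl rfl)⟩
    · obtain ⟨k, hk⟩ := exists_digit_s16 α x
      exact ⟨_, _, NT_eq hx y k hk, hb.next hgα hα hx hk, hs.next hgα hαβ hβ hb hx hk hp⟩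

/-- Let g ≤ α < β ≤ 1 and let (x, y) ∈ Ω_α with y < 1 − 1/√2.
Then S(x, y) ∩ Ω_β ≠ ∅. -/
theorem Sset_meets_Omega (α β : ℝ) (hgα : g ≤ α) (hαβ : α < β) (hβ : β ≤ 1)
    (x y : ℝ) (hxy : (x, y) ∈ Omega α) (hy : y < 1 - 1 / Real.sqrt 2) :
    (Sset x y ∩ Omega β).Nonempty := by
  obtain ⟨n, hn⟩ := mem_iUnion.1 hxy
  set A := (NT α)^[n] '' (Ico (α - 1) α ×ˢ ({0} : Set ℝ)) with hA
  set K := ⋃ m ∈ Iic (2 * n), closure ((NT β)^[m] '' (Ico (β - 1) β ×ˢ ({0} : Set ℝ))) with hK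
  have hKclosed : IsClosed K := (finite_Iic (2 * n)).isClosed_biUnion fun _ _ => isClosed_closure
  have hKΩ : K ⊆ Omega β := iUnion₂_subset fun m _ =>
    subset_iUnion (fun m => closure ((NT β)^[m] '' (Ico (β - 1) β ×ˢ ({0} : Set ℝ)))) m
  have hAprop : ∀ p ∈ A, -(1 / 2) ≤ p.2 ∧
      (p.2 < 1 - 1 / Real.sqrt 2 → (Sset p.1 p.2 ∩ K).Nonempty) := by
    rintro _ ⟨⟨t, s⟩, ⟨ht, rfl⟩, rfl⟩
    obtain ⟨x, y, hxy, hb, p, ⟨-, m, hm, hpm⟩, hs⟩ := exists_shadow_iterate hgα hαβ hβ ht n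
    rw [hxy]
    refine ⟨hb.lower, fun hlt => ⟨p, ?_, mem_biUnion hm (subset_closure hpm)⟩⟩
    exact hs.resolve_right fun h => h.1.not_gt hlt
  have hy2 : -(1 / 2) ≤ y :=
    closure_minimal (fun p hp => (hAprop p hp).1)
      (isClosed_le continuous_const continuous_snd) hn
  have hc : 1 / Real.sqrt 2 > 0 := by positivity
  have hfreq : ∃ᶠ p : ℝ × ℝ in nhds (x, y), p.2 < 1 - 1 / Real.sqrt 2 ∧ p ∈ A :=
    (mem_closure_iff_frequently.1 hn).and_eventually
      ((isOpen_lt continuous_snd continuous_const).mem_nhds hy) |>.mono fun _ h => ⟨h.2, h.1⟩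
  have key : ∃ᶠ p : ℝ × ℝ in nhds (x, y), p ∈ K ∨ (-p.1, -p.2) ∈ K ∨
      (p.1 + 1, p.2 / (1 - p.2)) ∈ K ∨ (1 - p.1, -p.2 / (p.2 + 1)) ∈ K := by
    refine hfreq.mono fun p hp => ?_
    obtain ⟨q, rfl | rfl | rfl | rfl, hq⟩ := (hAprop p hp.2).2 hp.1 <;> tauto
  have hmem (f : ℝ × ℝ → ℝ × ℝ) (hf : ContinuousAt f (x, y))
      (h : ∃ᶠ p in nhds (x, y), f p ∈ K) (hS : f (x, y) ∈ Sset x y) :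
      (Sset x y ∩ Omega β).Nonempty :=
    ⟨_, hS, hKΩ (hKclosed.mem_of_frequently_of_tendsto h hf)⟩
  simp only [Filter.frequently_or_distrib] at key
  have hd1 : 1 - y ≠ 0 := by linarith
  have hd2 : y + 1 ≠ 0 := by linarith
  rcases key with h | h | h | h
  · exact hmem id continuousAt_id h (Or.inl rfl)
  · exact hmem (fun p => (-p.1, -p.2)) (by fun_prop) h (Or.inr (Or.inl rfl))
  · exact hmem (fun p => (p.1 + 1, p.2 / (1 - p.2)))
      (by fun_prop (disch := exact hd1)) h (Or.inr (Or.inr (Or.inl rfl)))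
  · exact hmem (fun p => (1 - p.1, -p.2 / (p.2 + 1)))
      (by fun_prop (disch := exact hd2)) h (Or.inr (Or.inr (Or.inr rfl)))
end
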